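/- For every integer L, N₋₁(L) = 3·C(L−2, 1) + 3·C(L−1, 1) + 6·C(L−2, 2). In particular, N₋₁(L) = 3L² − 9L + 9 for every integer L ≥ 3. -/

import Mathlib

open scoped Classical

abbrev SL2Z := Matrix.SpecialLinearGroup (Fin 2) ℤ

def Amat : SL2Z := ⟨!![1, 2; 0, 1], by norm_num [Matrix.det_fin_two_of]⟩
def Bmat : SL2Z := ⟨!![1, 0; -2, 1], by norm_num [Matrix.det_fin_two_of]⟩
def Cmat : SL2Z := (Amat * Bmat)⁻¹

def Gamma : Subgroup SL2Z := Subgroup.closure {Amat, Bmat}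

/-- The real entry `i j` of a matrix in `SL₂(ℤ)`. -/
def entry (g : SL2Z) (i j : Fin 2) : ℝ := ((g : Matrix (Fin 2) (Fin 2) ℤ) i j : ℤ)

/-- The Möbius action of `SL₂(ℤ)` on the circle `ℝ ∪ {∞}`. -/
noncomputable def mobius (g : SL2Z) (p : OnePoint ℝ) : OnePoint ℝ :=
  Option.rec (motive := fun _ => OnePoint ℝ)
    (if entry g 1 0 = 0 then OnePoint.infty
     else OnePoint.some (entry g 0 0 / entry g 1 0))
    (fun x => if entry g 1 0 * x + entry g 1 1 = 0 then OnePoint.infty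
      else OnePoint.some ((entry g 0 0 * x + entry g 0 1) / (entry g 1 0 * x + entry g 1 1)))
    p

/-- The fixed-point set of `g` acting on the circle `ℝ ∪ {∞}`. -/
noncomputable def fixedSet (g : SL2Z) : Set (OnePoint ℝ) := {p | mobius g p = p}

/-- `g` is hyperbolic if `|trace g| > 2`. -/
def Hyperbolic (g : SL2Z) : Prop := 2 < |Matrix.trace (g : Matrix (Fin 2) (Fin 2) ℤ)|

/-- Two two-element subsets of the circle are linked if the two points of `Q` lie in
different connected components of the complement of `P`. -/
def Linked (P Q : Set (OnePoint ℝ)) : Prop :=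
  ∃ q₁ q₂ : OnePoint ℝ, q₁ ≠ q₂ ∧ Q = {q₁, q₂} ∧
    connectedComponentIn Pᶜ q₁ ≠ connectedComponentIn Pᶜ q₂

/-- `h` contributes to the count `s(v)`: `v` and `h * v * h⁻¹` are hyperbolic with
linked fixed-point sets. -/
def GoodConj (v h : Gamma) : Prop :=
  Hyperbolic (v : SL2Z) ∧ Hyperbolic ((h * v * h⁻¹ : Gamma) : SL2Z) ∧
    Linked (fixedSet (v : SL2Z)) (fixedSet ((h * v * h⁻¹ : Gamma) : SL2Z))

/-- Twice `s(v)`: the number of double cosets `⟨v⟩ h ⟨v⟩` in `Γ` such that `v` and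
`h * v * h⁻¹` are hyperbolic with linked fixed-point sets. -/
noncomputable def sTwo (v : Gamma) : ℕ :=
  Nat.card (Quot (fun h h' : {h : Gamma // GoodConj v h} =>
    ∃ m k : ℤ, (h' : Gamma) = v ^ m * (h : Gamma) * v ^ k))

/-- `v` is not a proper power in `Γ`. -/
def NotProperPower (v : Gamma) : Prop := ¬ ∃ u : Gamma, ∃ k : ℕ, 2 ≤ k ∧ v = u ^ k

/-- The self-intersection number `I(g) = n² s(v) + n - 1`, where `g = vⁿ` with `v` not a
proper power and `n ≥ 1`, and `s(v)` is half the number of good double cosets. -/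
noncomputable def Iγ (g : Gamma) : ℤ :=
  if h : ∃ p : Gamma × ℕ, 1 ≤ p.2 ∧ NotProperPower p.1 ∧ g = p.1 ^ p.2 then
    (h.choose.2 : ℤ) ^ 2 * ((sTwo h.choose.1 / 2 : ℕ) : ℤ) + (h.choose.2 : ℤ) - 1
  else 0
/-- The three-letter alphabet `{x, y, z}`. -/
inductive Letter | x | y | z
deriving DecidableEq

/-- The letter of `w` at cyclic position `i`. -/
def cget (w : List Letter) (i : ℕ) : Letter := w.getD (i % w.length) Letter.x

/-- `w` is cyclically reduced: nonempty, and any two cyclically consecutive letters differ. -/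
def CyclRed (w : List Letter) : Prop :=
  w ≠ [] ∧ ∀ i : ℕ, i < w.length → cget w i ≠ cget w (i + 1)

/-- The matrix assigned to a consecutive pair of letters:
`xy ↦ A`, `yx ↦ A⁻¹`, `yz ↦ B`, `zy ↦ B⁻¹`, `zx ↦ C`, `xz ↦ C⁻¹`. -/
def pairM : Letter → Letter → SL2Z
  | .x, .y => Amat
  | .y, .x => Amat⁻¹
  | .y, .z => Bmat
  | .z, .y => Bmat⁻¹
  | .z, .x => Cmat
  | .x, .z => Cmat⁻¹
  | _, _ => 1

/-- `φ(w)`: group the letters of `w` into consecutive pairs and multiply the matrices. -/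
def phiM : List Letter → SL2Z
  | [] => 1
  | [_] => 1
  | a :: b :: t => pairM a b * phiM t

lemma pairM_mem (a b : Letter) : pairM a b ∈ Gamma := by
  have hA : Amat ∈ Gamma := Subgroup.subset_closure (by simp)
  have hB : Bmat ∈ Gamma := Subgroup.subset_closure (by simp)
  have hC : Cmat ∈ Gamma := inv_mem (mul_mem hA hB)
  cases a <;> cases b <;>
    simp only [pairM] <;>
    first
      | exact hA | exact hB | exact hC
      | exact inv_mem hA | exact inv_mem hB | exact inv_mem hC
      | exact one_mem _

lemma phiM_mem : ∀ w : List Letter, phiM w ∈ Gamma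
  | [] => one_mem _
  | [_] => one_mem _
  | _ :: b :: t => mul_mem (pairM_mem _ b) (phiM_mem t)

/-- The self-intersection number of the word `w`. -/
noncomputable def Iw (w : List Letter) : ℤ := Iγ ⟨phiM w, phiM_mem w⟩

/-- The combinatorial length `L(w)` (half the number of letters). -/
def Lw (w : List Letter) : ℤ := (w.length : ℤ) / 2
/-- `w` is primitive: as a cyclic word it is not a `k`-fold concatenation of a
shorter word for any `k ≥ 2`. -/
def Primitive (w : List Letter) : Prop :=
  ¬ ∃ u : List Letter, ∃ k : ℕ, 2 ≤ k ∧ u.length < w.length ∧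
      ∃ j : ℕ, w.rotate j = (List.replicate k u).flatten

/-- `w` represents a class of `𝒢`: primitive, cyclically reduced, of even length at least 4. -/
def InG (w : List Letter) : Prop :=
  CyclRed w ∧ Primitive w ∧ 2 ∣ w.length ∧ 4 ≤ w.length

/-- Words representing classes of `𝒢`. -/
def GWord := {w : List Letter // InG w}

/-- `v` is obtained from `u`, or from its reversal, by a cyclic rotation through an
even number of places. -/
def WordEquiv (u v : List Letter) : Prop :=
  ∃ k : ℕ, 2 ∣ k ∧ (v = u.rotate k ∨ v = u.reverse.rotate k)

def GEquiv (u v : GWord) : Prop := WordEquiv u.1 v.1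

/-- The set `𝒢` of equivalence classes. -/
def GClass := Quot GEquiv

/-- The defect `δ(w) = I(w) - L(w)`. -/
noncomputable def deltaW (w : List Letter) : ℤ := Iw w - Lw w

/-- `N_δ(L)`: the number of classes `[w] ∈ 𝒢` with `L(w) = L` and `δ(w) = δ`. -/
noncomputable def Ncount (d L : ℤ) : ℕ :=
  Nat.card {c : GClass // ∃ w : GWord, Quot.mk GEquiv w = c ∧ Lw w.1 = L ∧ deltaW w.1 = d}
/-- The positions `i, i+1, …, i+len-1` (cyclically) form a run of `w`: a maximal cyclic
interval whose letters lie in a two-element subset of `{x, y, z}`. -/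
def RunAt (w : List Letter) (i len : ℕ) : Prop :=
  i < w.length ∧ 2 ≤ len ∧ len < w.length ∧
  (∃ T : Finset Letter, T.card = 2 ∧ ∀ j, j < len → cget w (i + j) ∈ T) ∧
  ¬ (∃ T : Finset Letter, T.card = 2 ∧ ∀ j, j < len + 1 → cget w (i + j) ∈ T) ∧
  ¬ (∃ T : Finset Letter, T.card = 2 ∧ ∀ j, j < len + 1 → cget w (i + w.length - 1 + j) ∈ T)

/-- The type of the run starting at position `i`: the two-element subset of letters it uses. -/
def runType (w : List Letter) (i : ℕ) : Finset Letter := {cget w i, cget w (i + 1)}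

/-- The expansion `w⁺[r]` of `w` at the run starting at position `i`: repeat the
first two letters of the run. -/
def expandAt (w : List Letter) (i : ℕ) : List Letter :=
  w.take i ++ [cget w i, cget w (i + 1)] ++ w.drop i

/-- The contraction `w⁻[r]` of `w` at the run starting at position `i`: delete the
first two letters of the run. -/
def contractAt (w : List Letter) (i : ℕ) : List Letter :=
  if i + 1 < w.length then w.take i ++ w.drop (i + 2)
  else (w.drop 1).dropLast

/-- The run at `(i, len)` is distinguished: strictly longer than every other run of the
same type. -/
def DistinguishedRun (w : List Letter) (i len : ℕ) : Prop :=
  RunAt w i len ∧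
    ∀ i' len', RunAt w i' len' → runType w i' = runType w i → i' ≠ i → len' < len

/-- The rank `ρ(w)`: the number of distinguished runs of `w`. -/
noncomputable def rank (w : List Letter) : ℕ :=
  Nat.card {p : ℕ × ℕ // DistinguishedRun w p.1 p.2}

/-- The motif condition: every run `r` with `ℓ(r) ≥ 4` admits another run `s` of the same
type with `ℓ(r) ≤ ℓ(s) + 2`. -/
def MotifCond (w : List Letter) : Prop :=
  ∀ i len, RunAt w i len → 4 ≤ len →
    ∃ i' len', RunAt w i' len' ∧ runType w i' = runType w i ∧ i' ≠ i ∧ len ≤ len' + 2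

/-- The binomial coefficient `C(n, k)` with the convention that it vanishes when `n` or `k`
is negative, except `C(-1, -1) = 1`. -/
def binC (n k : ℤ) : ℤ :=
  if n = -1 ∧ k = -1 then 1
  else if 0 ≤ n ∧ 0 ≤ k then (n.toNat.choose k.toNat : ℤ)
  else 0

/-- The word-level descendants of `w`: the smallest collection containing `w` and closed
under expansion at distinguished runs. -/
inductive Desc (w : List Letter) : List Letter → Prop
  | base : Desc w w
  | step (v : List Letter) (i len : ℕ) :
      Desc w v → DistinguishedRun v i len → Desc w (expandAt v i)

namespace Geo

section

def nxt : Letter → Letter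
  | .x => .y
  | .y => .z
  | .z => .x

def prv : Letter → Letter
  | .x => .z
  | .y => .x
  | .z => .y

/-- Position of a letter in the linear order `prv p < p < nxt p`. -/
def ordp : Letter → Letter → ℕ
  | .x, .x => 1
  | .x, .y => 2
  | .x, .z => 0
  | .y, .x => 0
  | .y, .y => 1
  | .y, .z => 2
  | .z, .x => 2
  | .z, .y => 0
  | .z, .z => 1

def betw {K : Type*} [LinearOrder K] (a b c : K) : Prop := (a < c ∧ c < b) ∨ (b < c ∧ c < a)

/-- The chords `{a, b}` and `{c, d}` interleave. -/
def Cr {K : Type*} [LinearOrder K] (a b c d : K) : Prop := ¬ (betw a b c ↔ betw a b d)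

section Interleave
variable {K : Type*} [LinearOrder K]

lemma cr_swap_right (a b c d : K) : Cr a b d c ↔ Cr a b c d := by
  unfold Cr; tauto

lemma betw_swap (a b c : K) : betw b a c ↔ betw a b c := by
  unfold betw; tauto

lemma cr_swap_left (a b c d : K) : Cr b a c d ↔ Cr a b c d := by
  unfold Cr; rw [betw_swap a b c, betw_swap a b d]

lemma cr_same_sides {a b c d : K} (hac : a ≠ c) (hbd : b ≠ d)
    (h : (a < b ∧ a < d ∧ c < b ∧ c < d) ∨ (b < a ∧ d < a ∧ b < c ∧ d < c)) :
    Cr a b c d ↔ (a < c ↔ b < d) := by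
  unfold Cr betw
  rcases lt_or_gt_of_ne hac with h1 | h1 <;> rcases lt_or_gt_of_ne hbd with h2 | h2 <;>
    rcases h with ⟨h3, h4, h5, h6⟩ | ⟨h3, h4, h5, h6⟩ <;>
    simp [h1, h2, h4, h5, h1.not_gt, h2.not_gt, h4.not_gt, h5.not_gt]

lemma cr_one_side {κ κ' μ μ' : K} {p a b b' : Letter} (hne : κ ≠ κ')
    (hab : a ≠ b) (hab' : a ≠ b') (hbb : b ≠ b')
    (h1 : ordp p a < ordp p b → κ < μ ∧ κ' < μ) (h2 : ordp p b < ordp p a → μ < κ ∧ μ < κ')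
    (h3 : ordp p a < ordp p b' → κ < μ' ∧ κ' < μ') (h4 : ordp p b' < ordp p a → μ' < κ ∧ μ' < κ')
    (h5 : ordp p b < ordp p b' → μ < μ') (h6 : ordp p b' < ordp p b → μ' < μ) :
    Cr κ μ κ' μ' ↔ (κ < κ' ↔ b = nxt a) := by
  unfold Cr betw
  rcases lt_or_gt_of_ne hne with h | h <;>
  cases p <;> cases a <;> cases b <;> cases b' <;> simp_all [ordp, nxt, not_lt_of_gt, le_of_lt]

end Interleave

end

section

/-- `W` is the bi-infinite periodic word of a primitive cyclically reduced word of even length. -/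
structure Cur (W : ℤ → Letter) (n : ℤ) : Prop where
  pos : 0 < n
  even : n % 2 = 0
  per : ∀ i, W (i + n) = W i
  red : ∀ i, W i ≠ W (i + 1)
  prim : ∀ d, (∀ i, W (i + d) = W i) → n ∣ d

/-- Positions of the points of a diagram on the boundary of a triangle: the three sides are
blocks, ordered cyclically. -/
structure Diag {K : Type*} [LinearOrder K] (W : ℤ → Letter) (n : ℤ) (p : Letter) (κ : ℤ → K) :
    Prop where
  mono : ∀ i j, ordp p (W i) < ordp p (W j) → κ i < κ j
  per : ∀ i, κ (i + n) = κ i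
  inj : ∀ i j, κ i = κ j → n ∣ i - j

lemma per_mul {α : Type*} {f : ℤ → α} {n : ℤ} (h : ∀ i, f (i + n) = f i) (i m : ℤ) :
    f (i + n * m) = f i := by
  induction m using Int.induction_on generalizing i with
  | zero => simp
  | succ k ih => rw [show i + n * ((k : ℤ) + 1) = (i + n * k) + n by ring, h, ih]
  | pred k ih => rw [← h (i + n * (-(k : ℤ) - 1)), ← ih i]; congr 1; ring

lemma per_dvd {α : Type*} {f : ℤ → α} {n : ℤ} (h : ∀ i, f (i + n) = f i) {i j : ℤ}
    (hd : n ∣ i - j) : f i = f j := by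
  obtain ⟨m, hm⟩ := hd
  rw [show i = j + n * m by linarith, per_mul h]

variable {W : ℤ → Letter} {n : ℤ}

lemma Cur.red' (hC : Cur W n) (i : ℤ) : W (i - 1) ≠ W i := by
  have := hC.red (i - 1); rwa [sub_add_cancel] at this

/-- The strand followed from vertex `j` forwards or backwards. -/
def st (j : ℤ) (ε : Bool) (k : ℤ) : ℤ := if ε then j + k else j - 1 - k

/-- The vertex reached from `j` after `k` steps. -/
def vx (j : ℤ) (ε : Bool) (k : ℤ) : ℤ := if ε then j + k else j - k

/-- Crossing of the chords at the vertices `i` and `j`. -/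
def VCr {K : Type*} [LinearOrder K] (κ : ℤ → K) (i j : ℤ) : Prop :=
  Cr (κ (i - 1)) (κ i) (κ (j - 1)) (κ j)

lemma vcr_vx {K : Type*} [LinearOrder K] (κ : ℤ → K) (i j k : ℤ) (ε : Bool) :
    VCr κ i (vx j ε k) ↔ Cr (κ (i - 1)) (κ i) (κ (st j ε (k - 1))) (κ (st j ε k)) := by
  cases ε
  · simp only [VCr, vx, st, Bool.false_eq_true, if_false]
    rw [cr_swap_right, show j - 1 - (k - 1) = j - k by ring, show j - k - 1 = j - 1 - k by ring]
  · simp only [VCr, vx, st, if_true]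
    rw [show j + k - 1 = j + (k - 1) by ring]

/-- A maximal segment shared by the strands from `i` and from `j`. -/
structure Seg (W : ℤ → Letter) (n i j : ℤ) (ε : Bool) (s t : ℤ) : Prop where
  par : (i - j) % 2 = 0
  ndvd : ¬ n ∣ i - j
  lt : s < t
  ag : ∀ k, s ≤ k → k < t → W (i + k) = W (st j ε k)
  left : W (i + (s - 1)) ≠ W (st j ε (s - 1))
  right : W (i + t) ≠ W (st j ε t)

lemma st_red (hC : Cur W n) (j : ℤ) (ε : Bool) (k : ℤ) : W (st j ε (k - 1)) ≠ W (st j ε k) := by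
  cases ε
  · have := hC.red (j - 1 - k)
    simp only [st, Bool.false_eq_true, if_false]
    rw [show j - 1 - (k - 1) = j - 1 - k + 1 by ring]
    exact this.symm
  · have := hC.red (j + (k - 1))
    simp only [st, if_true]
    rwa [show j + (k - 1) + 1 = j + k by ring] at this

lemma agree_false (hC : Cur W n) {i j : ℤ} {ε : Bool} (hp : (i - j) % 2 = 0)
    (hn : ¬ n ∣ i - j) (h : ∀ k, W (i + k) = W (st j ε k)) : False := by
  cases ε
  · simp only [st, Bool.false_eq_true, if_false] at h
    have h1 := h ((j - i) / 2)
    have h2 := hC.red' (i + (j - i) / 2)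
    rw [h1] at h2
    apply h2; congr 1; omega
  · simp only [st, if_true] at h
    apply hn
    apply hC.prim
    intro k
    have := h (k - j)
    rw [show k + (i - j) = i + (k - j) by ring, this]; congr 1; ring

lemma agree_right_false (hC : Cur W n) {i j k₀ : ℤ} {ε : Bool} (hp : (i - j) % 2 = 0)
    (hn : ¬ n ∣ i - j) (h : ∀ k, k₀ ≤ k → W (i + k) = W (st j ε k)) : False := by
  apply agree_false (ε := ε) hC hp hn
  intro k
  have hk : k₀ ≤ k + n * |k₀ - k| := by
    have := hC.pos
    have h1 : |k₀ - k| ≤ n * |k₀ - k| := le_mul_of_one_le_left (abs_nonneg _) this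
    have := le_abs_self (k₀ - k)
    linarith
  have h2 := h _ hk
  rw [per_dvd hC.per (i := i + (k + n * |k₀ - k|)) (j := i + k) ⟨|k₀ - k|, by ring⟩] at h2
  rw [h2]
  apply per_dvd hC.per
  cases ε
  · exact ⟨-|k₀ - k|, by simp [st]⟩
  · exact ⟨|k₀ - k|, by simp [st]⟩

lemma agree_left_false (hC : Cur W n) {i j k₀ : ℤ} {ε : Bool} (hp : (i - j) % 2 = 0)
    (hn : ¬ n ∣ i - j) (h : ∀ k, k ≤ k₀ → W (i + k) = W (st j ε k)) : False := by
  apply agree_false (ε := ε) hC hp hn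
  intro k
  have hk : k + n * (-|k - k₀|) ≤ k₀ := by
    have := hC.pos
    have h1 : |k - k₀| ≤ n * |k - k₀| := le_mul_of_one_le_left (abs_nonneg _) this
    have := le_abs_self (k - k₀)
    linarith
  have h2 := h _ hk
  rw [per_dvd hC.per (i := i + (k + n * (-|k - k₀|))) (j := i + k) ⟨-|k - k₀|, by ring⟩] at h2
  rw [h2]
  apply per_dvd hC.per
  cases ε
  · exact ⟨|k - k₀|, by simp [st]⟩
  · exact ⟨-|k - k₀|, by simp [st]⟩

lemma exists_first_right {p : ℤ → Prop} {k₀ : ℤ} (h : ∃ k, k₀ ≤ k ∧ p k) :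
    ∃ t, k₀ ≤ t ∧ p t ∧ ∀ k, k₀ ≤ k → k < t → ¬ p k := by
  obtain ⟨k, hk, hpk⟩ := h
  have hex : ∃ m : ℕ, p (k₀ + m) := ⟨(k - k₀).toNat, by rw [Int.toNat_of_nonneg (by omega)]; simpa⟩
  refine ⟨k₀ + Nat.find hex, by omega, Nat.find_spec hex, fun l hl hlt hpl => ?_⟩
  refine Nat.find_min hex (m := (l - k₀).toNat) (by omega) ?_
  rw [Int.toNat_of_nonneg (by omega)]; simpa

lemma exists_first_left {p : ℤ → Prop} {k₀ : ℤ} (h : ∃ k, k ≤ k₀ ∧ p k) :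
    ∃ t, t ≤ k₀ ∧ p t ∧ ∀ k, k ≤ k₀ → t < k → ¬ p k := by
  obtain ⟨k, hk, hpk⟩ := h
  obtain ⟨t, h1, h2, h3⟩ := exists_first_right (p := fun k => p (-k)) (k₀ := -k₀)
    ⟨-k, by omega, by simpa⟩
  exact ⟨-t, by omega, h2, fun l hl hlt => by simpa using h3 (-l) (by omega) (by omega)⟩

lemma exists_seg (hC : Cur W n) {i j k₀ : ℤ} {ε : Bool} (hp : (i - j) % 2 = 0)
    (hn : ¬ n ∣ i - j) (h : W (i + k₀) = W (st j ε k₀)) :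
    ∃ s t, s ≤ k₀ ∧ k₀ < t ∧ Seg W n i j ε s t := by
  obtain ⟨t, h1, h2, h3⟩ : ∃ t, k₀ ≤ t ∧ W (i + t) ≠ W (st j ε t) ∧
      ∀ k, k₀ ≤ k → k < t → ¬ W (i + k) ≠ W (st j ε k) := by
    apply exists_first_right
    by_contra hcon
    push Not at hcon
    exact agree_right_false hC hp hn hcon
  obtain ⟨s, h4, h5, h6⟩ : ∃ t, t ≤ k₀ ∧ W (i + t) ≠ W (st j ε t) ∧
      ∀ k, k ≤ k₀ → t < k → ¬ W (i + k) ≠ W (st j ε k) := by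
    apply exists_first_left
    by_contra hcon
    push Not at hcon
    exact agree_left_false hC hp hn hcon
  have ht : t ≠ k₀ := fun h' => h2 (h' ▸ h)
  have hs : s ≠ k₀ := fun h' => h5 (h' ▸ h)
  refine ⟨s + 1, t, by omega, by omega, hp, hn, by omega, fun k hk hk' => ?_, by simpa using h5, h2⟩
  rcases le_or_gt k₀ k with hle | hle
  · exact not_not.1 (h3 k hle hk')
  · exact not_not.1 (h6 k hle.le (by omega))

section Cross
variable {K : Type*} [LinearOrder K]

/-- Order of the two strands at edge `k`, normalised by parity. -/
def nd (κ : ℤ → K) (i j : ℤ) (ε : Bool) (k : ℤ) : Prop :=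
  κ (i + k) < κ (st j ε k) ↔ k % 2 = 0

def segEnd (W : ℤ → Letter) (i t : ℤ) : Prop := W (i + t) = nxt (W (i + (t - 1))) ↔ t % 2 = 0

def segStart (W : ℤ → Letter) (i s : ℤ) : Prop := W (i + (s - 1)) = nxt (W (i + s)) ↔ s % 2 ≠ 0

/-- Normalised order at the edges of a segment, extended by the two outer values. -/
def nde (W : ℤ → Letter) (κ : ℤ → K) (i j : ℤ) (ε : Bool) (s t k : ℤ) : Prop :=
  if k < s then segStart W i s else if k < t then nd κ i j ε k else segEnd W i t

variable {p : Letter} {κ : ℤ → K}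

lemma strand_ne (hC : Cur W n) (hD : Diag W n p κ) {i j : ℤ} {ε : Bool} (hp : (i - j) % 2 = 0)
    (hn : ¬ n ∣ i - j) (k : ℤ) : κ (i + k) ≠ κ (st j ε k) := by
  intro h
  have h1 := hD.inj _ _ h
  cases ε
  · obtain ⟨m, hm⟩ := h1
    obtain ⟨r, hr⟩ := Int.dvd_of_emod_eq_zero hC.even
    simp only [st, Bool.false_eq_true, if_false] at hm
    rw [hr, mul_assoc] at hm
    omega
  · apply hn; simpa [st] using h1

lemma ordp_lt_or {a b : Letter} (h : a ≠ b) : ordp p a < ordp p b ∨ ordp p b < ordp p a := by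
  cases p <;> cases a <;> cases b <;> simp_all [ordp]

lemma vcr_iff (hC : Cur W n) (hD : Diag W n p κ) {i j : ℤ} {ε : Bool} {s t : ℤ}
    (hS : Seg W n i j ε s t) {k : ℤ} (hs : s ≤ k) (ht : k ≤ t) :
    VCr κ (i + k) (vx j ε k) ↔ ¬ (nde W κ i j ε s t (k - 1) ↔ nde W κ i j ε s t k) := by
  have hm := hD.mono
  rw [vcr_vx, show i + k - 1 = i + (k - 1) by ring]
  have hr1 : W (i + (k - 1)) ≠ W (i + k) := by
    have := hC.red' (i + k); rwa [show i + k - 1 = i + (k - 1) by ring] at this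
  have hr2 := st_red hC j ε k
  have hne := strand_ne hC hD (ε := ε) hS.par hS.ndvd
  have hst := hS.lt
  rcases eq_or_lt_of_le hs with hs' | hs'
  · subst hs'
    have hag := hS.ag s le_rfl hst
    rw [cr_swap_left, cr_swap_right, cr_one_side (p := p) (a := W (i + s)) (b := W (i + (s - 1)))
      (b' := W (st j ε (s - 1))) (hne s) hr1.symm (by rw [hag]; exact hr2.symm) hS.left
      (fun h => ⟨hm _ _ h, hm _ _ (hag ▸ h)⟩) (fun h => ⟨hm _ _ h, hm _ _ (hag ▸ h)⟩)
      (fun h => ⟨hm _ _ h, hm _ _ (hag ▸ h)⟩) (fun h => ⟨hm _ _ h, hm _ _ (hag ▸ h)⟩)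
      (hm _ _) (hm _ _)]
    simp only [nde, segStart, nd, hst, if_true, lt_irrefl, if_false, sub_lt_self_iff, zero_lt_one]
    tauto
  rcases eq_or_lt_of_le ht with ht' | ht'
  · subst ht'
    have hag := hS.ag (k - 1) (by omega) (by omega)
    rw [cr_one_side (p := p) (a := W (i + (k - 1))) (b := W (i + k))
      (b' := W (st j ε k)) (hne (k - 1)) hr1 (by rw [hag]; exact hr2) hS.right
      (fun h => ⟨hm _ _ h, hm _ _ (hag ▸ h)⟩) (fun h => ⟨hm _ _ h, hm _ _ (hag ▸ h)⟩)
      (fun h => ⟨hm _ _ h, hm _ _ (hag ▸ h)⟩) (fun h => ⟨hm _ _ h, hm _ _ (hag ▸ h)⟩)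
      (hm _ _) (hm _ _)]
    have e1 : ¬ k - 1 < s := by omega
    have e2 : ¬ k < s := by omega
    have e3 : (k - 1) % 2 = 0 ↔ ¬ k % 2 = 0 := by omega
    simp only [nde, segEnd, nd, e1, e2, e3, lt_irrefl, if_false, sub_lt_self_iff, zero_lt_one, if_true]
    tauto
  · have hag := hS.ag (k - 1) (by omega) (by omega)
    have hag' := hS.ag k (by omega) (by omega)
    rw [cr_same_sides (hne (k - 1)) (hne k)]
    · have e1 : ¬ k - 1 < s := by omega
      have e2 : ¬ k < s := by omega
      have e4 : k - 1 < t := by omega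
      have e3 : (k - 1) % 2 = 0 ↔ ¬ k % 2 = 0 := by omega
      simp only [nde, nd, e1, e2, e3, e4, ht', if_false, if_true]
      tauto
    · rcases ordp_lt_or (p := p) hr1 with h | h
      · exact Or.inl ⟨hm _ _ h, hm _ _ (hag' ▸ h), hm _ _ (hag ▸ h), hm _ _ (hag ▸ hag' ▸ h)⟩
      · exact Or.inr ⟨hm _ _ h, hm _ _ (hag' ▸ h), hm _ _ (hag ▸ h), hm _ _ (hag ▸ hag' ▸ h)⟩

/-- If the outer values differ, some vertex of the segment is a crossing. -/
lemma exists_vcr (hC : Cur W n) (hD : Diag W n p κ) {i j : ℤ} {ε : Bool} {s t : ℤ}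
    (hS : Seg W n i j ε s t) (hne : ¬ (segStart W i s ↔ segEnd W i t)) :
    ∃ k, s ≤ k ∧ k ≤ t ∧ VCr κ (i + k) (vx j ε k) := by
  by_contra hcon
  push Not at hcon
  have key : ∀ m : ℕ, s + m ≤ t + 1 → (nde W κ i j ε s t (s - 1) ↔ nde W κ i j ε s t (s + m - 1)) := by
    intro m
    induction m with
    | zero => simp
    | succ m ih =>
      intro hm
      push_cast at hm ⊢
      have h1 := ih (by omega)
      have h2 := hcon (s + m) (by omega) (by omega)
      rw [vcr_iff hC hD hS (by omega) (by omega), not_not] at h2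
      rw [h1, h2]
      rw [show s + ((m : ℤ) + 1) - 1 = s + m by ring]
  have hst := hS.lt
  have h3 := key (t + 1 - s).toNat (by omega)
  rw [show s + ((t + 1 - s).toNat : ℤ) - 1 = t by omega] at h3
  apply hne
  simpa [nde, hst.not_gt] using h3

end Cross

end

section

variable {W : ℤ → Letter} {n : ℤ}

noncomputable def ahd (Q : ℤ → Letter) (k d : ℤ) : Bool :=
  xor (decide (Q (k + d) = nxt (Q (k + d - 1)))) (decide (d % 2 = 0))

noncomputable def bhd (Q : ℤ → Letter) (k d : ℤ) : Bool :=
  xor (decide (Q (k - d) = nxt (Q (k - d + 1)))) (decide (d % 2 = 0))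

noncomputable def dig (W : ℤ → Letter) (e : ℤ) (m : ℕ) : Bool :=
  if (m % 2 = 0 ↔ e % 2 = 1) then ahd W e (m / 2 + 1) else bhd W e (m / 2 + 1)

/-- The canonical position of a strand on its side. -/
noncomputable def can (W : ℤ → Letter) (e : ℤ) : ℕ ×ₗ Lex (ℕ → Bool) :=
  toLex (ordp .y (W e), toLex (dig W e))

lemma lex_lt_iff {a b : ℕ → Bool} {m : ℕ} (h : ∀ l < m, a l = b l) (hm : a m ≠ b m) :
    toLex a < toLex b ↔ b m = true := by
  constructor
  · rintro ⟨l, h1, h2⟩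
    change ∀ j, j < l → a j = b j at h1
    change a l < b l at h2
    rcases lt_trichotomy l m with hl | hl | hl
    · have := h l hl
      exact absurd this h2.ne
    · subst hl
      revert h2; cases a l <;> cases b l <;> simp_all
    · exact absurd (h1 m hl) hm
  · intro hb
    refine ⟨m, h, ?_⟩
    change a m < b m
    revert hm hb; cases a m <;> cases b m <;> simp

lemma dig_fst (i k : ℤ) (m : ℕ) : dig W (i + k) m =
    if (m % 2 = 0 ↔ (i + k) % 2 = 1) then ahd (fun l => W (i + l)) k (m / 2 + 1)
    else bhd (fun l => W (i + l)) k (m / 2 + 1) := by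
  unfold dig ahd bhd
  split_ifs <;> simp only [add_assoc, sub_eq_add_neg]

lemma dig_snd {i j : ℤ} (hp : (i - j) % 2 = 0) (ε : Bool) (k : ℤ) (m : ℕ) :
    dig W (st j ε k) m =
    if (m % 2 = 0 ↔ (i + k) % 2 = 1) then ahd (fun l => W (st j ε l)) k (m / 2 + 1)
    else bhd (fun l => W (st j ε l)) k (m / 2 + 1) := by
  cases ε
  · simp only [st, Bool.false_eq_true, if_false]
    unfold dig
    have e : ((m % 2 = 0 ↔ (j - 1 - k) % 2 = 1) ↔ ¬ (m % 2 = 0 ↔ (i + k) % 2 = 1)) := by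
      have : (j - 1 - k) % 2 = 1 ↔ ¬ (i + k) % 2 = 1 := by omega
      tauto
    rw [if_congr e rfl rfl, ite_not]
    unfold ahd bhd
    congr 1
    · congr 3
      · congr 1; ring
      · congr 2; ring
    · congr 3
      · congr 1; ring
      · congr 2; ring
  · simp only [st, if_true]
    have e : ((m % 2 = 0 ↔ (i + k) % 2 = 1) ↔ (m % 2 = 0 ↔ (j + k) % 2 = 1)) := by
      have : (j + k) % 2 = 1 ↔ (i + k) % 2 = 1 := by omega
      tauto
    rw [if_congr e rfl rfl, dig_fst]

lemma nxt_alt {a b c : Letter} (h1 : c ≠ a) (h2 : c ≠ b) (h3 : a ≠ b) :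
    a = nxt c ↔ ¬ b = nxt c := by
  cases a <;> cases b <;> cases c <;> simp_all [nxt]

lemma can_lt_iff {e f : ℤ} (h : W e = W f) :
    can W e < can W f ↔ toLex (dig W e) < toLex (dig W f) := by
  unfold can
  rw [Prod.Lex.toLex_lt_toLex]
  simp [h]

section
variable {i j : ℤ} {ε : Bool} {s t k : ℤ}

lemma ahd_agree (hS : Seg W n i j ε s t) (hs : s ≤ k) {d : ℤ} (hd : 1 ≤ d) (ht : k + d < t) :
    ahd (fun l => W (i + l)) k d = ahd (fun l => W (st j ε l)) k d := by
  unfold ahd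
  simp only [hS.ag (k + d) (by omega) ht, hS.ag (k + d - 1) (by omega) (by omega)]

lemma bhd_agree (hS : Seg W n i j ε s t) {d : ℤ} (hd : 1 ≤ d) (hs : s ≤ k - d)
    (ht : k < t) :
    bhd (fun l => W (i + l)) k d = bhd (fun l => W (st j ε l)) k d := by
  unfold bhd
  simp only [hS.ag (k - d) (by omega) (by omega), hS.ag (k - d + 1) (by omega) (by omega)]

lemma i_red (hC : Cur W n) (i k : ℤ) : W (i + (k - 1)) ≠ W (i + k) := by
  have := hC.red' (i + k); rwa [show i + k - 1 = i + (k - 1) by ring] at this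

lemma ahd_differ (hC : Cur W n) (hS : Seg W n i j ε s t) :
    (W (i + t) = nxt (W (i + (t - 1)))) ↔ ¬ (W (st j ε t) = nxt (W (st j ε (t - 1)))) := by
  have hst := hS.lt
  have hag := hS.ag (t - 1) (by omega) (by omega)
  rw [← hag]
  exact nxt_alt (i_red hC i t) (by rw [hag]; exact st_red hC j ε t) hS.right

lemma bhd_differ (hC : Cur W n) (hS : Seg W n i j ε s t) :
    (W (i + (s - 1)) = nxt (W (i + s))) ↔ ¬ (W (st j ε (s - 1)) = nxt (W (st j ε s))) := by
  have hst := hS.lt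
  have hag := hS.ag s (by omega) (by omega)
  rw [← hag]
  exact nxt_alt (i_red hC i s).symm (by rw [hag]; exact (st_red hC j ε s).symm) hS.left

lemma can_order (hC : Cur W n) (hS : Seg W n i j ε s t) (hs : s ≤ k) (ht : k < t) :
    can W (i + k) ≠ can W (st j ε k) ∧
    (2 * k + 1 > s + t → (nd (can W) i j ε k ↔ segEnd W i t)) ∧
    (2 * k + 1 < s + t → (nd (can W) i j ε k ↔ segStart W i s)) ∧
    ((nd (can W) i j ε k ↔ segEnd W i t) ∨ (nd (can W) i j ε k ↔ segStart W i s)) := by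
  have hag := hS.ag k hs ht
  obtain ⟨mA, hA1, hA2⟩ : ∃ mA : ℕ, (mA / 2 + 1 : ℤ) = t - k ∧ (mA % 2 = 0 ↔ (i + k) % 2 = 1) := by
    rcases Int.emod_two_eq_zero_or_one (i + k) with h | h
    · exact ⟨(2 * (t - k - 1) + 1).toNat, by omega, by omega⟩
    · exact ⟨(2 * (t - k - 1)).toNat, by omega, by omega⟩
  obtain ⟨mB, hB1, hB2⟩ : ∃ mB : ℕ, (mB / 2 + 1 : ℤ) = k - s + 1 ∧
      ¬ (mB % 2 = 0 ↔ (i + k) % 2 = 1) := by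
    rcases Int.emod_two_eq_zero_or_one (i + k) with h | h
    · exact ⟨(2 * (k - s)).toNat, by omega, by omega⟩
    · exact ⟨(2 * (k - s) + 1).toNat, by omega, by omega⟩
  have hag' : ∀ m : ℕ, m < mA → m < mB → dig W (i + k) m = dig W (st j ε k) m := by
    intro m h1 h2
    rw [dig_fst, dig_snd hS.par]
    split_ifs with hm
    · exact ahd_agree hS hs (by omega) (by omega)
    · exact bhd_agree hS (by omega) (by omega) ht
  have hdA := ahd_differ hC hS
  have hdB := bhd_differ hC hS
  have hne : mA ≠ mB := fun h => hB2 (h ▸ hA2)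
  rcases lt_or_gt_of_ne hne with hlt | hlt
  · have hE : can W (i + k) ≠ can W (st j ε k) ∧ (nd (can W) i j ε k ↔ segEnd W i t) := by
      have h1 : dig W (i + k) mA = ahd (fun l => W (i + l)) k (t - k) := by
        rw [dig_fst, if_pos hA2, hA1]
      have h2 : dig W (st j ε k) mA = ahd (fun l => W (st j ε l)) k (t - k) := by
        rw [dig_snd hS.par, if_pos hA2, hA1]
      simp only [ahd, add_sub_cancel] at h1 h2
      have hd : dig W (i + k) mA ≠ dig W (st j ε k) mA := by
        rw [h1, h2]
        by_cases hx : W (st j ε t) = nxt (W (st j ε (t - 1))) <;> simp [hx, hdA]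
      refine ⟨fun h => hd ?_, ?_⟩
      · have := congrArg (fun z => (ofLex z).2) h
        exact congrFun this mA
      · unfold nd segEnd
        rw [can_lt_iff hag, lex_lt_iff (fun l hl => hag' l hl (by omega)) hd, h2, hdA]
        by_cases hx : W (st j ε t) = nxt (W (st j ε (t - 1))) <;> simp [hx] <;> omega
    exact ⟨hE.1, fun _ => hE.2, fun h => by omega, Or.inl hE.2⟩
  · have hE : can W (i + k) ≠ can W (st j ε k) ∧ (nd (can W) i j ε k ↔ segStart W i s) := by
      have h1 : dig W (i + k) mB = bhd (fun l => W (i + l)) k (k - s + 1) := by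
        rw [dig_fst, if_neg hB2, hB1]
      have h2 : dig W (st j ε k) mB = bhd (fun l => W (st j ε l)) k (k - s + 1) := by
        rw [dig_snd hS.par, if_neg hB2, hB1]
      simp only [bhd, show k - (k - s + 1) = s - 1 by ring, sub_add_cancel] at h1 h2
      have hd : dig W (i + k) mB ≠ dig W (st j ε k) mB := by
        rw [h1, h2]
        by_cases hx : W (st j ε (s - 1)) = nxt (W (st j ε s)) <;> simp [hx, hdB]
      refine ⟨fun h => hd ?_, ?_⟩
      · have := congrArg (fun z => (ofLex z).2) h
        exact congrFun this mB
      · unfold nd segStart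
        rw [can_lt_iff hag, lex_lt_iff (fun l hl => hag' l (by omega) hl) hd, h2, hdB]
        by_cases hx : W (st j ε (s - 1)) = nxt (W (st j ε s)) <;> simp [hx] <;> omega
    exact ⟨hE.1, fun h => by omega, fun _ => hE.2, Or.inr hE.2⟩
end

lemma can_diag (hC : Cur W n) : Diag W n .y (can W) where
  mono i j h := by
    unfold can
    rw [Prod.Lex.toLex_lt_toLex]
    exact Or.inl h
  per i := by
    unfold can
    have h1 : ∀ a b : ℤ, a = b + n → W a = W b := fun a b h => by rw [h, hC.per]
    have : dig W (i + n) = dig W i := by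
      funext m
      unfold dig ahd bhd
      have hn := hC.even
      rw [h1 (i + n + ((m : ℤ) / 2 + 1)) (i + ((m : ℤ) / 2 + 1)) (by ring),
        h1 (i + n + ((m : ℤ) / 2 + 1) - 1) (i + ((m : ℤ) / 2 + 1) - 1) (by ring),
        h1 (i + n - ((m : ℤ) / 2 + 1)) (i - ((m : ℤ) / 2 + 1)) (by ring),
        h1 (i + n - ((m : ℤ) / 2 + 1) + 1) (i - ((m : ℤ) / 2 + 1) + 1) (by ring),
        show (i + n) % 2 = i % 2 by omega]
    rw [this, hC.per]
  inj i j h := by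
    by_contra hn
    have hW : W i = W j := by
      have := congrArg (fun z => (ofLex z).1) h
      simp only [can, ofLex_toLex] at this
      revert this; cases W i <;> cases W j <;> simp [ordp]
    rcases Int.emod_two_eq_zero_or_one (i - j) with hp | hp
    · obtain ⟨s, t, hs, ht, hS⟩ := exists_seg (k₀ := 0) (ε := true) hC hp hn (by simpa [st])
      have := (can_order hC hS hs ht).1
      simp [st] at this
      exact this h
    · have hn' : ¬ n ∣ i - (j + 1) := by
        intro hd
        obtain ⟨r, hr⟩ := Int.dvd_of_emod_eq_zero hC.even
        obtain ⟨m, hm⟩ := hd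
        rw [hr] at hm
        have : i - j = 1 + 2 * (r * m) := by linarith
        have h2 : (i - (j + 1)) = n * m := by rw [hr]; exact hm
        have hW2 : W (i + 0) = W (st (j + 1) false 0) := by simpa [st]
        have h3 : W i = W (j + 1) := per_dvd hC.per ⟨m, h2⟩
        exact hC.red j (hW ▸ h3)
      obtain ⟨s, t, hs, ht, hS⟩ := exists_seg (i := i) (j := j + 1) (k₀ := 0) (ε := false) hC
        (by omega) hn' (by simpa [st])
      have := (can_order hC hS hs ht).1
      simp [st] at this
      exact this h

section
variable {i j : ℤ} {ε : Bool} {s t k : ℤ}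

/-- In the canonical diagram the sequence of normalised orders changes at most once. -/
lemma can_nde (hC : Cur W n) (hS : Seg W n i j ε s t) {l : ℤ} (hs : s ≤ k) (hkl : k < l) (hl : l ≤ t)
    (hk : VCr (can W) (i + k) (vx j ε k)) (hcl : VCr (can W) (i + l) (vx j ε l)) : False := by
  have hD := can_diag hC
  rw [vcr_iff hC hD hS hs (by omega)] at hk
  rw [vcr_iff hC hD hS (by omega) hl] at hcl
  have h2 : ∀ m, s - 1 ≤ m → 2 * m + 1 < s + t → (nde W (can W) i j ε s t m ↔ segStart W i s) := by
    intro m h1 h2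
    unfold nde
    split_ifs with h3 h4
    · rfl
    · exact (can_order hC hS (by omega) h4).2.2.1 h2
    · omega
  have h3 : ∀ m, m ≤ t → 2 * m + 1 > s + t → (nde W (can W) i j ε s t m ↔ segEnd W i t) := by
    intro m h1 h2
    unfold nde
    have := hS.lt
    split_ifs with h3 h4
    · omega
    · exact (can_order hC hS (by omega) h4).2.1 h2
    · rfl
  have h4 : ∀ m, 2 * m + 1 = s + t → ((nde W (can W) i j ε s t m ↔ segEnd W i t) ∨
      (nde W (can W) i j ε s t m ↔ segStart W i s)) := by
    intro m h1
    have := hS.lt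
    unfold nde
    split_ifs with h3 h4
    · omega
    · exact (can_order hC hS (by omega) h4).2.2.2
    · omega
  rcases lt_trichotomy (2 * k + 1) (s + t) with h | h | h
  · exact hk (by rw [h2 _ (by omega) (by omega), h2 _ (by omega) h])
  · rcases h4 k h with h5 | h5
    · exact hcl (by rw [h3 l (by omega) (by omega)]; rcases eq_or_lt_of_le (show k ≤ l - 1 by omega) with e | e
                    · rw [← e, h5]
                    · rw [h3 _ (by omega) (by omega)])
    · exact hk (by rw [h2 _ (by omega) (by omega), h5])
  · exact hcl (by rw [h3 l (by omega) (by omega), h3 (l - 1) (by omega) (by omega)])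

lemma can_ne (hC : Cur W n) (hS : Seg W n i j ε s t) (hs : s ≤ k) (ht : k ≤ t)
    (hk : VCr (can W) (i + k) (vx j ε k)) : ¬ (segStart W i s ↔ segEnd W i t) := by
  intro heq
  have hD := can_diag hC
  rw [vcr_iff hC hD hS hs (by omega)] at hk
  have h2 : ∀ m, nde W (can W) i j ε s t m ↔ segStart W i s := by
    intro m
    unfold nde
    split_ifs with h3 h4
    · rfl
    · rcases (can_order hC hS (by omega) h4).2.2.2 with h | h
      · rw [h, heq]
      · exact h
    · exact heq.symm
  exact hk (by rw [h2, h2])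
end

end

section

section Circle
open Set Filter Topology OnePoint

lemma component_eq {P : Set (OnePoint ℝ)} {s : Set (OnePoint ℝ)} (hs : IsPreconnected s) (hP : s ⊆ Pᶜ)
    {q r : OnePoint ℝ} (hq : q ∈ s) (hr : r ∈ s) :
    connectedComponentIn Pᶜ q = connectedComponentIn Pᶜ r :=
  connectedComponentIn_eq (hs.subset_connectedComponentIn hq hP hr)

lemma inside_preconnected (a b : ℝ) : IsPreconnected ((↑) '' Ioo a b : Set (OnePoint ℝ)) :=
  isPreconnected_Ioo.image _ OnePoint.continuous_coe.continuousOn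

lemma outside_preconnected (a b : ℝ) :
    IsPreconnected (insert ∞ ((↑) '' Iio a) ∪ insert ∞ ((↑) '' Ioi b) : Set (OnePoint ℝ)) := by
  have h1 : ∞ ∈ closure ((↑) '' Iio a : Set (OnePoint ℝ)) := by
    have : Tendsto ((↑) : ℝ → OnePoint ℝ) atBot (𝓝 ∞) :=
      OnePoint.tendsto_coe_infty.mono_left (by
        rw [Filter.coclosedCompact_eq_cocompact]; exact atBot_le_cocompact)
    exact mem_closure_of_tendsto this ((eventually_lt_atBot a).mono fun x hx => ⟨x, hx, rfl⟩)
  have h2 : ∞ ∈ closure ((↑) '' Ioi b : Set (OnePoint ℝ)) := by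
    have : Tendsto ((↑) : ℝ → OnePoint ℝ) atTop (𝓝 ∞) :=
      OnePoint.tendsto_coe_infty.mono_left (by
        rw [Filter.coclosedCompact_eq_cocompact]; exact atTop_le_cocompact)
    exact mem_closure_of_tendsto this ((eventually_gt_atTop b).mono fun x hx => ⟨x, hx, rfl⟩)
  refine IsPreconnected.union ∞ (mem_insert _ _) (mem_insert _ _) ?_ ?_
  · exact (isPreconnected_Iio.image _ OnePoint.continuous_coe.continuousOn).subset_closure
      (subset_insert _ _) (insert_subset h1 subset_closure)
  · exact (isPreconnected_Ioi.image _ OnePoint.continuous_coe.continuousOn).subset_closure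
      (subset_insert _ _) (insert_subset h2 subset_closure)

lemma component_iff {a b c d : ℝ} (hab : a < b) (hac : a ≠ c) (had : a ≠ d) (hbc : b ≠ c)
    (hbd : b ≠ d) :
    connectedComponentIn ({(a : OnePoint ℝ), (b : OnePoint ℝ)}ᶜ) (c : OnePoint ℝ) =
      connectedComponentIn ({(a : OnePoint ℝ), (b : OnePoint ℝ)}ᶜ) (d : OnePoint ℝ) ↔
    (c ∈ Ioo a b ↔ d ∈ Ioo a b) := by
  constructor
  · intro h
    by_contra hne
    wlog hc : c ∈ Ioo a b generalizing c d
    · exact this had hac hbd hbc h.symm (fun h' => hne h'.symm) (by tauto)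
    have hd : d ∉ Ioo a b := by tauto
    have hdm : (d : OnePoint ℝ) ∈ connectedComponentIn ({(a : OnePoint ℝ), (b : OnePoint ℝ)}ᶜ)
        (c : OnePoint ℝ) := by
      rw [h]; apply mem_connectedComponentIn; simp [had.symm, hbd.symm]
    have hcm : (c : OnePoint ℝ) ∈ connectedComponentIn ({(a : OnePoint ℝ), (b : OnePoint ℝ)}ᶜ)
        (c : OnePoint ℝ) := by
      apply mem_connectedComponentIn; simp [hac.symm, hbc.symm]
    have hU : IsOpen ((↑) '' Ioo a b : Set (OnePoint ℝ)) :=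
      OnePoint.isOpenEmbedding_coe.isOpenMap _ isOpen_Ioo
    have hV : IsOpen (((↑) '' Icc a b : Set (OnePoint ℝ))ᶜ) :=
      OnePoint.isOpen_compl_image_coe.2 ⟨isClosed_Icc, isCompact_Icc⟩
    have hsub := connectedComponentIn_subset ({(a : OnePoint ℝ), (b : OnePoint ℝ)}ᶜ) (c : OnePoint ℝ)
    obtain ⟨r, -, ⟨r', hr', rfl⟩, hr2⟩ := (isPreconnected_connectedComponentIn
      (x := (c : OnePoint ℝ)) (F := ({(a : OnePoint ℝ), (b : OnePoint ℝ)}ᶜ))) _ _ hU hV (by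
        intro q hq
        have := hsub hq
        by_cases hq2 : q ∈ ((↑) '' Icc a b : Set (OnePoint ℝ))
        · obtain ⟨x, hx, rfl⟩ := hq2
          simp only [mem_compl_iff, mem_insert_iff, mem_singleton_iff, not_or, OnePoint.coe_eq_coe] at this
          exact Or.inl ⟨x, ⟨lt_of_le_of_ne hx.1 (Ne.symm this.1), lt_of_le_of_ne hx.2 this.2⟩, rfl⟩
        · exact Or.inr hq2) ⟨_, hcm, c, hc, rfl⟩ ⟨_, hdm, by
          rintro ⟨x, hx, hxd⟩
          rw [OnePoint.coe_eq_coe] at hxd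
          subst hxd
          exact hd ⟨lt_of_le_of_ne hx.1 had, lt_of_le_of_ne hx.2 hbd.symm⟩⟩
    exact hr2 ⟨r', Ioo_subset_Icc_self hr', rfl⟩
  · intro h
    by_cases hc : c ∈ Ioo a b
    · refine component_eq (inside_preconnected a b) ?_ ⟨c, hc, rfl⟩ ⟨d, h.1 hc, rfl⟩
      rintro _ ⟨x, hx, rfl⟩
      simp [hx.1.ne', hx.2.ne]
    · have hd : d ∉ Ioo a b := fun h' => hc (h.2 h')
      have key : ∀ e : ℝ, a ≠ e → b ≠ e → e ∉ Ioo a b →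
          (e : OnePoint ℝ) ∈ (insert ∞ ((↑) '' Iio a) ∪ insert ∞ ((↑) '' Ioi b) : Set (OnePoint ℝ)) := by
        intro e h1 h2 h3
        rcases lt_or_gt_of_ne h1 with h4 | h4
        · rcases lt_or_gt_of_ne h2 with h5 | h5
          · exact Or.inr (Or.inr ⟨e, h5, rfl⟩)
          · exact absurd ⟨h4, h5⟩ h3
        · exact Or.inl (Or.inr ⟨e, h4, rfl⟩)
      refine component_eq (outside_preconnected a b) ?_ (key c hac hbc hc) (key d had hbd hd)
      rintro q ((rfl | ⟨x, hx, rfl⟩) | (rfl | ⟨x, hx, rfl⟩))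
      · simp
      · have hx' : x < a := hx
        simp [hx'.ne, (hx'.trans hab).ne]
      · simp
      · have hx' : b < x := hx
        simp [hx'.ne', (hab.trans hx').ne']

lemma linked_coe {a b c d : ℝ} (hab : a ≠ b) (hcd : c ≠ d) (hac : a ≠ c) (had : a ≠ d) (hbc : b ≠ c)
    (hbd : b ≠ d) :
    Linked {(a : OnePoint ℝ), (b : OnePoint ℝ)} {(c : OnePoint ℝ), (d : OnePoint ℝ)} ↔ Cr a b c d := by
  wlog hlt : a < b generalizing a b
  · rw [Set.pair_comm, this hab.symm hbc hbd hac had (lt_of_le_of_ne (not_lt.1 hlt) hab.symm),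
      cr_swap_left]
  have hC : Cr a b c d ↔ ¬ (c ∈ Ioo a b ↔ d ∈ Ioo a b) := by
    simp only [Cr, betw, mem_Ioo]
    have h1 : ¬ (b < c ∧ c < a) := fun h => (hlt.trans (h.1.trans h.2)).false
    have h2 : ¬ (b < d ∧ d < a) := fun h => (hlt.trans (h.1.trans h.2)).false
    tauto
  rw [hC, ← component_iff hlt hac had hbc hbd]
  constructor
  · rintro ⟨q₁, q₂, hq, hQ, hne⟩ heq
    have hc : (c : OnePoint ℝ) ∈ ({q₁, q₂} : Set _) := hQ ▸ (by simp)
    have hd : (d : OnePoint ℝ) ∈ ({q₁, q₂} : Set _) := hQ ▸ (by simp)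
    have hcd' : (c : OnePoint ℝ) ≠ d := by simpa using hcd
    rw [mem_insert_iff, mem_singleton_iff] at hc hd
    rcases hc with hc | hc <;> rcases hd with hd | hd
    · exact hcd' (hc.trans hd.symm)
    · subst hc hd; exact hne heq
    · subst hc hd; exact hne heq.symm
    · exact hcd' (hc.trans hd.symm)
  · intro h
    exact ⟨_, _, by simpa using hcd, rfl, h⟩

lemma not_linked_self (P : Set (OnePoint ℝ)) : ¬ Linked P P := by
  rintro ⟨q₁, q₂, -, rfl, h⟩
  apply h
  rw [connectedComponentIn_eq_empty (by simp), connectedComponentIn_eq_empty (by simp)]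

end Circle

section Form

/-- Quadratic form whose zeros are the fixed directions of `M`. -/
def qf (M : Matrix (Fin 2) (Fin 2) ℤ) (t : ℝ) : ℝ :=
  (M 1 0 : ℝ) * t ^ 2 + ((M 1 1 : ℝ) - M 0 0) * t - M 0 1

/-- Discriminant-type pairing detecting linked axes. -/
def lam (M N : Matrix (Fin 2) (Fin 2) ℤ) : ℤ :=
  (2 * (M * N).trace - M.trace * N.trace) ^ 2 -
    (M.trace ^ 2 - 4 * M.det) * (N.trace ^ 2 - 4 * N.det)

lemma lam_roots {M N : Matrix (Fin 2) (Fin 2) ℤ} {p q r s : ℝ}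
    (hM : ∀ t, qf M t = M 1 0 * ((t - p) * (t - q))) (hN : ∀ t, qf N t = N 1 0 * ((t - r) * (t - s))) :
    (lam M N : ℝ) = 4 * (M 1 0 : ℝ) ^ 2 * (N 1 0 : ℝ) ^ 2 *
      (((p - r) * (q - r)) * ((p - s) * (q - s))) := by
  have h1 := hM 0
  have h2 := hM 1
  have h3 := hN 0
  have h4 := hN 1
  simp only [qf] at h1 h2 h3 h4
  have e1 : (M 0 1 : ℝ) = - M 1 0 * (p * q) := by linarith
  have e2 : (M 1 1 : ℝ) = M 0 0 - M 1 0 * (p + q) := by linarith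
  have e3 : (N 0 1 : ℝ) = - N 1 0 * (r * s) := by linarith
  have e4 : (N 1 1 : ℝ) = N 0 0 - N 1 0 * (r + s) := by linarith
  simp only [lam, Matrix.trace_fin_two, Matrix.det_fin_two, Matrix.mul_apply, Fin.sum_univ_two]
  push_cast
  rw [e1, e2, e3, e4]
  ring

lemma cr_iff_mul {a b c d : ℝ} (hac : a ≠ c) (had : a ≠ d) (hbc : b ≠ c)
    (hbd : b ≠ d) : Cr a b c d ↔ ((a - c) * (b - c)) * ((a - d) * (b - d)) < 0 := by
  have key : ∀ e, a ≠ e → b ≠ e → (betw a b e ↔ (a - e) * (b - e) < 0) := by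
    intro e h1 h2
    unfold betw
    rw [mul_neg_iff]
    constructor
    · rintro (⟨h, h'⟩ | ⟨h, h'⟩)
      · right; constructor <;> linarith
      · left; constructor <;> linarith
    · rintro (⟨h, h'⟩ | ⟨h, h'⟩)
      · right; constructor <;> linarith
      · left; constructor <;> linarith
  unfold Cr
  rw [key c hac hbc, key d had hbd]
  have h1 : (a - c) * (b - c) ≠ 0 := mul_ne_zero (sub_ne_zero.2 hac) (sub_ne_zero.2 hbc)
  have h2 : (a - d) * (b - d) ≠ 0 := mul_ne_zero (sub_ne_zero.2 had) (sub_ne_zero.2 hbd)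
  generalize (a - c) * (b - c) = u at *
  generalize (a - d) * (b - d) = v at *
  rw [mul_neg_iff]
  rcases lt_or_gt_of_ne h1 with h3 | h3 <;> rcases lt_or_gt_of_ne h2 with h4 | h4 <;>
    simp [h3, h4, h3.not_gt, h4.not_gt]

lemma lam_neg_iff {M N : Matrix (Fin 2) (Fin 2) ℤ} {p q r s : ℝ}
    (hM : ∀ t, qf M t = M 1 0 * ((t - p) * (t - q))) (hN : ∀ t, qf N t = N 1 0 * ((t - r) * (t - s)))
    (hM0 : M 1 0 ≠ 0) (hN0 : N 1 0 ≠ 0) (hpr : p ≠ r) (hps : p ≠ s) (hqr : q ≠ r)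
    (hqs : q ≠ s) : Cr p q r s ↔ lam M N < 0 := by
  rw [cr_iff_mul hpr hps hqr hqs]
  have h := lam_roots hM hN
  have hpos : (0 : ℝ) < 4 * (M 1 0 : ℝ) ^ 2 * (N 1 0 : ℝ) ^ 2 := by
    have : (M 1 0 : ℝ) ≠ 0 := by exact_mod_cast hM0
    have : (N 1 0 : ℝ) ≠ 0 := by exact_mod_cast hN0
    positivity
  rw [← Int.cast_lt (R := ℝ), h]
  constructor
  · intro h'; simpa using mul_neg_of_pos_of_neg hpos h'
  · intro h'
    by_contra hcon
    have := mul_nonneg hpos.le (not_lt.1 hcon)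
    push_cast at h'
    linarith

end Form

section Fix

lemma exists_roots {M : Matrix (Fin 2) (Fin 2) ℤ} (hdet : M.det = 1) (htr : 2 < |M.trace|) :
    M 1 0 ≠ 0 ∧ ∃ p q : ℝ, p ≠ q ∧ ∀ t, qf M t = M 1 0 * ((t - p) * (t - q)) := by
  rw [Matrix.det_fin_two] at hdet
  rw [Matrix.trace_fin_two] at htr
  have hc : M 1 0 ≠ 0 := by
    intro h
    rw [h, mul_zero, sub_zero] at hdet
    rcases Int.eq_one_or_neg_one_of_mul_eq_one' hdet with ⟨h1, h2⟩ | ⟨h1, h2⟩ <;>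
      rw [h1, h2] at htr <;> norm_num at htr
  refine ⟨hc, ?_⟩
  have hc' : (M 1 0 : ℝ) ≠ 0 := by exact_mod_cast hc
  have hD : (0 : ℝ) < ((M 0 0 : ℝ) + M 1 1) ^ 2 - 4 := by
    have h1 : (4 : ℤ) < (M 0 0 + M 1 1) ^ 2 := by
      rw [← sq_abs]; nlinarith
    have : ((4 : ℤ) : ℝ) < (((M 0 0 + M 1 1) ^ 2 : ℤ) : ℝ) := by exact_mod_cast h1
    push_cast at this; linarith
  have hdet' : (M 0 0 : ℝ) * M 1 1 - M 0 1 * M 1 0 = 1 := by exact_mod_cast hdet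
  set D := ((M 0 0 : ℝ) + M 1 1) ^ 2 - 4 with hDdef
  have hs := Real.sq_sqrt hD.le
  have hsp := Real.sqrt_pos.2 hD
  set σ := Real.sqrt D
  refine ⟨((M 0 0 : ℝ) - M 1 1 + σ) / (2 * M 1 0), ((M 0 0 : ℝ) - M 1 1 - σ) / (2 * M 1 0), ?_, ?_⟩
  · intro h
    field_simp at h
    linarith
  · intro t
    unfold qf
    field_simp
    have e : (σ : ℝ) ^ 2 = (M 0 0 - M 1 1) ^ 2 + 4 * (M 0 1 * M 1 0) := by
      rw [hs, hDdef]; linear_combination 4 * hdet'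
    linear_combination e

lemma fixedSet_eq (g : SL2Z) {p q : ℝ} (hc : (g : Matrix (Fin 2) (Fin 2) ℤ) 1 0 ≠ 0)
    (h : ∀ t, qf g t = (g : Matrix (Fin 2) (Fin 2) ℤ) 1 0 * ((t - p) * (t - q))) :
    fixedSet g = {(p : OnePoint ℝ), (q : OnePoint ℝ)} := by
  have hc' : entry g 1 0 ≠ 0 := by unfold entry; exact_mod_cast hc
  have hdet : entry g 0 0 * entry g 1 1 - entry g 0 1 * entry g 1 0 = 1 := by
    have := g.2
    rw [Matrix.det_fin_two] at this
    unfold entry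
    exact_mod_cast this
  ext P
  induction P using OnePoint.rec with
  | infty =>
    have h0 : mobius g OnePoint.infty = if entry g 1 0 = 0 then OnePoint.infty
      else OnePoint.some (entry g 0 0 / entry g 1 0) := rfl
    simp [fixedSet, h0, hc']
  | coe x =>
    have h0 : mobius g (x : OnePoint ℝ) = if entry g 1 0 * x + entry g 1 1 = 0 then OnePoint.infty
      else OnePoint.some ((entry g 0 0 * x + entry g 0 1) / (entry g 1 0 * x + entry g 1 1)) := rfl
    have h1 := h x
    have h1' : entry g 1 0 * x ^ 2 + (entry g 1 1 - entry g 0 0) * x - entry g 0 1 =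
      entry g 1 0 * ((x - p) * (x - q)) := h1
    have h2 : (x = p ∨ x = q) ↔
        entry g 1 0 * x ^ 2 + (entry g 1 1 - entry g 0 0) * x - entry g 0 1 = 0 := by
      rw [h1', mul_eq_zero, mul_eq_zero, sub_eq_zero, sub_eq_zero]; simp [hc']
    simp only [fixedSet, Set.mem_ofPred_eq, h0, Set.mem_insert_iff, Set.mem_singleton_iff,
      OnePoint.coe_eq_coe, h2]
    split_ifs with hz
    · simp only [OnePoint.infty_ne_coe, false_iff]
      intro h3
      have h4 : entry g 0 0 * x + entry g 0 1 = 0 := by linear_combination x * hz - h3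
      have : (1 : ℝ) = 0 := by
        linear_combination entry g 0 0 * hz - hdet - entry g 1 0 * h4
      exact one_ne_zero this
    · change ((_ : ℝ) : OnePoint ℝ) = _ ↔ _
      rw [OnePoint.coe_eq_coe, div_eq_iff hz]
      constructor <;> intro h3 <;> linear_combination -h3

lemma linked_iff_lam {g h : SL2Z} (hg : Hyperbolic g) (hh : Hyperbolic h)
    (h0 : lam g h ≠ 0) : Linked (fixedSet g) (fixedSet h) ↔ lam g h < 0 := by
  obtain ⟨hc, p, q, hpq, hq⟩ := exists_roots g.2 hg
  obtain ⟨hc', r, s, hrs, hs⟩ := exists_roots h.2 hh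
  have hl := lam_roots hq hs
  have hne : (lam g h : ℝ) ≠ 0 := by exact_mod_cast h0
  have e1 : p ≠ r := fun e => hne (by rw [hl, e]; ring)
  have e2 : p ≠ s := fun e => hne (by rw [hl, e]; ring)
  have e3 : q ≠ r := fun e => hne (by rw [hl, e]; ring)
  have e4 : q ≠ s := fun e => hne (by rw [hl, e]; ring)
  rw [fixedSet_eq g hc hq, fixedSet_eq h hc' hs, linked_coe hpq hrs e1 e2 e3 e4,
    lam_neg_iff hq hs hc hc' e1 e2 e3 e4]

end Fix

end

section

open Matrix

abbrev Mat := Matrix (Fin 2) (Fin 2) ℤ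

/-- Reflections in the sides of the ideal triangle. -/
def Rm : Letter → Mat
  | .x => !![-1, 2; 0, 1]
  | .y => !![-1, 0; 0, 1]
  | .z => !![-1, 0; -2, 1]

lemma Rm_sq (a : Letter) : Rm a * Rm a = 1 := by
  cases a <;> simp [Rm, Matrix.one_fin_two]

lemma Rm_det (a : Letter) : (Rm a).det = -1 := by
  cases a <;> simp [Rm, Matrix.det_fin_two]

def Rg (a : Letter) : GL (Fin 2) ℤ := ⟨Rm a, Rm a, Rm_sq a, Rm_sq a⟩

lemma Rg_mul_self (a : Letter) : Rg a * Rg a = 1 := Units.ext (Rm_sq a)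

lemma Rg_inv (a : Letter) : (Rg a)⁻¹ = Rg a := rfl

/-- Basis of the cone of the side `a`. -/
def Em : Letter → Mat
  | .x => !![1, 1; 1, 0]
  | .y => !![-1, 0; 0, 1]
  | .z => !![0, 1; 1, 1]

def Tm (a b : Letter) : Mat := if b = nxt a then !![0, 1; 1, 1] else !![1, 1; 1, 0]

lemma Rm_Em {a b : Letter} (h : a ≠ b) : ∃ σ : ℤ, (σ = 1 ∨ σ = -1) ∧
    Rm a * Em b = σ • (Em a * Tm a b) := by
  cases a <;> cases b <;> first
    | exact absurd rfl h
    | exact ⟨1, Or.inl rfl, by decide⟩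
    | exact ⟨-1, Or.inr rfl, by decide⟩

def PR (W : ℤ → Letter) (i : ℤ) : ℕ → Mat
  | 0 => 1
  | m + 1 => PR W i m * Rm (W (i + m))

def PT (W : ℤ → Letter) (i : ℤ) : ℕ → Mat
  | 0 => 1
  | m + 1 => PT W i m * Tm (W (i + m)) (W (i + m + 1))

variable {W : ℤ → Letter} {n : ℤ}

lemma PR_Em (h : ∀ i, W i ≠ W (i + 1)) (i : ℤ) (m : ℕ) : ∃ σ : ℤ, (σ = 1 ∨ σ = -1) ∧
    PR W i m * Em (W (i + m)) = σ • (Em (W i) * PT W i m) := by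
  induction m with
  | zero => exact ⟨1, Or.inl rfl, by simp [PR, PT]⟩
  | succ m ih =>
    obtain ⟨σ, hσ, h1⟩ := ih
    obtain ⟨τ, hτ, h2⟩ := Rm_Em (h (i + m))
    refine ⟨τ * σ, by rcases hσ with rfl | rfl <;> rcases hτ with rfl | rfl <;> simp, ?_⟩
    push_cast
    rw [← add_assoc, PR, mul_assoc, h2, mul_smul_comm, ← mul_assoc, h1, PT, smul_mul_assoc, mul_assoc,
      smul_smul]

lemma PT_add (i : ℤ) (m l : ℕ) : PT W i (m + l) = PT W i m * PT W (i + m) l := by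
  induction l with
  | zero => simp [PT]
  | succ l ih =>
    rw [← add_assoc, PT, ih, PT, mul_assoc]; push_cast; simp only [add_assoc]

lemma PT_det (i : ℤ) (m : ℕ) : (PT W i m).det = (-1) ^ m := by
  induction m with
  | zero => simp [PT]
  | succ m ih =>
    rw [PT, det_mul, ih, pow_succ]
    congr 1
    unfold Tm; split_ifs <;> simp [det_fin_two]

lemma PT_nonneg (i : ℤ) (m : ℕ) : (∀ a b, 0 ≤ PT W i m a b) ∧ ∀ a, 0 < PT W i m a 0 + PT W i m a 1 := by
  induction m with
  | zero => refine ⟨fun a b => ?_, fun a => ?_⟩ <;> fin_cases a <;> (try fin_cases b) <;> simp [PT, Matrix.one_apply]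
  | succ m ih =>
    obtain ⟨h1, h2⟩ := ih
    rw [PT]
    refine ⟨fun a b => ?_, fun a => ?_⟩
    · have := h1 a 0
      have := h1 a 1
      unfold Tm
      split_ifs <;> fin_cases b <;> simp [Matrix.mul_apply, Fin.sum_univ_two] <;> omega
    · have := h1 a 0
      have := h1 a 1
      have := h2 a
      unfold Tm
      split_ifs <;> simp [Matrix.mul_apply, Fin.sum_univ_two] <;> omega

lemma PT_pos (hr : ∀ i, W i ≠ W (i + 1)) {i : ℤ} {l : ℕ} (h : W (i + l) ≠ W (i + l + 2)) (m : ℕ) :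
    ∀ a b, 0 < PT W i (l + 2 + m) a b := by
  induction m with
  | zero =>
    intro a b
    obtain ⟨h1, h2⟩ := PT_nonneg (W := W) i l
    have g0 := h1 a 0
    have g1 := h1 a 1
    have g2 := h2 a
    have e1 := hr (i + l)
    have e2 := hr (i + l + 1)
    rw [add_zero, PT, PT]
    push_cast
    rw [← add_assoc i (l : ℤ) 1, show i + (l : ℤ) + 1 + 1 = i + l + 2 by ring]
    rw [show i + (l : ℤ) + 1 + 1 = i + l + 2 by ring] at e2
    generalize W (i + l) = A at *
    generalize W (i + l + 1) = B at *
    generalize W (i + l + 2) = C at *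
    have : (B = nxt A ∧ C = nxt B) ∨ (B ≠ nxt A ∧ C ≠ nxt B) := by
      cases A <;> cases B <;> cases C <;> simp_all [nxt]
    rcases this with ⟨e3, e4⟩ | ⟨e3, e4⟩
    · simp only [Tm, if_pos e3, if_pos e4]
      fin_cases b <;> simp [Matrix.mul_apply, Fin.sum_univ_two] <;> omega
    · simp only [Tm, if_neg e3, if_neg e4]
      fin_cases b <;> simp [Matrix.mul_apply, Fin.sum_univ_two] <;> omega
  | succ m ih =>
    intro a b
    have := ih a 0
    have := ih a 1
    rw [← add_assoc, PT]
    unfold Tm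
    split_ifs <;> fin_cases b <;> simp [Matrix.mul_apply, Fin.sum_univ_two] <;> omega

/-- The quadratic form of `M` has opposite signs at the two ends of the side `a`. -/
def ES : Letter → Mat → Prop
  | .y, M => M 1 0 * (-M 0 1) < 0
  | .z, M => (-M 0 1) * (M 1 0 + M 1 1 - M 0 0 - M 0 1) < 0
  | .x, M => M 1 0 * (M 1 0 + M 1 1 - M 0 0 - M 0 1) < 0

lemma es_of_conj {a : Letter} {M N : Mat} {σ : ℤ} (hσ : σ = 1 ∨ σ = -1)
    (h : M * Em a = σ • (Em a * N)) (h01 : 0 < N 0 1) (h10 : 0 < N 1 0) : ES a M ∧ M.trace = σ * N.trace := by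
  have e00 := congrFun (congrFun h 0) 0
  have e01 := congrFun (congrFun h 0) 1
  have e10 := congrFun (congrFun h 1) 0
  have e11 := congrFun (congrFun h 1) 1
  have hp := mul_pos h01 h10
  have hs : σ * σ = 1 := by rcases hσ with rfl | rfl <;> rfl
  cases a <;> simp [Em, Matrix.mul_apply, Matrix.vecMul, dotProduct, Fin.sum_univ_two] at e00 e01 e10 e11 <;>
    simp only [ES, Matrix.trace_fin_two]
  · refine ⟨?_, by linarith⟩
    have : M 1 0 = σ * N 0 1 := by linarith
    have h2 : M 1 0 + M 1 1 - M 0 0 - M 0 1 = - σ * N 1 0 := by linarith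
    rw [h2, this]
    have : σ * N 0 1 * (-σ * N 1 0) = - (N 0 1 * N 1 0) := by linear_combination (-N 0 1 * N 1 0) * hs
    omega
  · refine ⟨?_, by linarith⟩
    have : M 0 1 = - (σ * N 0 1) := by linarith
    have h2 : M 1 0 = - (σ * N 1 0) := by linarith
    rw [this, h2]
    have : -(σ * N 1 0) * (- -(σ * N 0 1)) = - (N 0 1 * N 1 0) := by
      linear_combination (-N 0 1 * N 1 0) * hs
    omega
  · refine ⟨?_, by linarith⟩
    have : M 0 1 = (σ * N 1 0) := by linarith
    have h2 : M 1 0 + M 1 1 - M 0 0 - M 0 1 = σ * N 0 1 := by linarith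
    rw [h2, this]
    have : -(σ * N 1 0) * (σ * N 0 1) = - (N 0 1 * N 1 0) := by
      linear_combination (-N 0 1 * N 1 0) * hs
    omega

lemma Cur.rev (hC : Cur W n) (c : ℤ) : Cur (fun k => W (c - k)) n where
  pos := hC.pos
  even := hC.even
  per i := by
    have := hC.per (c - (i + n))
    rw [show c - (i + n) + n = c - i by ring] at this; exact this.symm
  red i := by
    have := hC.red (c - (i + 1))
    rw [show c - (i + 1) + 1 = c - i by ring] at this; exact this.symm
  prim d h := by
    have := hC.prim (-d) (fun i => by
      have := h (c - i)
      simp only [sub_sub_cancel] at this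
      rwa [show c - (c - i + d) = i + -d by ring] at this)
    simpa using this

lemma Cur.change (hC : Cur W n) (h4 : 4 ≤ n) : ∃ k, W k ≠ W (k + 2) := by
  by_contra hcon
  push Not at hcon
  have := Int.le_of_dvd (by norm_num) (hC.prim 2 fun i => (hcon i).symm)
  omega

lemma PT_offdiag (hC : Cur W n) (h4 : 4 ≤ n) (i : ℤ) :
    0 < PT W i n.toNat 0 1 ∧ 0 < PT W i n.toNat 1 0 := by
  obtain ⟨k, hk⟩ := hC.change h4
  have hn : (n.toNat : ℤ) = n := Int.toNat_of_nonneg (by omega)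
  have hmod : ∀ j, W (i + (j - i) % n) = W j := fun j =>
    per_dvd hC.per ⟨-((j - i) / n), by
      have := Int.emod_add_mul_ediv (j - i) n
      linear_combination this⟩
  set l := ((k - i) % n).toNat with hl
  have hl0 : (l : ℤ) = (k - i) % n := Int.toNat_of_nonneg (Int.emod_nonneg _ (by omega))
  have hln : (l : ℤ) < n := hl0 ▸ Int.emod_lt_of_pos _ (by omega)
  have hch : W (i + l) ≠ W (i + l + 2) := by
    rw [hl0, hmod]
    have : W (i + (k - i) % n + 2) = W (k + 2) := per_dvd hC.per ⟨-((k - i) / n), by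
      have := Int.emod_add_mul_ediv (k - i) n
      linear_combination this⟩
    rwa [this]
  have hpos := PT_pos hC.red hch (n.toNat + n.toNat - (l + 2))
  rw [show l + 2 + (n.toNat + n.toNat - (l + 2)) = n.toNat + n.toNat by omega, PT_add] at hpos
  have hper : ∀ m, PT W (i + n.toNat) m = PT W i m := by
    intro m
    induction m with
    | zero => rfl
    | succ m ih =>
      have e : ∀ c : ℤ, W (i + n + c) = W (i + c) := fun c => by
        rw [show i + n + c = i + c + n by ring, hC.per]
      rw [PT, PT, ih, hn, add_assoc (i + n), e, e, add_assoc]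
  rw [hper] at hpos
  obtain ⟨h1, -⟩ := PT_nonneg (W := W) i n.toNat
  generalize PT W i n.toNat = N at *
  have p1 := hpos 0 1
  have p2 := hpos 1 0
  simp only [Matrix.mul_apply, Fin.sum_univ_two] at p1 p2
  have := h1 0 0
  have := h1 1 1
  have := h1 0 1
  have := h1 1 0
  constructor
  · rcases (h1 0 1).eq_or_lt with h | h
    · rw [← h] at p1; simp at p1
    · exact h
  · rcases (h1 1 0).eq_or_lt with h | h
    · rw [← h] at p2; simp at p2
    · exact h

lemma PR_hyp (hC : Cur W n) (h4 : 4 ≤ n) (i : ℤ) :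
    ES (W i) (PR W i n.toNat) ∧ 2 < |(PR W i n.toNat).trace| := by
  obtain ⟨σ, hσ, h⟩ := PR_Em hC.red i n.toNat
  have hn : (n.toNat : ℤ) = n := Int.toNat_of_nonneg (by omega)
  rw [hn, hC.per] at h
  obtain ⟨h01, h10⟩ := PT_offdiag hC h4 i
  obtain ⟨h1, h2⟩ := es_of_conj hσ h h01 h10
  refine ⟨h1, ?_⟩
  have hd := PT_det (W := W) i n.toNat
  rw [Even.neg_one_pow (by rw [Nat.even_iff]; have := hC.even; omega), det_fin_two] at hd
  obtain ⟨h3, -⟩ := PT_nonneg (W := W) i n.toNat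
  have g0 := h3 0 0
  have g1 := h3 1 1
  have : 2 < (PT W i n.toNat).trace := by
    rw [trace_fin_two]
    have := mul_pos h01 h10
    by_contra hcon
    have h5 : PT W i n.toNat 0 0 ≤ 2 := by omega
    have h6 : PT W i n.toNat 1 1 ≤ 2 - PT W i n.toNat 0 0 := by omega
    nlinarith [sq_nonneg (PT W i n.toNat 0 0 - 1), mul_le_mul_of_nonneg_left h6 g0]
  rw [h2, abs_mul, show |σ| = 1 by rcases hσ with rfl | rfl <;> simp, one_mul]
  exact lt_of_lt_of_le this (le_abs_self _)

/-- Partial products of the reflections along the word. -/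
def gpos (W : ℤ → Letter) : ℕ → GL (Fin 2) ℤ
  | 0 => 1
  | k + 1 => gpos W k * Rg (W k)

def gneg (W : ℤ → Letter) : ℕ → GL (Fin 2) ℤ
  | 0 => 1
  | k + 1 => gneg W k * Rg (W (-(k : ℤ) - 1))

def gg (W : ℤ → Letter) (i : ℤ) : GL (Fin 2) ℤ :=
  if 0 ≤ i then gpos W i.toNat else gneg W (-i).toNat

lemma gg_zero : gg W 0 = 1 := by simp [gg, gpos]

lemma gg_succ (i : ℤ) : gg W (i + 1) = gg W i * Rg (W i) := by
  rcases lt_trichotomy i (-1) with h | h | h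
  · obtain ⟨k, rfl⟩ : ∃ k : ℕ, i = -(k : ℤ) - 1 - 1 := ⟨(-i - 2).toNat, by omega⟩
    rw [gg, gg, if_neg (by omega), if_neg (by omega), show (-(-(k : ℤ) - 1 - 1)).toNat = k + 1 + 1 by omega,
      show (-(-(k : ℤ) - 1 - 1 + 1)).toNat = k + 1 by omega, gneg.eq_2 W (k + 1)]
    push_cast
    rw [show -((k : ℤ) + 1) - 1 = -(k : ℤ) - 1 - 1 by ring, mul_assoc, Rg_mul_self, mul_one]
  · subst h
    simp [gg, gpos, gneg, Rg_mul_self]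
  · obtain ⟨k, rfl⟩ : ∃ k : ℕ, i = k := ⟨i.toNat, by omega⟩
    rw [gg, gg, if_pos (by omega), if_pos (by omega), show ((k : ℤ) + 1).toNat = k + 1 by omega, gpos]
    simp

lemma gg_pred (i : ℤ) : gg W (i - 1) = gg W i * Rg (W (i - 1)) := by
  have := gg_succ (W := W) (i - 1)
  rw [sub_add_cancel] at this
  rw [this, mul_assoc, Rg_mul_self, mul_one]

lemma gg_add (hC : Cur W n) (i : ℤ) : gg W (i + n) = gg W n * gg W i := by
  induction i using Int.induction_on with
  | zero => simp [gg_zero]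
  | succ k ih => rw [add_right_comm, gg_succ, ih, gg_succ, hC.per, mul_assoc]
  | pred k ih =>
    rw [show -(k : ℤ) - 1 + n = -(k : ℤ) + n - 1 by ring, gg_pred, ih, gg_pred, mul_assoc,
      show -(k : ℤ) + n - 1 = -(k : ℤ) - 1 + n by ring, hC.per]

lemma gg_add_mul (hC : Cur W n) (i m : ℤ) : gg W (i + n * m) = gg W n ^ m * gg W i := by
  induction m using Int.induction_on with
  | zero => simp
  | succ k ih =>
    rw [show i + n * ((k : ℤ) + 1) = i + n * k + n by ring, gg_add hC, ih,
      ← mul_assoc, ← _root_.zpow_one_add, add_comm 1]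
  | pred k ih =>
    have := gg_add hC (i + n * (-(k : ℤ) - 1))
    rw [show i + n * (-(k : ℤ) - 1) + n = i + n * -(k : ℤ) by ring, ih] at this
    rw [eq_inv_mul_of_mul_eq this.symm, ← mul_assoc, ← _root_.zpow_neg_one, ← _root_.zpow_add]
    congr 2; ring

/-- The element seen from the frame `i`. -/
def Mg (W : ℤ → Letter) (n i : ℤ) : GL (Fin 2) ℤ := (gg W i)⁻¹ * gg W n * gg W i

lemma Mg_succ (i : ℤ) : Mg W n (i + 1) = Rg (W i) * Mg W n i * Rg (W i) := by
  simp only [Mg, gg_succ, _root_.mul_inv_rev, Rg_inv, mul_assoc]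

lemma Mg_eq (hC : Cur W n) (i : ℤ) : Mg W n i = (gg W i)⁻¹ * gg W (i + n) := by
  rw [Mg, gg_add hC, mul_assoc]

lemma PR_eq (i : ℤ) (m : ℕ) : PR W i m = (((gg W i)⁻¹ * gg W (i + m) : GL (Fin 2) ℤ) : Mat) := by
  induction m with
  | zero => simp [PR]
  | succ m ih =>
    rw [PR, ih, Nat.cast_succ, ← add_assoc, gg_succ, ← mul_assoc]; rfl

lemma PR_rev_eq (i : ℤ) (m : ℕ) :
    PR (fun k => W (i - 1 - k)) 0 m = (((gg W i)⁻¹ * gg W (i - m) : GL (Fin 2) ℤ) : Mat) := by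
  induction m with
  | zero => simp [PR]
  | succ m ih =>
    rw [PR, ih, Nat.cast_succ, show i - ((m : ℤ) + 1) = i - m - 1 by ring, gg_pred, ← mul_assoc,
      zero_add, show i - 1 - (m : ℤ) = i - m - 1 by ring]
    rfl

lemma Mg_rev (hC : Cur W n) (i : ℤ) : (gg W i)⁻¹ * gg W (i - n) = (Mg W n i)⁻¹ := by
  have := gg_add hC (i - n)
  rw [sub_add_cancel] at this
  rw [Mg, this]; group

lemma gg_det (i : ℤ) : (gg W i : Mat).det = if i % 2 = 0 then 1 else -1 := by
  induction i using Int.induction_on with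
  | zero => simp [gg_zero]
  | succ k ih =>
    rw [gg_succ, Units.val_mul, det_mul, ih]
    have : (Rg (W k) : Mat).det = -1 := Rm_det _
    rw [this]
    split_ifs <;> first | rfl | omega
  | pred k ih =>
    rw [gg_pred, Units.val_mul, det_mul, ih]
    have : (Rg (W (-(k : ℤ) - 1)) : Mat).det = -1 := Rm_det _
    rw [this]
    split_ifs <;> first | rfl | omega

lemma Mg_det (hC : Cur W n) (i : ℤ) : (Mg W n i : Mat).det = 1 := by
  have h : (Mg W n i : Mat) = ((gg W i)⁻¹ : GL (Fin 2) ℤ) * (gg W n : Mat) * (gg W i : Mat) := rfl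
  have h2 : (((gg W i)⁻¹ : GL (Fin 2) ℤ) : Mat).det * (gg W i : Mat).det = 1 := by
    rw [← det_mul, ← Units.val_mul, inv_mul_cancel]; simp
  rw [h, det_mul, det_mul, gg_det n, if_pos hC.even, mul_one, h2]

lemma inv_entries {g : GL (Fin 2) ℤ} (h : (g : Mat).det = 1) :
    ((g⁻¹ : GL (Fin 2) ℤ) : Mat) = !![g 1 1, -g 0 1; -g 1 0, g 0 0] := by
  rw [Matrix.coe_units_inv, Matrix.inv_def, h, Matrix.adjugate_fin_two]; simp

lemma Mg_hyp (hC : Cur W n) (h4 : 4 ≤ n) (i : ℤ) :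
    ES (W i) (Mg W n i) ∧ ES (W (i - 1)) (Mg W n i) ∧ 2 < |(Mg W n i : Mat).trace| := by
  have hn : (n.toNat : ℤ) = n := Int.toNat_of_nonneg (by omega)
  obtain ⟨h1, h2⟩ := PR_hyp hC h4 i
  rw [PR_eq, hn, ← Mg_eq hC] at h1 h2
  obtain ⟨h3, -⟩ := PR_hyp (hC.rev (i - 1)) h4 0
  rw [PR_rev_eq, hn, Mg_rev hC, inv_entries (Mg_det hC i), sub_zero] at h3
  refine ⟨h1, ?_, h2⟩
  cases h : W (i - 1) <;> simp [ES, h] at h3 ⊢ <;> nlinarith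

end

section

open Matrix

/-- The open arc cut off by the side `a`. -/
def inI : Letter → ℝ → Prop
  | .y, t => t < 0
  | .z, t => 0 < t ∧ t < 1
  | .x, t => 1 < t

/-- Homogeneous version of `inI`. -/
def cone : Letter → ℝ × ℝ → Prop
  | .y, v => v.1 * v.2 < 0
  | .z, v => v.1 * (v.1 - v.2) < 0
  | .x, v => v.2 * (v.2 - v.1) < 0

lemma cone_one (a : Letter) (t : ℝ) : cone a (t, 1) ↔ inI a t := by
  cases a
  · simp [cone, inI]
  · simp [cone, inI]
  · simp only [cone, inI]
    constructor
    · intro h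
      constructor <;> nlinarith
    · rintro ⟨h1, h2⟩; nlinarith

lemma cone_unique {a b : Letter} {v : ℝ × ℝ} (ha : cone a v) (hb : cone b v) : a = b := by
  obtain ⟨p, q⟩ := v
  have := sq_nonneg p
  have := sq_nonneg q
  have := sq_nonneg (p - q)
  cases a <;> cases b <;> simp only [cone] at ha hb <;> first | rfl | (exfalso; nlinarith)

lemma inI_unique {a b : Letter} {t : ℝ} (ha : inI a t) (hb : inI b t) : a = b :=
  cone_unique ((cone_one a t).2 ha) ((cone_one b t).2 hb)

lemma cone_snd_ne {a : Letter} {v : ℝ × ℝ} (h : cone a v) : v.2 ≠ 0 := by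
  obtain ⟨p, q⟩ := v
  intro h0
  simp only at h0
  subst h0
  have := sq_nonneg p
  cases a <;> simp [cone] at h <;> nlinarith

lemma cone_scale {a : Letter} {v : ℝ × ℝ} {t : ℝ} (h : cone a v) (hv : v.1 = t * v.2) : inI a t := by
  have h2 := cone_snd_ne h
  obtain ⟨p, q⟩ := v
  simp only at hv h2
  subst hv
  have : 0 < q * q := mul_self_pos.2 h2
  rw [← cone_one]
  cases a <;> simp only [cone] at h ⊢ <;> by_contra hcon <;> push Not at hcon <;>
    nlinarith [mul_nonneg hcon this.le]

/-- Linear action on pairs. -/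
def act (M : Mat) (v : ℝ × ℝ) : ℝ × ℝ := (M 0 0 * v.1 + M 0 1 * v.2, M 1 0 * v.1 + M 1 1 * v.2)

lemma act_mul (M N : Mat) (v : ℝ × ℝ) : act (M * N) v = act M (act N v) := by
  simp only [act, Matrix.mul_apply, Fin.sum_univ_two]
  push_cast
  ext <;> simp only <;> ring

lemma act_one (v : ℝ × ℝ) : act 1 v = v := by simp [act]

def wedge (v w : ℝ × ℝ) : ℝ := v.1 * w.2 - v.2 * w.1

lemma wedge_act (M : Mat) (v w : ℝ × ℝ) : wedge (act M v) (act M w) = M.det * wedge v w := by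
  simp only [act, wedge, Matrix.det_fin_two]; push_cast; ring

/-- Homogeneous version of `qf`. -/
def qv (M : Mat) (v : ℝ × ℝ) : ℝ := wedge v (act M v)

lemma qv_conj (g : GL (Fin 2) ℤ) (M : Mat) (v : ℝ × ℝ) :
    qv ((g : Mat) * M * ((g⁻¹ : GL (Fin 2) ℤ) : Mat)) (act g v) = (g : Mat).det * qv M v := by
  unfold qv
  rw [act_mul, act_mul, ← act_mul _ (g : Mat) v, ← Units.val_mul, inv_mul_cancel, Units.val_one, act_one,
    wedge_act]

lemma qv_roots {M : Mat} {p q : ℝ} (h : ∀ t, qf M t = M 1 0 * ((t - p) * (t - q))) (v : ℝ × ℝ) :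
    qv M v = M 1 0 * ((v.1 - p * v.2) * (v.1 - q * v.2)) := by
  have h1 := h 0
  have h2 := h 1
  simp only [qf] at h1 h2
  have e1 : (M 0 1 : ℝ) = - M 1 0 * (p * q) := by linarith
  have e2 : (M 1 1 : ℝ) = M 0 0 - M 1 0 * (p + q) := by linarith
  simp only [qv, wedge, act]
  rw [e1, e2]; ring

lemma cone_Rm {a b : Letter} (h : a ≠ b) {v : ℝ × ℝ} (hv : cone b v) : cone a (act (Rm a) v) := by
  obtain ⟨p, q⟩ := v
  have := sq_nonneg p
  have := sq_nonneg q
  have := sq_nonneg (p - q)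
  cases a <;> cases b <;> first
    | exact absurd rfl h
    | (simp only [cone, act, Rm] at hv ⊢; simp at hv ⊢; nlinarith)

lemma es_roots {a : Letter} {M : Mat} {p q : ℝ} (hE : ES a M)
    (h : ∀ t, qf M t = M 1 0 * ((t - p) * (t - q))) :
    (inI a p ∧ ¬ inI a q) ∨ (inI a q ∧ ¬ inI a p) := by
  have h1 := h 0
  have h2 := h 1
  simp only [qf] at h1 h2
  have e1 : - (M 0 1 : ℝ) = M 1 0 * (p * q) := by linarith
  have e2 : ((M 1 0 : ℝ) + M 1 1 - M 0 0 - M 0 1) = M 1 0 * ((1 - p) * (1 - q)) := by linarith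
  have hc : 0 ≤ (M 1 0 : ℝ) * M 1 0 := mul_self_nonneg _
  cases a <;> simp only [ES, inI] at hE ⊢
  · have hE' : (M 1 0 : ℝ) * ((M 1 0 : ℝ) + M 1 1 - M 0 0 - M 0 1) < 0 := by exact_mod_cast hE
    rw [e2] at hE'
    have : (1 - p) * (1 - q) < 0 := by by_contra hcon; push Not at hcon; nlinarith [mul_nonneg hc hcon]
    rcases mul_neg_iff.1 this with h | h
    · right; constructor <;> linarith
    · left; constructor <;> linarith
  · have hE' : (M 1 0 : ℝ) * (-(M 0 1 : ℝ)) < 0 := by exact_mod_cast hE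
    rw [e1] at hE'
    have : p * q < 0 := by by_contra hcon; push Not at hcon; nlinarith [mul_nonneg hc hcon]
    rcases mul_neg_iff.1 this with h | h
    · right; constructor <;> linarith
    · left; constructor <;> linarith
  · have hE' : (-(M 0 1 : ℝ)) * ((M 1 0 : ℝ) + M 1 1 - M 0 0 - M 0 1) < 0 := by exact_mod_cast hE
    rw [e2, e1] at hE'
    have : (p * (1 - p)) * (q * (1 - q)) < 0 := by
      by_contra hcon; push Not at hcon; nlinarith [mul_nonneg hc hcon]
    rcases mul_neg_iff.1 this with ⟨h3, h4⟩ | ⟨h3, h4⟩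
    · left
      refine ⟨⟨?_, ?_⟩, fun h => ?_⟩ <;> nlinarith
    · right
      refine ⟨⟨?_, ?_⟩, fun h => ?_⟩ <;> nlinarith

variable {W : ℤ → Letter} {n : ℤ}

/-- Attracting and repelling fixed points of `Mg W n i`. -/
structure IsEnds (W : ℤ → Letter) (n : ℤ) (ξ η : ℤ → ℝ) : Prop where
  inx : ∀ i, inI (W i) (ξ i)
  iny : ∀ i, inI (W (i - 1)) (η i)
  ne0 : ∀ i, (Mg W n i : Mat) 1 0 ≠ 0
  roots : ∀ i t, qf (Mg W n i) t = (Mg W n i : Mat) 1 0 * ((t - ξ i) * (t - η i))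

lemma exists_ends (hC : Cur W n) (h4 : 4 ≤ n) : ∃ ξ η, IsEnds W n ξ η := by
  have key : ∀ i, ∃ ξ η : ℝ, inI (W i) ξ ∧ inI (W (i - 1)) η ∧ (Mg W n i : Mat) 1 0 ≠ 0 ∧
      ∀ t, qf (Mg W n i) t = (Mg W n i : Mat) 1 0 * ((t - ξ) * (t - η)) := by
    intro i
    obtain ⟨h1, h2, h3⟩ := Mg_hyp hC h4 i
    obtain ⟨hc, p, q, hpq, hr⟩ := exists_roots (Mg_det hC i) h3
    have hne := hC.red' i
    rcases es_roots h1 hr with ⟨g1, g2⟩ | ⟨g1, g2⟩ <;> rcases es_roots h2 hr with ⟨g3, g4⟩ | ⟨g3, g4⟩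
    · exact absurd (inI_unique g3 g1) hne
    · exact ⟨p, q, g1, g3, hc, hr⟩
    · exact ⟨q, p, g1, g3, hc, fun t => by rw [hr]; ring⟩
    · exact absurd (inI_unique g3 g1) hne
  choose ξ η h using key
  exact ⟨ξ, η, fun i => (h i).1, fun i => (h i).2.1, fun i => (h i).2.2.1, fun i => (h i).2.2.2⟩

/-- `s'` is the image of `s` under the reflection `a`. -/
def Maps (a : Letter) (s s' : ℝ) : Prop :=
  (act (Rm a) (s, 1)).2 ≠ 0 ∧ (act (Rm a) (s, 1)).1 = s' * (act (Rm a) (s, 1)).2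

variable {ξ η : ℤ → ℝ}

lemma Mg_step (i : ℤ) (s : ℝ) (h : qv (Mg W n i) (s, 1) = 0) :
    qv (Mg W n (i + 1)) (act (Rm (W i)) (s, 1)) = 0 := by
  have := qv_conj (Rg (W i)) (Mg W n i) (s, 1)
  rw [h, mul_zero] at this
  rw [Mg_succ]; exact this

lemma IsEnds.eta (hE : IsEnds W n ξ η) (hC : Cur W n) (i : ℤ) : Maps (W i) (η i) (η (i + 1)) := by
  have h1 := Mg_step i (η i) (by rw [qv_roots (hE.roots i)]; simp)
  have h2 := cone_Rm (hC.red' i).symm ((cone_one _ _).2 (hE.iny i))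
  refine ⟨cone_snd_ne h2, ?_⟩
  rw [qv_roots (hE.roots (i + 1)), mul_eq_zero, mul_eq_zero] at h1
  rcases h1 with h1 | h1 | h1
  · exact absurd (by exact_mod_cast h1) (hE.ne0 (i + 1))
  · exact absurd (inI_unique (cone_scale h2 (by linarith)) (hE.inx (i + 1))) (hC.red i)
  · linarith

lemma IsEnds.xi_ne_eta (hE : IsEnds W n ξ η) (hC : Cur W n) (i : ℤ) : ξ i ≠ η i := fun h =>
  hC.red' i (inI_unique (hE.iny i) (h ▸ hE.inx i))

lemma IsEnds.xi (hE : IsEnds W n ξ η) (hC : Cur W n) (i : ℤ) : Maps (W i) (ξ i) (ξ (i + 1)) := by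
  have h1 := Mg_step i (ξ i) (by rw [qv_roots (hE.roots i)]; simp)
  obtain ⟨h3, h4⟩ := hE.eta hC i
  have h5 := wedge_act (Rm (W i)) (ξ i, 1) (η i, 1)
  rw [Rm_det] at h5
  simp only [wedge, mul_one, one_mul] at h5
  have hne := hE.xi_ne_eta hC i
  rw [h4] at h5
  have hne' : (act (Rm (W i)) (ξ i, 1)).1 - η (i + 1) * (act (Rm (W i)) (ξ i, 1)).2 ≠ 0 := by
    intro h
    have h6 : (((-1 : ℤ) : ℝ)) * (ξ i - η i) = 0 := by
      rw [← h5]; linear_combination (act (Rm (W i)) (η i, 1)).2 * h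
    push_cast at h6
    apply hne; linarith
  rw [qv_roots (hE.roots (i + 1)), mul_eq_zero, mul_eq_zero] at h1
  rcases h1 with h1 | h1 | h1
  · exact absurd (by exact_mod_cast h1) (hE.ne0 (i + 1))
  · refine ⟨fun h => hne' ?_, by linarith⟩
    rw [h] at h1 ⊢
    linarith
  · exact absurd h1 hne'

lemma Maps.symm {a : Letter} {s s' : ℝ} (h : Maps a s s') : Maps a s' s := by
  obtain ⟨h1, h2⟩ := h
  cases a <;> simp [Maps, act, Rm] at h1 h2 ⊢
  · linarith
  · linarith
  · have h3 : (-(2 * s') + 1) * (-(2 * s) + 1) = 1 := by linear_combination 2 * h2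
    refine ⟨fun h => by rw [h] at h3; simp at h3, by linear_combination h2⟩

lemma Maps.unique {a : Letter} {s s' s'' : ℝ} (h : Maps a s s') (h' : Maps a s s'') : s' = s'' :=
  mul_right_cancel₀ h.1 (h.2.symm.trans h'.2)

lemma Maps.lt_iff_same {a b : Letter} {s t s' t' : ℝ} (hs : inI a s) (ht : inI a t)
    (hs' : inI b s') (ht' : inI b t') (h1 : Maps a s s') (h2 : Maps a t t') (hab : a ≠ b) :
    s < t ↔ t' < s' := by
  obtain ⟨h3, h4⟩ := h1
  obtain ⟨h5, h6⟩ := h2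
  cases a <;> simp [act, Rm] at h3 h4 h5 h6
  · constructor <;> intro h <;> linarith
  · constructor <;> intro h <;> linarith
  · have e : (s' - t') * ((-(2 * s) + 1) * (-(2 * t) + 1)) = t - s := by
      linear_combination (-(-(2 * t) + 1)) * h4 + (-(2 * s) + 1) * h6
    have hpos : 0 < (-(2 * s) + 1) * (-(2 * t) + 1) := by
      simp only [inI] at hs ht
      cases b <;> simp only [inI] at hs' ht'
      · exact mul_pos_of_neg_of_neg (by nlinarith) (by nlinarith)
      · exact mul_pos (by nlinarith) (by nlinarith)
      · exact absurd rfl hab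
    rw [← sub_pos, ← e]
    constructor
    · intro h; have := (pos_iff_pos_of_mul_pos h).2 hpos; linarith
    · intro h; exact mul_pos (by linarith) hpos

lemma Maps.lt_iff_diff {a b b' : Letter} {s t s' t' : ℝ} (hs : inI a s) (ht : inI a t)
    (hs' : inI b s') (ht' : inI b' t') (h1 : Maps a s s') (h2 : Maps a t t') (hab : a ≠ b)
    (hab' : a ≠ b') (hbb : b ≠ b') : s < t ↔ ¬ b = nxt a := by
  obtain ⟨h3, h4⟩ := h1
  obtain ⟨h5, h6⟩ := h2
  cases a <;> cases b <;> cases b' <;>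
    first
    | exact absurd rfl hab
    | exact absurd rfl hab'
    | exact absurd rfl hbb
    | (simp [act, Rm] at h3 h4 h5 h6
       simp only [inI] at hs ht hs' ht'
       simp [nxt]
       first
       | nlinarith
       | (have a1 : ∀ u u' : ℝ, 0 < u → -u = u' * (-(2 * u) + 1) →
            (u' < 0 → 2 * u < 1) ∧ (1 < u' → 1 < 2 * u) :=
            fun u u' hu h => ⟨fun h' => by nlinarith, fun h' => by nlinarith⟩
          have := a1 s s' hs.1 h4
          have := a1 t t' ht.1 h6
          grind))

end

section

open Matrix

variable {W : ℤ → Letter} {n : ℤ} {ξ η : ℤ → ℝ}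

/-- Endpoint of the second axis ahead of the strand. -/
def xi' (ξ η : ℤ → ℝ) (j : ℤ) (ε : Bool) (k : ℤ) : ℝ := if ε then ξ (j + k) else η (j - k)

/-- Endpoint of the second axis behind the strand. -/
def et' (ξ η : ℤ → ℝ) (j : ℤ) (ε : Bool) (k : ℤ) : ℝ := if ε then η (j + k) else ξ (j - k)

lemma IsEnds.inx' (hE : IsEnds W n ξ η) (j : ℤ) (ε : Bool) (k : ℤ) :
    inI (W (st j ε k)) (xi' ξ η j ε k) := by
  cases ε
  · have := hE.iny (j - k)
    simp only [st, xi', Bool.false_eq_true, if_false]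
    rwa [show j - 1 - k = j - k - 1 by ring]
  · simpa [st, xi'] using hE.inx (j + k)

lemma IsEnds.iny' (hE : IsEnds W n ξ η) (j : ℤ) (ε : Bool) (k : ℤ) :
    inI (W (st j ε (k - 1))) (et' ξ η j ε k) := by
  cases ε
  · have := hE.inx (j - k)
    simp only [st, et', Bool.false_eq_true, if_false]
    rwa [show j - 1 - (k - 1) = j - k by ring]
  · have := hE.iny (j + k)
    simp only [st, et', if_true]
    rwa [show j + (k - 1) = j + k - 1 by ring]

lemma IsEnds.maps_xi' (hE : IsEnds W n ξ η) (hC : Cur W n) (j : ℤ) (ε : Bool) (k : ℤ) :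
    Maps (W (st j ε k)) (xi' ξ η j ε k) (xi' ξ η j ε (k + 1)) := by
  cases ε
  · have := (hE.eta hC (j - 1 - k)).symm
    simp only [st, xi', Bool.false_eq_true, if_false]
    rw [show j - 1 - k + 1 = j - k by ring] at this
    rwa [show j - (k + 1) = j - 1 - k by ring]
  · have := hE.xi hC (j + k)
    simp only [st, xi', if_true]
    rwa [show j + (k + 1) = j + k + 1 by ring]

lemma IsEnds.maps_et' (hE : IsEnds W n ξ η) (hC : Cur W n) (j : ℤ) (ε : Bool) (k : ℤ) :
    Maps (W (st j ε k)) (et' ξ η j ε k) (et' ξ η j ε (k + 1)) := by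
  cases ε
  · have := (hE.xi hC (j - 1 - k)).symm
    simp only [st, et', Bool.false_eq_true, if_false]
    rw [show j - 1 - k + 1 = j - k by ring] at this
    rwa [show j - (k + 1) = j - 1 - k by ring]
  · have := hE.eta hC (j + k)
    simp only [st, et', if_true]
    rwa [show j + (k + 1) = j + k + 1 by ring]

lemma IsEnds.xi_ne (hE : IsEnds W n ξ η) (hC : Cur W n) {i j : ℤ} {ε : Bool}
    (hp : (i - j) % 2 = 0) (hn : ¬ n ∣ i - j) (k : ℤ) : ξ (i + k) ≠ xi' ξ η j ε k := by
  intro h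
  apply agree_right_false (ε := ε) hC hp hn (k₀ := k)
  have key : ∀ m : ℕ, ξ (i + (k + m)) = xi' ξ η j ε (k + m) := by
    intro m
    induction m with
    | zero => simpa using h
    | succ m ih =>
      have h1 := hE.xi hC (i + (k + m))
      have h2 := hE.maps_xi' hC j ε (k + m)
      have h3 := hE.inx (i + (k + m))
      rw [ih] at h1 h3
      rw [inI_unique h3 (hE.inx' j ε (k + m))] at h1
      have := h1.unique h2
      push_cast
      rwa [show i + (k + ((m : ℤ) + 1)) = i + (k + m) + 1 by ring,
        show k + ((m : ℤ) + 1) = k + m + 1 by ring]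
  intro l hl
  have h1 := key (l - k).toNat
  rw [show k + ((l - k).toNat : ℤ) = l by omega] at h1
  have h3 := hE.inx (i + l)
  rw [h1] at h3
  exact inI_unique h3 (hE.inx' j ε l)

lemma IsEnds.eta_ne (hE : IsEnds W n ξ η) (hC : Cur W n) {i j : ℤ} {ε : Bool}
    (hp : (i - j) % 2 = 0) (hn : ¬ n ∣ i - j) (k : ℤ) : η (i + k) ≠ et' ξ η j ε k := by
  intro h
  have key : ∀ m : ℕ, η (i + (k - m)) = et' ξ η j ε (k - m) := by
    intro m
    induction m with
    | zero => simpa using h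
    | succ m ih =>
      have h1 := (hE.eta hC (i + (k - m - 1))).symm
      have h2 := (hE.maps_et' hC j ε (k - m - 1)).symm
      have h3 := hE.iny (i + (k - m))
      have h4 := hE.iny' j ε (k - m)
      rw [ih] at h3
      rw [show i + (k - m - 1) + 1 = i + (k - (m : ℤ)) by ring, ih,
        show i + (k - (m : ℤ) - 1) = i + (k - m) - 1 by ring, inI_unique h3 h4] at h1
      rw [show k - (m : ℤ) - 1 + 1 = k - m by ring] at h2
      have := h1.unique h2
      push_cast
      rwa [show i + (k - ((m : ℤ) + 1)) = i + (k - m) - 1 by ring,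
        show k - ((m : ℤ) + 1) = k - m - 1 by ring]
  apply agree_left_false (ε := ε) hC hp hn (k₀ := k - 1)
  intro l hl
  have h1 := key (k - (l + 1)).toNat
  rw [show k - ((k - (l + 1)).toNat : ℤ) = l + 1 by omega] at h1
  have h3 := hE.iny (i + (l + 1))
  have h4 := hE.iny' j ε (l + 1)
  rw [h1] at h3
  rw [show i + (l + 1) - 1 = i + l by ring] at h3
  rw [show l + 1 - 1 = l by ring] at h4
  exact inI_unique h3 h4

/-- Axes at inequivalent vertices of the same parity have no common endpoint. -/
lemma IsEnds.distinct (hE : IsEnds W n ξ η) (hC : Cur W n) {i j : ℤ}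
    (hp : (i - j) % 2 = 0) (hn : ¬ n ∣ i - j) :
    ξ i ≠ ξ j ∧ ξ i ≠ η j ∧ η i ≠ ξ j ∧ η i ≠ η j := by
  have h1 := hE.xi_ne (ε := true) hC hp hn 0
  have h2 := hE.xi_ne (ε := false) hC hp hn 0
  have h3 := hE.eta_ne (ε := false) hC hp hn 0
  have h4 := hE.eta_ne (ε := true) hC hp hn 0
  simp [xi', et'] at h1 h2 h3 h4
  exact ⟨h1, h2, h3, h4⟩

lemma lam_ne_zero {M N : Mat} {p q r s : ℝ}
    (hM : ∀ t, qf M t = M 1 0 * ((t - p) * (t - q))) (hN : ∀ t, qf N t = N 1 0 * ((t - r) * (t - s)))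
    (hM0 : M 1 0 ≠ 0) (hN0 : N 1 0 ≠ 0) (h : p ≠ r ∧ p ≠ s ∧ q ≠ r ∧ q ≠ s) : lam M N ≠ 0 := by
  intro h0
  have hl := lam_roots hM hN
  rw [h0] at hl
  have a1 : (M 1 0 : ℝ) ≠ 0 := by exact_mod_cast hM0
  have a2 : (N 1 0 : ℝ) ≠ 0 := by exact_mod_cast hN0
  obtain ⟨b1, b2, b3, b4⟩ := h
  rw [← sub_ne_zero] at b1 b2 b3 b4
  have : 4 * (M 1 0 : ℝ) ^ 2 * (N 1 0 : ℝ) ^ 2 * (((p - r) * (q - r)) * ((p - s) * (q - s))) ≠ 0 := by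
    positivity
  apply this
  rw [← hl]; simp

lemma lam_Mg_ne (hC : Cur W n) (h4 : 4 ≤ n) {i j : ℤ}
    (hp : (i - j) % 2 = 0) (hn : ¬ n ∣ i - j) : lam (Mg W n i) (Mg W n j) ≠ 0 := by
  obtain ⟨ξ, η, hE⟩ := exists_ends hC h4
  exact lam_ne_zero (hE.roots i) (hE.roots j) (hE.ne0 i) (hE.ne0 j) (hE.distinct hC hp hn)

lemma lam_conj (g : GL (Fin 2) ℤ) (M N : GL (Fin 2) ℤ) :
    lam ((g * M * g⁻¹ : GL (Fin 2) ℤ) : Mat) ((g * N * g⁻¹ : GL (Fin 2) ℤ) : Mat) = lam M N := by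
  have tr : ∀ A : GL (Fin 2) ℤ, ((g * A * g⁻¹ : GL (Fin 2) ℤ) : Mat).trace = (A : Mat).trace := by
    intro A
    rw [Units.val_mul, Matrix.trace_mul_comm, ← Units.val_mul, inv_mul_cancel_left]
  have dt : ∀ A : GL (Fin 2) ℤ, ((g * A * g⁻¹ : GL (Fin 2) ℤ) : Mat).det = (A : Mat).det := by
    intro A
    rw [Units.val_mul, Matrix.det_mul_comm, ← Units.val_mul, inv_mul_cancel_left]
  unfold lam
  rw [← Units.val_mul, ← Units.val_mul, tr, tr, dt, dt,
    show g * M * g⁻¹ * (g * N * g⁻¹) = g * (M * N) * g⁻¹ by group, tr]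

lemma Mg_vx (j : ℤ) (ε : Bool) (k : ℤ) :
    Mg W n (vx j ε (k + 1)) = Rg (W (st j ε k)) * Mg W n (vx j ε k) * Rg (W (st j ε k)) := by
  cases ε
  · simp only [vx, st, Bool.false_eq_true, if_false]
    have h := Mg_succ (W := W) (n := n) (j - 1 - k)
    rw [show j - 1 - k + 1 = j - k by ring] at h
    rw [show j - (k + 1) = j - 1 - k by ring, h]
    have := Rg_mul_self (W (j - 1 - k))
    simp only [mul_assoc, this, mul_one]
    rw [← mul_assoc, this, one_mul]
  · simp only [vx, st, if_true]
    rw [show j + (k + 1) = j + k + 1 by ring, Mg_succ]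

lemma lam_seg {i j : ℤ} {ε : Bool} {s t : ℤ} (hS : Seg W n i j ε s t) (m : ℕ) (hm : s + m ≤ t) :
    lam (Mg W n (i + (s + m))) (Mg W n (vx j ε (s + m))) =
      lam (Mg W n (i + s)) (Mg W n (vx j ε s)) := by
  induction m with
  | zero => simp
  | succ m ih =>
    push_cast at hm ⊢
    rw [← ih (by omega), show s + ((m : ℤ) + 1) = s + m + 1 by ring, Mg_vx,
      show i + (s + m + 1) = i + (s + (m : ℤ)) + 1 by ring, Mg_succ, hS.ag (s + m) (by omega) (by omega)]
    exact lam_conj (Rg (W (st j ε (s + m)))) _ _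

lemma prop_aux {A P Q E F : Prop} (h : (¬ Q ↔ ¬ F) ↔ (A ↔ E)) :
    (A ↔ P) ↔ ¬ ((P ↔ ¬ E) ↔ (Q ↔ F)) := by
  by_cases A <;> by_cases P <;> by_cases Q <;> by_cases E <;> by_cases F <;> simp_all

/-- The linking criterion for the axes at two vertices in terms of the shared segment. -/
lemma lam_seg_neg (hC : Cur W n) (h4 : 4 ≤ n) {i j : ℤ} {ε : Bool} {s t : ℤ}
    (hS : Seg W n i j ε s t) (hs : s ≤ 0) (ht : 0 ≤ t) :
    lam (Mg W n i) (Mg W n j) < 0 ↔ ¬ (segStart W i s ↔ segEnd W i t) := by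
  obtain ⟨ξ, η, hE⟩ := exists_ends hC h4
  have h0 := lam_seg hS (-s).toNat (by omega)
  rw [show s + ((-s).toNat : ℤ) = 0 by omega] at h0
  have hv0 : vx j ε 0 = j := by cases ε <;> simp [vx]
  rw [add_zero, hv0] at h0
  rw [h0]
  have hst := hS.lt
  have hne := hE.xi_ne (ε := ε) hC hS.par hS.ndvd
  -- propagation of the order along the segment
  have prop : ∀ m : ℕ, s + m < t →
      ((ξ (i + (s + m)) < xi' ξ η j ε (s + m) ↔ (s + m) % 2 = 0) ↔
        (ξ (i + s) < xi' ξ η j ε s ↔ s % 2 = 0)) := by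
    intro m
    induction m with
    | zero => simp
    | succ m ih =>
      intro hm
      push_cast at hm ⊢
      rw [← ih (by omega)]
      have a1 := hS.ag (s + m) (by omega) (by omega)
      have a2 := hS.ag (s + m + 1) (by omega) (by omega)
      have e : i + (s + (m : ℤ) + 1) = i + (s + m) + 1 := by ring
      have b1 := hE.inx' j ε (s + m)
      have b2 := hE.inx' j ε (s + m + 1)
      have b3 := hE.maps_xi' hC j ε (s + m)
      rw [← a1] at b1 b3
      rw [← a2, e] at b2
      have := Maps.lt_iff_same (hE.inx _) b1 (hE.inx _) b2 (hE.xi hC _) b3 (hC.red _)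
      rw [this, show s + ((m : ℤ) + 1) = s + m + 1 by ring, e]
      have hn1 := hne (s + m + 1)
      rw [e] at hn1
      have e3 : (s + (m : ℤ) + 1) % 2 = 0 ↔ ¬ (s + m) % 2 = 0 := by omega
      rw [e3]
      rcases lt_or_gt_of_ne hn1 with h | h <;> simp [h, h.not_gt]
  have hend := prop (t - 1 - s).toNat (by omega)
  rw [show s + ((t - 1 - s).toNat : ℤ) = t - 1 by omega] at hend
  have hendv : ξ (i + (t - 1)) < xi' ξ η j ε (t - 1) ↔ ¬ W (i + t) = nxt (W (i + (t - 1))) := by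
    have a1 := hS.ag (t - 1) (by omega) (by omega)
    have b1 := hE.inx' j ε (t - 1)
    have b2 := hE.inx' j ε (t - 1 + 1)
    have b3 := hE.maps_xi' hC j ε (t - 1)
    have b4 := hE.inx (i + (t - 1) + 1)
    have b5 := hE.xi hC (i + (t - 1))
    have r1 := hC.red (i + (t - 1))
    have r2 := st_red hC j ε t
    rw [← a1] at b1 b3 r2
    rw [show t - 1 + 1 = t by ring] at b2 b3
    rw [show i + (t - 1) + 1 = i + t by ring] at b4 b5 r1
    exact Maps.lt_iff_diff (hE.inx _) b1 b4 b2 b5 b3 r1 r2 hS.right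
  have ag := hS.ag s le_rfl hst
  have c1 : inI (W (i + (s - 1))) (η (i + s)) := by
    have := hE.iny (i + s); rwa [show i + s - 1 = i + (s - 1) by ring] at this
  have c2 := hE.inx' j ε s
  have c3 := hE.iny' j ε s
  have c0 := hE.inx (i + s)
  rw [← ag] at c2
  have r1 : W (i + s) ≠ W (i + (s - 1)) := by
    have := hC.red' (i + s); rw [show i + s - 1 = i + (s - 1) by ring] at this; exact this.symm
  have r2 : W (i + s) ≠ W (st j ε (s - 1)) := by rw [ag]; exact (st_red hC j ε s).symm
  have ordI : ∀ {a b : Letter} {u v : ℝ}, inI a u → inI b v → ordp .z a < ordp .z b → u < v := by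
    intro a b u v ha hb h
    cases a <;> cases b <;> simp [ordp] at h <;> simp only [inI] at ha hb <;> linarith
  have hcr := cr_one_side (p := .z) (hne s) r1 r2 hS.left
    (fun h => ⟨ordI c0 c1 h, ordI c2 c1 h⟩) (fun h => ⟨ordI c1 c0 h, ordI c1 c2 h⟩)
    (fun h => ⟨ordI c0 c3 h, ordI c2 c3 h⟩) (fun h => ⟨ordI c3 c0 h, ordI c3 c2 h⟩)
    (ordI c1 c3) (ordI c3 c1)
  have hdiff : ∀ {a b : Letter} {u v : ℝ}, inI a u → inI b v → a ≠ b → u ≠ v := by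
    rintro a b u v ha hb hab rfl
    exact hab (inI_unique ha hb)
  have hl : Cr (ξ (i + s)) (η (i + s)) (xi' ξ η j ε s) (et' ξ η j ε s) ↔
      lam (Mg W n (i + s)) (Mg W n (vx j ε s)) < 0 := by
    refine lam_neg_iff (hE.roots _) (fun u => ?_) (hE.ne0 _) (hE.ne0 _) (hne s)
      (hdiff c0 c3 r2) (hdiff c1 c2 r1.symm) (hdiff c1 c3 hS.left)
    rw [hE.roots]
    cases ε
    · simp only [vx, xi', et', Bool.false_eq_true, if_false]; ring
    · simp only [vx, xi', et', if_true]
  rw [← hl, hcr]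
  rw [hendv] at hend
  unfold segStart segEnd
  have e3 : (t - 1) % 2 = 0 ↔ ¬ t % 2 = 0 := by omega
  rw [e3] at hend
  exact prop_aux hend

/-- Two vertices always share a side in one of the two directions. -/
lemma exists_seg_vertex (hC : Cur W n) {i j : ℤ} (hp : (i - j) % 2 = 0) (hn : ¬ n ∣ i - j) :
    ∃ ε s t, s ≤ 0 ∧ 0 ≤ t ∧ Seg W n i j ε s t := by
  have r1 := hC.red' i
  have r2 := hC.red' j
  have h : W i = W j ∨ W (i - 1) = W (j - 1) ∨ W i = W (j - 1) ∨ W (i - 1) = W j := by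
    revert r1 r2
    generalize W i = a; generalize W j = b; generalize W (i - 1) = c; generalize W (j - 1) = d
    cases a <;> cases b <;> cases c <;> cases d <;> simp
  rcases h with h | h | h | h
  · obtain ⟨s, t, h1, h2, h3⟩ := exists_seg (ε := true) (k₀ := 0) hC hp hn (by simpa [st] using h)
    exact ⟨_, s, t, h1, by omega, h3⟩
  · obtain ⟨s, t, h1, h2, h3⟩ := exists_seg (ε := true) (k₀ := -1) hC hp hn
      (by simpa [st, ← sub_eq_add_neg] using h)
    exact ⟨_, s, t, by omega, by omega, h3⟩
  · obtain ⟨s, t, h1, h2, h3⟩ := exists_seg (ε := false) (k₀ := 0) hC hp hn (by simpa [st] using h)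
    exact ⟨_, s, t, h1, by omega, h3⟩
  · obtain ⟨s, t, h1, h2, h3⟩ := exists_seg (ε := false) (k₀ := -1) hC hp hn
      (by simpa [st, ← sub_eq_add_neg] using h)
    exact ⟨_, s, t, by omega, by omega, h3⟩

lemma Mg_inj (hC : Cur W n) (h4 : 4 ≤ n) {i j : ℤ} (hp : (i - j) % 2 = 0)
    (h : Mg W n i = Mg W n j) : n ∣ i - j := by
  by_contra hn
  have h1 := lam_Mg_ne hC h4 hp hn
  obtain ⟨ξ, η, hE⟩ := exists_ends hC h4
  rw [h] at h1
  apply h1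
  have := lam_roots (hE.roots j) (hE.roots j)
  rw [sub_self, zero_mul, zero_mul, mul_zero] at this
  exact_mod_cast this

end

section

open Matrix

variable {W : ℤ → Letter} {n : ℤ} {ξ η : ℤ → ℝ}

/-- Product of the reflections of a list of letters. -/
def PL (u : List Letter) : GL (Fin 2) ℤ := (u.map Rg).prod

lemma PL_cons (a : Letter) (u : List Letter) : PL (a :: u) = Rg a * PL u := by simp [PL]

lemma PL_append (u v : List Letter) : PL (u ++ v) = PL u * PL v := by simp [PL]

lemma PL_nil : PL [] = 1 := rfl

lemma PL_det (u : List Letter) : (PL u : Mat).det = if u.length % 2 = 0 then 1 else -1 := by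
  induction u with
  | nil => simp [PL]
  | cons a u ih =>
    have : (Rg a : Mat).det = -1 := Rm_det _
    rw [PL_cons, Units.val_mul, det_mul, ih, this, List.length_cons]
    split_ifs <;> first | rfl | omega

lemma exists_square_of_not_chain {l : List Letter} (h : ¬ l.IsChain (· ≠ ·)) :
    ∃ l₁ a l₂, l = l₁ ++ a :: a :: l₂ := by
  induction l with
  | nil => simp at h
  | cons a l ih =>
    cases l with
    | nil => simp at h
    | cons b l =>
      rw [List.isChain_cons_cons] at h
      by_cases hab : a = b
      · exact ⟨[], a, l, by simp [hab]⟩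
      · obtain ⟨l₁, c, l₂, hl⟩ := ih (fun h' => h ⟨hab, h'⟩)
        exact ⟨a :: l₁, c, l₂, by rw [hl]; rfl⟩

lemma cone_PL {c : Letter} {v : ℝ × ℝ} (hv : cone c v) (u : List Letter)
    (h : (u ++ [c]).IsChain (· ≠ ·)) : cone ((u ++ [c]).head (by simp)) (act (PL u) v) := by
  induction u with
  | nil => simpa [PL, act_one] using hv
  | cons a u ih =>
    rw [PL_cons, Units.val_mul, act_mul]
    cases u with
    | nil =>
      simp only [List.cons_append, List.nil_append, List.isChain_cons_cons] at h
      rw [PL_nil, Units.val_one, act_one]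
      exact cone_Rm h.1 hv
    | cons b u =>
      simp only [List.cons_append, List.isChain_cons_cons] at h
      have := ih (by simpa using h.2)
      exact cone_Rm h.1 (by simpa using this)

lemma exists_avoid (a b : Letter) : ∃ c, c ≠ a ∧ c ≠ b := by
  cases a <;> cases b <;> first
    | exact ⟨.x, by decide, by decide⟩
    | exact ⟨.y, by decide, by decide⟩
    | exact ⟨.z, by decide, by decide⟩

lemma exists_cone (c : Letter) : ∃ v, cone c v := by
  cases c
  · exact ⟨(2, 1), by norm_num [cone]⟩
  · exact ⟨(-1, 1), by norm_num [cone]⟩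
  · exact ⟨(1, 2), by norm_num [cone]⟩

lemma chain_snoc {u : List Letter} {c : Letter} (hu : u.IsChain (· ≠ ·))
    (h : ∀ b ∈ u.getLast?, b ≠ c) : (u ++ [c]).IsChain (· ≠ ·) := by
  rw [List.isChain_append]
  exact ⟨hu, by simp, by simpa using h⟩

lemma PL_inj {u u' : List Letter} (hu : u.IsChain (· ≠ ·)) (hu' : u'.IsChain (· ≠ ·))
    (h : PL u = PL u') : u = u' := by
  induction u generalizing u' with
  | nil =>
    cases u' with
    | nil => rfl
    | cons a u' =>
      obtain ⟨c, h1, h2⟩ := exists_avoid a ((a :: u').getLast (by simp))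
      obtain ⟨v, hv⟩ := exists_cone c
      have := cone_PL hv (a :: u') (chain_snoc hu' (by
        intro b hb; rw [List.getLast?_eq_getLast_of_ne_nil (by simp)] at hb; simp at hb
        rw [← hb]; exact h2.symm))
      rw [← h, PL_nil, Units.val_one, act_one] at this
      exact absurd (cone_unique hv this) h1
  | cons a u ih =>
    cases u' with
    | nil =>
      obtain ⟨c, h1, h2⟩ := exists_avoid a ((a :: u).getLast (by simp))
      obtain ⟨v, hv⟩ := exists_cone c
      have := cone_PL hv (a :: u) (chain_snoc hu (by
        intro b hb; rw [List.getLast?_eq_getLast_of_ne_nil (by simp)] at hb; simp at hb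
        rw [← hb]; exact h2.symm))
      rw [h, PL_nil, Units.val_one, act_one] at this
      exact absurd (cone_unique hv this) h1
    | cons a' u' =>
      obtain ⟨c, h1, h2⟩ := exists_avoid ((a :: u).getLast (by simp)) ((a' :: u').getLast (by simp))
      obtain ⟨v, hv⟩ := exists_cone c
      have k1 := cone_PL hv (a :: u) (chain_snoc hu (by
        intro b hb; rw [List.getLast?_eq_getLast_of_ne_nil (by simp)] at hb; simp at hb
        rw [← hb]; exact h1.symm))
      have k2 := cone_PL hv (a' :: u') (chain_snoc hu' (by
        intro b hb; rw [List.getLast?_eq_getLast_of_ne_nil (by simp)] at hb; simp at hb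
        rw [← hb]; exact h2.symm))
      rw [h] at k1
      have haa : a = a' := cone_unique k1 k2
      subst haa
      rw [PL_cons, PL_cons] at h
      rw [ih hu.of_cons hu'.of_cons (mul_left_cancel h)]

/-- The letters read along `d` steps of a strand. -/
def sw (f : ℤ → Letter) (d : ℕ) : List Letter := (List.range d).map (fun k : ℕ => f k)

lemma sw_chain {f : ℤ → Letter} (hf : ∀ k, f (k - 1) ≠ f k) (d : ℕ) : (sw f d).IsChain (· ≠ ·) := by
  rw [List.isChain_iff_getElem]
  intro i hi
  have := hf (i + 1)
  simpa [sw] using this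

lemma sw_succ (f : ℤ → Letter) (d : ℕ) : sw f (d + 1) = sw f d ++ [f d] := by
  simp [sw, List.range_succ]

lemma sw_eq {f f' : ℤ → Letter} {d d' : ℕ} (h : sw f d = sw f' d') :
    d = d' ∧ ∀ k : ℤ, 0 ≤ k → k < d → f k = f' k := by
  have hl : d = d' := by simpa [sw] using congrArg List.length h
  subst hl
  refine ⟨rfl, fun k h0 hk => ?_⟩
  obtain ⟨m, rfl⟩ := Int.eq_ofNat_of_zero_le h0
  have := (List.map_inj_left.1 h) m (by simpa using hk)
  exact this

lemma gg_vx_succ (j : ℤ) (ε : Bool) (k : ℤ) :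
    gg W (vx j ε (k + 1)) = gg W (vx j ε k) * Rg (W (st j ε k)) := by
  cases ε
  · simp only [vx, st, Bool.false_eq_true, if_false]
    rw [show j - (k + 1) = j - k - 1 by ring, gg_pred, show j - 1 - k = j - k - 1 by ring]
  · simp only [vx, st, if_true]
    rw [show j + (k + 1) = j + k + 1 by ring, gg_succ]

lemma vx_zero (j : ℤ) (ε : Bool) : vx j ε 0 = j := by cases ε <;> simp [vx]

lemma gg_sw (j : ℤ) (ε : Bool) (d : ℕ) : gg W (vx j ε d) = gg W j * PL (sw (fun k => W (st j ε k)) d) := by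
  induction d with
  | zero => simp [sw, PL, vx_zero]
  | succ d ih => rw [Nat.cast_succ, gg_vx_succ, ih, sw_succ, PL_append, mul_assoc]; simp [PL]

lemma gg_inj (hC : Cur W n) {i j : ℤ} (h : gg W i = gg W j) : i = j := by
  wlog hij : i ≤ j generalizing i j
  · exact (this h.symm (by omega)).symm
  have h1 := gg_sw (W := W) i true (j - i).toNat
  simp only [vx, if_true] at h1
  rw [show i + ((j - i).toNat : ℤ) = j by omega, h] at h1
  have h2 : PL (sw (fun k => W (st i true k)) (j - i).toNat) = PL (sw (fun k => W (st i true k)) 0) := by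
    rw [left_eq_mul.1 h1]; simp [sw, PL]
  have := (sw_eq (PL_inj (sw_chain (st_red hC i true) _) (sw_chain (st_red hC i true) _) h2)).1
  omega

/-- Equal transition elements between vertices come from a common stretch of letters. -/
lemma gg_div_eq (hC : Cur W n) {i j i' j' : ℤ} (hii : i ≤ i')
    (h : (gg W i)⁻¹ * gg W i' = (gg W j)⁻¹ * gg W j') :
    ∃ ε, j' = vx j ε (i' - i) ∧ ∀ k, 0 ≤ k → k < i' - i → W (i + k) = W (st j ε k) := by
  have key : ∀ ε, ∀ d : ℕ, j' = vx j ε d → d = (i' - i).toNat ∧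
      ∀ k : ℤ, 0 ≤ k → k < i' - i → W (i + k) = W (st j ε k) := by
    intro ε d hd
    have h1 := gg_sw (W := W) i true (i' - i).toNat
    simp only [vx, if_true] at h1
    rw [show i + ((i' - i).toNat : ℤ) = i' by omega] at h1
    have h2 := gg_sw (W := W) j ε d
    rw [← hd] at h2
    rw [h1, h2, inv_mul_cancel_left, inv_mul_cancel_left] at h
    obtain ⟨h3, h4⟩ := sw_eq (PL_inj (sw_chain (st_red hC i true) _) (sw_chain (st_red hC j ε) _) h)
    refine ⟨h3.symm, fun k h0 hk => ?_⟩
    simpa [st] using h4 k h0 (by omega)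
  rcases le_total j j' with hj | hj
  · obtain ⟨h1, h2⟩ := key true (j' - j).toNat (by simp only [vx, if_true]; omega)
    exact ⟨true, by simp only [vx, if_true]; omega, h2⟩
  · obtain ⟨h1, h2⟩ := key false (j - j').toNat (by simp only [vx, Bool.false_eq_true, if_false]; omega)
    exact ⟨false, by simp only [vx, Bool.false_eq_true, if_false]; omega, h2⟩

/-- The embedding of `Γ` into `GL₂(ℤ)`. -/
def io : Gamma →* GL (Fin 2) ℤ := Matrix.SpecialLinearGroup.toGL.comp Gamma.subtype

lemma io_inj : Function.Injective io :=
  Matrix.SpecialLinearGroup.toGL_injective.comp Subtype.val_injective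

lemma io_coe (h : Gamma) : (io h : Mat) = ((h : SL2Z) : Mat) := rfl

lemma toGL_pairM {a b : Letter} (h : a ≠ b) :
    Matrix.SpecialLinearGroup.toGL (pairM a b) = Rg a * Rg b := by
  have hA : Matrix.SpecialLinearGroup.toGL Amat = Rg .x * Rg .y := by
    apply Units.ext
    change !![1, 2; 0, 1] = Rm .x * Rm .y
    simp [Rm]
  have hB : Matrix.SpecialLinearGroup.toGL Bmat = Rg .y * Rg .z := by
    apply Units.ext
    change !![1, 0; -2, 1] = Rm .y * Rm .z
    simp [Rm]
  have hyy := Rg_mul_self .y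
  have hC : Matrix.SpecialLinearGroup.toGL (Amat * Bmat) = Rg .x * Rg .z := by
    rw [map_mul, hA, hB, mul_assoc, ← mul_assoc (Rg .y), hyy, one_mul]
  cases a <;> cases b <;> first
    | exact absurd rfl h
    | (simp only [pairM, Cmat, inv_inv, map_inv, hA, hB, hC]; done)
    | (simp only [pairM, Cmat, map_inv, hA, hB, hC]; simp only [_root_.mul_inv_rev, Rg_inv])

lemma exists_PL (h : Gamma) : ∃ u, io h = PL u := by
  obtain ⟨h, hh⟩ := h
  change ∃ u, Matrix.SpecialLinearGroup.toGL h = PL u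
  induction hh using Subgroup.closure_induction with
  | mem x hx =>
    rcases hx with rfl | rfl
    · exact ⟨[.x, .y], by simpa [PL, pairM] using toGL_pairM (a := .x) (b := .y) (by simp)⟩
    · exact ⟨[.y, .z], by simpa [PL, pairM] using toGL_pairM (a := .y) (b := .z) (by simp)⟩
  | one => exact ⟨[], by simp [PL]⟩
  | mul x y _ _ hx hy =>
    obtain ⟨u, hu⟩ := hx
    obtain ⟨v, hv⟩ := hy
    exact ⟨u ++ v, by rw [map_mul, hu, hv, PL_append]⟩
  | inv x _ hx =>
    obtain ⟨u, hu⟩ := hx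
    refine ⟨u.reverse, ?_⟩
    rw [map_inv, hu]
    simp only [PL, List.prod_inv_reverse, List.map_reverse, List.map_map]
    rfl

lemma exists_io_pair (a b : Letter) : ∃ h : Gamma, io h = Rg a * Rg b := by
  by_cases hab : a = b
  · exact ⟨1, by rw [hab, Rg_mul_self, map_one]⟩
  · exact ⟨⟨pairM a b, pairM_mem a b⟩, toGL_pairM hab⟩

lemma exists_io_gg_even (m : ℤ) : ∃ h : Gamma, io h = gg W (2 * m) := by
  induction m using Int.induction_on with
  | zero => exact ⟨1, by simp [gg_zero]⟩
  | succ k ih =>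
    obtain ⟨h, hh⟩ := ih
    obtain ⟨h', hh'⟩ := exists_io_pair (W (2 * k)) (W (2 * k + 1))
    exact ⟨h * h', by rw [map_mul, hh, hh', show 2 * ((k : ℤ) + 1) = 2 * k + 1 + 1 by ring, gg_succ,
      gg_succ, mul_assoc]⟩
  | pred k ih =>
    obtain ⟨h, hh⟩ := ih
    obtain ⟨h', hh'⟩ := exists_io_pair (W (2 * -(k : ℤ) - 1)) (W (2 * -(k : ℤ) - 1 - 1))
    exact ⟨h * h', by rw [map_mul, hh, hh', show 2 * (-(k : ℤ) - 1) = 2 * -k - 1 - 1 by ring, gg_pred,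
      gg_pred, mul_assoc]⟩

lemma exists_io_gg {i j : ℤ} (hp : (i - j) % 2 = 0) : ∃ h : Gamma, io h = gg W i * (gg W j)⁻¹ := by
  rcases Int.emod_two_eq_zero_or_one i with hi | hi
  · obtain ⟨h, hh⟩ := exists_io_gg_even (W := W) (i / 2)
    obtain ⟨h', hh'⟩ := exists_io_gg_even (W := W) (j / 2)
    rw [show 2 * (i / 2) = i by omega] at hh
    rw [show 2 * (j / 2) = j by omega] at hh'
    exact ⟨h * h'⁻¹, by rw [map_mul, map_inv, hh, hh']⟩
  · obtain ⟨h, hh⟩ := exists_io_gg_even (W := W) (i / 2)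
    obtain ⟨h', hh'⟩ := exists_io_gg_even (W := W) (j / 2)
    obtain ⟨k, hk⟩ := exists_io_pair (W (2 * (i / 2))) (W (2 * (j / 2)))
    refine ⟨h * k * h'⁻¹, ?_⟩
    rw [map_mul, map_inv, map_mul, hh, hh', hk]
    have e1 := gg_succ (W := W) (2 * (i / 2))
    have e2 := gg_succ (W := W) (2 * (j / 2))
    rw [show 2 * (i / 2) + 1 = i by omega] at e1
    rw [show 2 * (j / 2) + 1 = j by omega] at e2
    rw [e1, e2, _root_.mul_inv_rev, Rg_inv]
    simp only [mul_assoc]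

end

section

open Matrix

variable {W : ℤ → Letter} {n : ℤ} {ξ η : ℤ → ℝ}

lemma not_cr_of_arc {a b c : Letter} {p q r s : ℝ} (hp : inI b p) (hq : inI c q) (hr : inI a r)
    (hs : inI a s) (hab : a ≠ b) (hac : a ≠ c) : ¬ Cr p q r s := by
  have key : ∀ d u, d ≠ a → inI d u → ((u < r ↔ u < s) ∧ (r < u ↔ s < u)) := by
    intro d u hd hu
    cases a <;> cases d <;> simp only [inI] at * <;> first
      | exact absurd rfl hd
      | (constructor <;> constructor <;> intro h <;> linarith)
  have h1 := key b p hab.symm hp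
  have h2 := key c q hac.symm hq
  unfold Cr betw
  tauto

lemma wedge_ratio {p : ℝ} {v w : ℝ × ℝ} (hv : v.1 = p * v.2) (hw : w.1 = p * w.2) : wedge v w = 0 := by
  simp only [wedge, hv, hw]; ring

/-- An element moved away from all frames moves the axis off itself. -/
lemma lam_pos_of_chain (hC : Cur W n) (h4 : 4 ≤ n) {i j : ℤ} {a : Letter} {u : List Letter}
    (ha : a ≠ W i) (ha' : a ≠ W (i - 1)) (h1 : (a :: u ++ [W j]).IsChain (· ≠ ·))
    (h2 : (a :: u ++ [W (j - 1)]).IsChain (· ≠ ·)) :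
    0 < lam (Mg W n i) (PL (a :: u) * Mg W n j * (PL (a :: u))⁻¹ : GL (Fin 2) ℤ) := by
  obtain ⟨ξ, η, hE⟩ := exists_ends hC h4
  set g := PL (a :: u) with hg
  set M' := g * Mg W n j * g⁻¹ with hM'
  have hdet : (M' : Mat).det = 1 := by
    rw [hM', Units.val_mul, Matrix.det_mul_comm, ← Units.val_mul, inv_mul_cancel_left, Mg_det hC]
  have htr : 2 < |(M' : Mat).trace| := by
    rw [hM', Units.val_mul, Matrix.trace_mul_comm, ← Units.val_mul, inv_mul_cancel_left]
    exact (Mg_hyp hC h4 j).2.2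
  obtain ⟨hc, p, q, hpq, hr⟩ := exists_roots hdet htr
  have c1 : cone a (act g (ξ j, 1)) := by simpa using cone_PL ((cone_one _ _).2 (hE.inx j)) (a :: u) h1
  have c2 : cone a (act g (η j, 1)) := by simpa using cone_PL ((cone_one _ _).2 (hE.iny j)) (a :: u) h2
  have q1 : qv M' (act g (ξ j, 1)) = 0 := by
    have := qv_conj g (Mg W n j) (ξ j, 1)
    rw [hM', Units.val_mul, Units.val_mul, this, qv_roots (hE.roots j)]; simp
  have q2 : qv M' (act g (η j, 1)) = 0 := by
    have := qv_conj g (Mg W n j) (η j, 1)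
    rw [hM', Units.val_mul, Units.val_mul, this, qv_roots (hE.roots j)]; simp
  have hw : wedge (act g (ξ j, 1)) (act g (η j, 1)) ≠ 0 := by
    rw [wedge_act, PL_det]
    have h0 := hE.xi_ne_eta hC j
    simp only [wedge, one_mul, mul_one]
    split_ifs
    · push_cast; intro h; apply h0; linarith
    · push_cast; intro h; apply h0; linarith
  have hc' : ((M' : Mat) 1 0 : ℝ) ≠ 0 := by exact_mod_cast hc
  rw [qv_roots hr, mul_eq_zero, mul_eq_zero, or_iff_right hc', sub_eq_zero, sub_eq_zero] at q1 q2
  have hin : inI a p ∧ inI a q := by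
    rcases q1 with q1 | q1 <;> rcases q2 with q2 | q2
    · exact absurd (wedge_ratio q1 q2) hw
    · exact ⟨cone_scale c1 q1, cone_scale c2 q2⟩
    · exact ⟨cone_scale c2 q2, cone_scale c1 q1⟩
    · exact absurd (wedge_ratio q1 q2) hw
  have hdiff : ∀ {b : Letter} {s t : ℝ}, inI b s → inI a t → a ≠ b → s ≠ t := by
    rintro b s t hs ht hab rfl
    exact hab (inI_unique ht hs)
  have d1 := hdiff (hE.inx i) hin.1 ha
  have d2 := hdiff (hE.inx i) hin.2 ha
  have d3 := hdiff (hE.iny i) hin.1 ha'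
  have d4 := hdiff (hE.iny i) hin.2 ha'
  have h5 := lam_ne_zero (hE.roots i) hr (hE.ne0 i) hc ⟨d1, d2, d3, d4⟩
  have h6 := lam_neg_iff (hE.roots i) hr (hE.ne0 i) hc d1 d2 d3 d4
  have h7 := not_cr_of_arc (hE.inx i) (hE.iny i) hin.1 hin.2 ha ha'
  rw [h6] at h7
  omega

lemma frame_or (hC : Cur W n) (h4 : 4 ≤ n) {v : Gamma} (hv : io v = gg W n) (h : Gamma) :
    (∃ i j, (i - j) % 2 = 0 ∧ io h = gg W i * (gg W j)⁻¹) ∨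
      0 < lam (io v : Mat) (io (h * v * h⁻¹) : Mat) := by
  have hex : ∃ m, ∃ u : List Letter, u.length = m ∧ ∃ i j, PL u = (gg W i)⁻¹ * io h * gg W j := by
    obtain ⟨u, hu⟩ := exists_PL h
    exact ⟨_, u, rfl, 0, 0, by simp [gg_zero, hu]⟩
  obtain ⟨u, hum, i, j, hu⟩ := Nat.find_spec hex
  have hmin : ∀ (u' : List Letter) (i j : ℤ), PL u' = (gg W i)⁻¹ * io h * gg W j → u.length ≤ u'.length := by
    intro u' i j h'
    rw [hum]
    exact Nat.find_min' hex ⟨u', rfl, i, j, h'⟩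
  have hh : io h = gg W i * PL u * (gg W j)⁻¹ := by rw [hu]; group
  cases u with
  | nil =>
    left
    refine ⟨i, j, ?_, by rw [hh, PL_nil, mul_one]⟩
    have h1 := congrArg (fun g : GL (Fin 2) ℤ => (g : Mat).det) hu
    simp only [PL_nil, Units.val_mul, det_mul, Units.val_one, det_one] at h1
    have h2 : (io h : Mat).det = 1 := h.1.2
    have h3 : (((gg W i)⁻¹ : GL (Fin 2) ℤ) : Mat).det * (gg W i : Mat).det = 1 := by
      rw [← det_mul, ← Units.val_mul, inv_mul_cancel]; simp
    rw [h2, mul_one] at h1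
    rw [gg_det] at h1 h3
    split_ifs at h3 with h5
    · split_ifs at h1 with h6
      · omega
      · omega
    · split_ifs at h1 with h6
      · omega
      · omega
  | cons a u =>
    right
    have chain : ∀ c j', gg W j' = gg W j * Rg c → (a :: u ++ [c]).IsChain (· ≠ ·) := by
      intro c j' hj'
      by_contra hcon
      obtain ⟨l₁, b, l₂, hl⟩ := exists_square_of_not_chain hcon
      rcases List.eq_nil_or_concat l₂ with rfl | ⟨l₃, d, rfl⟩
      · rw [show l₁ ++ [b, b] = (l₁ ++ [b]) ++ [b] by simp] at hl
        obtain ⟨h1, h2⟩ := List.append_inj' hl rfl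
        simp only [List.cons.injEq, and_true] at h2
        subst h2
        have := hmin l₁ i j' (by
          rw [hj', ← mul_assoc, ← hu, h1, PL_append]; simp [PL, mul_assoc, Rg_mul_self])
        rw [h1] at this
        simp at this
      · rw [List.concat_eq_append, show l₁ ++ b :: b :: (l₃ ++ [d]) = (l₁ ++ b :: b :: l₃) ++ [d] by simp] at hl
        obtain ⟨h1, h2⟩ := List.append_inj' hl rfl
        have := hmin (l₁ ++ l₃) i j (by
          rw [← hu, h1, PL_append, PL_append, PL_cons, PL_cons, ← mul_assoc (Rg b), Rg_mul_self, one_mul])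
        rw [h1] at this
        simp at this
    have head : ∀ i', gg W i' = gg W i * Rg a → False := by
      intro i' hi'
      have := hmin u i' j (by
        rw [hi', _root_.mul_inv_rev, Rg_inv, mul_assoc, mul_assoc, ← mul_assoc _ (io h), ← hu, PL_cons,
          ← mul_assoc, Rg_mul_self, one_mul])
      simp at this
    have := lam_pos_of_chain (a := a) (u := u) hC h4 (i := i) (j := j)
      (fun h' => head (i + 1) (by rw [gg_succ, h'])) (fun h' => head (i - 1) (by rw [gg_pred, h']))
      (chain _ (j + 1) (gg_succ j)) (chain _ (j - 1) (gg_pred j))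
    rw [← lam_conj (gg W i)] at this
    have e1 : gg W i * Mg W n i * (gg W i)⁻¹ = io v := by rw [hv, Mg]; group
    have e2 : gg W i * (PL (a :: u) * Mg W n j * (PL (a :: u))⁻¹) * (gg W i)⁻¹ = io (h * v * h⁻¹) := by
      rw [map_mul, map_mul, map_inv, hh, hv, Mg]; group
    rwa [e1, e2] at this

lemma lam_io_frames {v h : Gamma} (hv : io v = gg W n) {i j : ℤ} (hh : io h = gg W i * (gg W j)⁻¹) :
    lam (io v : Mat) (io (h * v * h⁻¹) : Mat) = lam (Mg W n i) (Mg W n j) := by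
  have e1 : gg W i * Mg W n i * (gg W i)⁻¹ = io v := by rw [hv, Mg]; group
  have e2 : gg W i * Mg W n j * (gg W i)⁻¹ = io (h * v * h⁻¹) := by
    rw [map_mul, map_mul, map_inv, hh, hv, Mg]; group
  rw [← lam_conj (gg W i) (Mg W n i) (Mg W n j), e1, e2]

lemma io_hyp (hC : Cur W n) (h4 : 4 ≤ n) {v : Gamma} (hv : io v = gg W n) (h : Gamma) :
    Hyperbolic ((h * v * h⁻¹ : Gamma) : SL2Z) := by
  unfold Hyperbolic
  have h1 := (Mg_hyp hC h4 0).2.2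
  have e : Mg W n 0 = io v := by rw [Mg, gg_zero, hv]; simp
  rw [e] at h1
  have : (((h * v * h⁻¹ : Gamma) : SL2Z) : Mat).trace = (io v : Mat).trace := by
    rw [← io_coe, map_mul, map_mul, map_inv, Units.val_mul, Matrix.trace_mul_comm, ← Units.val_mul,
      inv_mul_cancel_left]
  rw [this]; exact h1

lemma io_hyp_self (hC : Cur W n) (h4 : 4 ≤ n) {v : Gamma} (hv : io v = gg W n) :
    Hyperbolic (v : SL2Z) := by
  simpa using io_hyp hC h4 hv 1

lemma io_gg_zpow (hC : Cur W n) {v : Gamma} (hv : io v = gg W n) (m i : ℤ) :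
    io (v ^ m) * gg W i = gg W (i + n * m) := by
  rw [gg_add_mul hC, map_zpow, hv]

/-- Good conjugators come from pairs of vertices with crossing axes. -/
lemma goodConj_frames (hC : Cur W n) (h4 : 4 ≤ n) {v : Gamma} (hv : io v = gg W n) {h : Gamma}
    (hg : GoodConj v h) : ∃ i j, (i - j) % 2 = 0 ∧ ¬ n ∣ i - j ∧ io h = gg W i * (gg W j)⁻¹ ∧
      lam (Mg W n i) (Mg W n j) < 0 := by
  obtain ⟨h1, h2, h3⟩ := hg
  rcases frame_or hC h4 hv h with ⟨i, j, hp, hh⟩ | hpos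
  · have hn : ¬ n ∣ i - j := by
      rintro ⟨m, hm⟩
      have e : h = v ^ m := by
        apply io_inj
        rw [hh, show i = j + n * m by omega, ← io_gg_zpow hC hv, mul_inv_cancel_right]
      have : h * v * h⁻¹ = v := by
        rw [e, ← _root_.zpow_add_one, add_comm, _root_.zpow_one_add, mul_inv_cancel_right]
      rw [this] at h3
      exact not_linked_self _ h3
    refine ⟨i, j, hp, hn, hh, ?_⟩
    have hl := lam_io_frames hv hh
    have hne := lam_Mg_ne hC h4 hp hn
    rw [← hl] at hne ⊢
    exact (linked_iff_lam h1 h2 hne).1 h3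
  · exact absurd ((linked_iff_lam h1 h2 hpos.ne').1 h3) (not_lt.2 hpos.le)

lemma goodConj_of_lam (hC : Cur W n) (h4 : 4 ≤ n) {v : Gamma} (hv : io v = gg W n) {h : Gamma} {i j : ℤ}
    (hh : io h = gg W i * (gg W j)⁻¹) (hl : lam (Mg W n i) (Mg W n j) < 0) : GoodConj v h := by
  have h1 := io_hyp_self hC h4 hv
  have h2 := io_hyp hC h4 hv h
  refine ⟨h1, h2, ?_⟩
  rw [← lam_io_frames hv hh] at hl
  exact (linked_iff_lam h1 h2 hl.ne).2 hl

lemma lam_self (M : Mat) : lam M M = 0 := by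
  simp only [lam, trace_fin_two, det_fin_two, mul_apply, Fin.sum_univ_two]; ring

lemma notProperPower (hC : Cur W n) (h4 : 4 ≤ n) {v : Gamma} (hv : io v = gg W n) :
    NotProperPower v := by
  rintro ⟨u, k, hk, huk⟩
  have hcomm : u * v * u⁻¹ = v := by
    rw [huk, ← _root_.pow_succ', _root_.pow_succ, mul_inv_cancel_right]
  rcases frame_or hC h4 hv u with ⟨i, j, hp, hh⟩ | hpos
  · have e : Mg W n i = Mg W n j := by
      have h1 : io u * io v = io v * io u := by
        rw [← map_mul, ← map_mul, mul_inv_eq_iff_eq_mul.1 hcomm]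
      rw [hh, hv] at h1
      rw [Mg, Mg]
      have h2 := congrArg (fun g => (gg W i)⁻¹ * g * gg W j) h1
      simp only [mul_assoc, inv_mul_cancel, inv_mul_cancel_left, mul_one] at h2
      simp only [mul_assoc]
      exact h2.symm
    obtain ⟨m, hm⟩ := Mg_inj hC h4 hp e
    have e : u = v ^ m := by
      apply io_inj
      rw [hh, show i = j + n * m by omega, ← io_gg_zpow hC hv, mul_inv_cancel_right]
    rw [e, ← _root_.zpow_natCast, ← _root_.zpow_mul] at huk
    have h1 := io_gg_zpow hC hv (m * k) 0
    rw [← huk, gg_zero, mul_one, hv] at h1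
    have h2 := gg_inj hC h1
    rw [zero_add] at h2
    have h3 : m * k = 1 := by
      have hpos := hC.pos
      have : n * (m * k - 1) = 0 := by linarith
      rcases mul_eq_zero.1 this with h | h <;> omega
    have := Int.eq_one_or_neg_one_of_mul_eq_one' h3
    omega
  · rw [hcomm, lam_self] at hpos
    exact absurd hpos (lt_irrefl _)

lemma Iγ_eq (hC : Cur W n) (h4 : 4 ≤ n) {v : Gamma} (hv : io v = gg W n) :
    Iγ v = ((sTwo v / 2 : ℕ) : ℤ) := by
  have hnp := notProperPower hC h4 hv
  have hex : ∃ p : Gamma × ℕ, 1 ≤ p.2 ∧ NotProperPower p.1 ∧ v = p.1 ^ p.2 :=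
    ⟨(v, 1), le_rfl, hnp, by simp⟩
  have hs := hex.choose_spec
  unfold Iγ
  rw [dif_pos hex]
  generalize hex.choose = p at hs
  obtain ⟨h1, h2, h3⟩ := hs
  have h5 : p.2 = 1 := by
    by_contra hcon
    exact hnp ⟨p.1, p.2, by omega, h3⟩
  rw [h5, pow_one] at h3
  rw [h5, ← h3]; simp

/-- Pairs of vertices in a window of one period with crossing chords. -/
noncomputable def crPairs {K : Type*} [LinearOrder K] (κ : ℤ → K) (n t₀ : ℤ) : Finset (ℤ × ℤ) :=
  (Finset.Ico t₀ (t₀ + n) ×ˢ Finset.Ico t₀ (t₀ + n)).filter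
    (fun q => (q.1 - q.2) % 2 = 0 ∧ VCr κ q.1 q.2)

lemma mem_crPairs {K : Type*} [LinearOrder K] {κ : ℤ → K} {n t₀ : ℤ} {q : ℤ × ℤ} :
    q ∈ crPairs κ n t₀ ↔ (t₀ ≤ q.1 ∧ q.1 < t₀ + n) ∧ (t₀ ≤ q.2 ∧ q.2 < t₀ + n) ∧
      (q.1 - q.2) % 2 = 0 ∧ VCr κ q.1 q.2 := by
  simp [crPairs, and_assoc]

lemma vcr_congr {K : Type*} [LinearOrder K] {κ : ℤ → K} (hper : ∀ i, κ (i + n) = κ i) {i i' j j' : ℤ}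
    (hi : n ∣ i - i') (hj : n ∣ j - j') : VCr κ i j ↔ VCr κ i' j' := by
  unfold VCr
  rw [per_dvd hper hi, per_dvd hper hj, per_dvd hper (i := i - 1) (j := i' - 1) (by simpa using hi),
    per_dvd hper (i := j - 1) (j := j' - 1) (by simpa using hj)]

lemma gg_seg {i j : ℤ} {ε : Bool} {s t : ℤ} (hS : Seg W n i j ε s t) (m : ℕ) (hm : s + m ≤ t) :
    gg W (i + (s + m)) * (gg W (vx j ε (s + m)))⁻¹ = gg W (i + s) * (gg W (vx j ε s))⁻¹ := by
  induction m with
  | zero => simp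
  | succ m ih =>
    push_cast at hm ⊢
    rw [← ih (by omega), show s + ((m : ℤ) + 1) = s + m + 1 by ring, gg_vx_succ,
      show i + (s + m + 1) = i + (s + (m : ℤ)) + 1 by ring, gg_succ, hS.ag (s + m) (by omega) (by omega)]
    group

lemma gg_seg_eq {i j : ℤ} {ε : Bool} {s t k : ℤ} (hS : Seg W n i j ε s t) (hs : s ≤ 0) (ht : 0 ≤ t)
    (hk : s ≤ k) (hk' : k ≤ t) : gg W (i + k) * (gg W (vx j ε k))⁻¹ = gg W i * (gg W j)⁻¹ := by
  have h1 := gg_seg hS (k - s).toNat (by omega)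
  have h2 := gg_seg hS (-s).toNat (by omega)
  rw [show s + ((k - s).toNat : ℤ) = k by omega] at h1
  rw [show s + ((-s).toNat : ℤ) = 0 by omega, vx_zero, add_zero] at h2
  rw [h1, h2]

/-- The double coset relation on good conjugators. -/
def dcRel (v : Gamma) (h h' : {h : Gamma // GoodConj v h}) : Prop :=
  ∃ m k : ℤ, (h' : Gamma) = v ^ m * (h : Gamma) * v ^ k

lemma dcRel_equiv (v : Gamma) : Equivalence (dcRel v) where
  refl h := ⟨0, 0, by simp⟩
  symm := by
    rintro h h' ⟨m, k, e⟩
    exact ⟨-m, -k, by rw [e]; group⟩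
  trans := by
    rintro h h' h'' ⟨m, k, e⟩ ⟨m', k', e'⟩
    exact ⟨m' + m, k + k', by rw [e', e]; simp only [_root_.zpow_add, mul_assoc]⟩

lemma window_rep (hn : 0 < n) (t₀ i : ℤ) : ∃ m, t₀ ≤ i + n * m ∧ i + n * m < t₀ + n := by
  refine ⟨-((i - t₀) / n), ?_, ?_⟩
  · have := Int.emod_nonneg (i - t₀) hn.ne'
    have := Int.emod_add_mul_ediv (i - t₀) n
    linarith
  · have := Int.emod_lt_of_pos (i - t₀) hn
    have := Int.emod_add_mul_ediv (i - t₀) n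
    linarith

lemma exists_crossing_map (hC : Cur W n) (h4 : 4 ≤ n) {v : Gamma} (hv : io v = gg W n) {K : Type*} [LinearOrder K]
    {κ : ℤ → K} {p : Letter} (hD : Diag W n p κ) (t₀ : ℤ) :
    ∃ f : Quot (dcRel v) → {q // q ∈ crPairs κ n t₀}, Function.Injective f := by
  have key : ∀ c : Quot (dcRel v), ∃ q : ℤ × ℤ, q ∈ crPairs κ n t₀ ∧ ∃ h : {h : Gamma // GoodConj v h},
      Quot.mk _ h = c ∧ io h.1 = gg W q.1 * (gg W q.2)⁻¹ := by
    intro c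
    obtain ⟨⟨h, hg⟩, rfl⟩ := Quot.exists_rep c
    obtain ⟨i, j, hp, hn, hh, hl⟩ := goodConj_frames hC h4 hv hg
    obtain ⟨ε, s, t, hs, ht, hS⟩ := exists_seg_vertex hC hp hn
    rw [lam_seg_neg hC h4 hS hs ht] at hl
    obtain ⟨k, hk, hk', hcr⟩ := exists_vcr hC hD hS hl
    rw [← gg_seg_eq hS hs ht hk hk'] at hh
    obtain ⟨m, hm1, hm2⟩ := window_rep hC.pos t₀ (i + k)
    obtain ⟨l, hl1, hl2⟩ := window_rep hC.pos t₀ (vx j ε k)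
    have hio : io (v ^ m * h * v ^ (-l)) = gg W (i + k + n * m) * (gg W (vx j ε k + n * l))⁻¹ := by
      rw [_root_.zpow_neg, map_mul, map_mul, map_inv, hh, ← io_gg_zpow hC hv, ← io_gg_zpow hC hv]
      group
    have hpar : (i + k + n * m - (vx j ε k + n * l)) % 2 = 0 := by
      obtain ⟨r, hr⟩ := Int.dvd_of_emod_eq_zero hC.even
      rw [hr, mul_assoc, mul_assoc]
      unfold vx
      split_ifs <;> omega
    have hgood : GoodConj v (v ^ m * h * v ^ (-l)) := by
      apply goodConj_of_lam hC h4 hv (i := i + k + n * m) (j := vx j ε k + n * l) hio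
      have hl' := (lam_seg_neg hC h4 hS hs ht).2 hl
      rw [← lam_io_frames hv (hh.trans (gg_seg_eq hS hs ht hk hk')),
        lam_io_frames hv hh] at hl'
      have e : ∀ a b, Mg W n (a + n * b) = Mg W n a := by
        intro a b
        rw [Mg, Mg, gg_add_mul hC]; group
      rwa [e, e]
    refine ⟨(i + k + n * m, vx j ε k + n * l), ?_, ⟨_, hgood⟩, Quot.sound ⟨-m, l, ?_⟩, hio⟩
    · rw [mem_crPairs]
      exact ⟨⟨hm1, hm2⟩, ⟨hl1, hl2⟩, hpar,
        (vcr_congr hD.per (i' := i + k) (j' := vx j ε k) ⟨m, by ring⟩ ⟨l, by ring⟩).2 hcr⟩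
    · simp only []; group
  choose f hf1 hf2 using key
  have hinj : Function.Injective (fun c => (⟨f c, hf1 c⟩ : {q // q ∈ crPairs κ n t₀})) := by
    intro c c' h
    have h' : f c = f c' := congrArg Subtype.val h
    obtain ⟨a, ha, ha'⟩ := hf2 c
    obtain ⟨b, hb, hb'⟩ := hf2 c'
    rw [← ha, ← hb]
    congr 1
    apply Subtype.ext
    apply io_inj
    rw [ha', hb', h']
  exact ⟨_, hinj⟩

/-- Every diagram has at least as many crossings as linked double cosets. -/
lemma sTwo_le (hC : Cur W n) (h4 : 4 ≤ n) {v : Gamma} (hv : io v = gg W n) {K : Type*} [LinearOrder K]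
    {κ : ℤ → K} {p : Letter} (hD : Diag W n p κ) (t₀ : ℤ) : sTwo v ≤ (crPairs κ n t₀).card := by
  obtain ⟨f, hf⟩ := exists_crossing_map hC h4 hv hD t₀
  have h := Nat.card_le_card_of_injective f hf
  rwa [Nat.card_eq_fintype_card (α := {q // q ∈ crPairs κ n t₀}), Fintype.card_coe] at h

/-- The canonical diagram realises exactly the linked double cosets. -/
lemma le_sTwo (hC : Cur W n) (h4 : 4 ≤ n) {v : Gamma} (hv : io v = gg W n) (t₀ : ℤ) :
    (crPairs (can W) n t₀).card ≤ sTwo v := by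
  have hD := can_diag hC
  have seg : ∀ q ∈ crPairs (can W) n t₀, (¬ n ∣ q.1 - q.2) ∧ lam (Mg W n q.1) (Mg W n q.2) < 0 := by
    intro q hq
    rw [mem_crPairs] at hq
    obtain ⟨-, -, hp, hcr⟩ := hq
    have hn : ¬ n ∣ q.1 - q.2 := by
      intro hd
      rw [vcr_congr hD.per hd (j' := q.2) ⟨0, by ring⟩] at hcr
      apply hcr
      simp [betw]
    refine ⟨hn, ?_⟩
    obtain ⟨ε, s, t, hs, ht, hS⟩ := exists_seg_vertex hC hp hn
    rw [lam_seg_neg hC h4 hS hs ht]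
    exact can_ne hC hS hs ht (by rwa [add_zero, vx_zero])
  have key : ∀ q : {q // q ∈ crPairs (can W) n t₀}, ∃ h : {h : Gamma // GoodConj v h},
      io h.1 = gg W q.1.1 * (gg W q.1.2)⁻¹ := by
    rintro ⟨q, hq⟩
    obtain ⟨hn, hl⟩ := seg q hq
    rw [mem_crPairs] at hq
    obtain ⟨h, hh⟩ := exists_io_gg (W := W) hq.2.2.1
    exact ⟨⟨h, goodConj_of_lam hC h4 hv hh hl⟩, hh⟩
  choose f hf using key
  have hwin : ∀ a b m : ℤ, t₀ ≤ a → a < t₀ + n → t₀ ≤ b → b < t₀ + n → b = a + n * m → b = a := by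
    intro a b m h1 h2 h3 h4 h5
    have : m = 0 := by
      by_contra hm
      rcases lt_or_gt_of_ne hm with h | h
      · have : n * m ≤ n * (-1) := mul_le_mul_of_nonneg_left (by omega) hC.pos.le
        omega
      · have : n * 1 ≤ n * m := mul_le_mul_of_nonneg_left (by omega) hC.pos.le
        omega
    rw [h5, this]; ring
  have hinj : Function.Injective (fun q => Quot.mk (dcRel v) (f q)) := by
    rintro ⟨q, hq⟩ ⟨q', hq'⟩ h
    obtain ⟨m, k, e⟩ := ((dcRel_equiv v).eqvGen_iff).1 (Quot.eqvGen_exact h)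
    have e2 := congrArg io e
    rw [map_mul, map_mul, hf, hf] at e2
    have e3 : gg W q'.1 * (gg W q'.2)⁻¹ = gg W (q.1 + n * m) * (gg W (q.2 + n * (-k)))⁻¹ := by
      rw [e2, ← io_gg_zpow hC hv, ← io_gg_zpow hC hv, _root_.zpow_neg, map_inv]; group
    have g1 := mem_crPairs.1 hq
    have g2 := mem_crPairs.1 hq'
    obtain ⟨hn1, -⟩ := seg q hq
    obtain ⟨hn2, -⟩ := seg q' hq'
    have c1 : VCr (can W) (q.1 + n * m) (q.2 + n * (-k)) :=
      (vcr_congr hD.per ⟨m, by ring⟩ ⟨-k, by ring⟩).2 g1.2.2.2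
    have p1 : (q.1 + n * m - (q.2 + n * (-k))) % 2 = 0 := by
      obtain ⟨r, hr⟩ := Int.dvd_of_emod_eq_zero hC.even
      have := g1.2.2.1
      rw [hr, mul_assoc, mul_assoc]
      omega
    have n1 : ¬ n ∣ q.1 + n * m - (q.2 + n * (-k)) := by
      rintro ⟨r, hr⟩
      exact hn1 ⟨r - m - k, by linear_combination hr⟩
    have main : ∀ i j i' j' : ℤ, i ≤ i' → (i - j) % 2 = 0 → ¬ n ∣ i - j → VCr (can W) i j →
        VCr (can W) i' j' → gg W i * (gg W j)⁻¹ = gg W i' * (gg W j')⁻¹ → i = i' ∧ j = j' := by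
      intro i j i' j' hii hp hn hc hc' he
      have he' : (gg W i)⁻¹ * gg W i' = (gg W j)⁻¹ * gg W j' := by
        have h1 : gg W i' = gg W i * (gg W j)⁻¹ * gg W j' := by rw [he]; group
        rw [h1]; group
      obtain ⟨ε, hj', hag⟩ := gg_div_eq hC hii he'
      rcases hii.eq_or_lt with heq | hlt
      · subst heq
        rw [sub_self, vx_zero] at hj'
        exact ⟨rfl, hj'.symm⟩
      · exfalso
        have h0 := hag 0 le_rfl (by omega)
        obtain ⟨s, t, hs, ht, hS⟩ := exists_seg hC hp hn h0
        have htd : i' - i ≤ t := by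
          by_contra hcon
          exact hS.right (hag t (by omega) (by omega))
        refine can_nde hC hS (k := 0) (l := i' - i) hs (by omega) htd ?_ ?_
        · rwa [add_zero, vx_zero]
        · rwa [← hj', show i + (i' - i) = i' by ring]
    have res : q.1 + n * m = q'.1 ∧ q.2 + n * (-k) = q'.2 := by
      rcases le_total (q.1 + n * m) q'.1 with hle | hle
      · exact main _ _ _ _ hle p1 n1 c1 g2.2.2.2 e3.symm
      · have := main _ _ _ _ hle g2.2.2.1 hn2 g2.2.2.2 c1 e3
        exact ⟨this.1.symm, this.2.symm⟩
    apply Subtype.ext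
    apply Prod.ext
    · exact (hwin _ _ m g1.1.1 g1.1.2 g2.1.1 g2.1.2 res.1.symm).symm
    · exact (hwin _ _ (-k) g1.2.1.1 g1.2.1.2 g2.2.1.1 g2.2.1.2 res.2.symm).symm
  have hfin : Finite (Quot (dcRel v)) := by
    obtain ⟨g, hg⟩ := exists_crossing_map hC h4 hv hD t₀
    exact Finite.of_injective g hg
  have h := Nat.card_le_card_of_injective _ hinj
  rwa [Nat.card_eq_fintype_card (α := {q // q ∈ crPairs (can W) n t₀}), Fintype.card_coe] at h

end

section

/-- Integer labels `0, …, n - 1` of the points of a diagram; `X` and `β` separate the sides. -/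
structure Lab (W : ℤ → Letter) (n X β : ℤ) (r : ℤ → ℤ) : Prop where
  nonneg : ∀ i, 0 ≤ r i
  lt : ∀ i, r i < n
  per : ∀ i, r (i + n) = r i
  inj : ∀ i j, r i = r j → n ∣ i - j
  sx : ∀ i, W i = .x ↔ r i < X
  sz : ∀ i, W i = .z ↔ β ≤ r i
  left_nonneg : 0 ≤ X
  left_le : X ≤ β
  le_right : β ≤ n

/-- The transposition of `p` and `p + 1`. -/
def swp (p a : ℤ) : ℤ := if a = p then p + 1 else if a = p + 1 then p else a

/-- Apply a list of adjacent transpositions. -/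
def app : List ℤ → ℤ → ℤ
  | [], a => a
  | p :: T, a => app T (swp p a)

/-- Adjacent transpositions within one side. -/
def Val (n X β p : ℤ) : Prop := 0 ≤ p ∧ p + 1 < n ∧ p + 1 ≠ X ∧ p + 1 ≠ β

lemma swp_swp (p a : ℤ) : swp p (swp p a) = a := by
  unfold swp; split_ifs <;> omega

lemma app_append (T T' : List ℤ) (a : ℤ) : app (T ++ T') a = app T' (app T a) := by
  induction T generalizing a with
  | nil => rfl
  | cons p T ih => exact ih _

lemma app_reverse (T : List ℤ) (a : ℤ) : app T.reverse (app T a) = a := by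
  induction T generalizing a with
  | nil => rfl
  | cons p T ih => rw [List.reverse_cons, app_append, show app (p :: T) a = app T (swp p a) from rfl, ih]; exact swp_swp p a

section Rank
variable {W : ℤ → Letter} {n : ℤ} {K : Type*} [LinearOrder K] {κ : ℤ → K}

/-- The rank of a point of a diagram. -/
noncomputable def rk (κ : ℤ → K) (n i : ℤ) : ℤ :=
  (((Finset.Ico 0 n).filter (fun j => κ j < κ i)).card : ℤ)

lemma exists_rep (hn : 0 < n) (hper : ∀ i, κ (i + n) = κ i) (i : ℤ) :
    ∃ j, 0 ≤ j ∧ j < n ∧ κ j = κ i ∧ n ∣ j - i := by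
  obtain ⟨m, h1, h2⟩ := window_rep hn 0 i
  exact ⟨i + n * m, h1, by omega, per_mul hper i m, ⟨m, by ring⟩⟩

lemma rk_lt_of (hn : 0 < n) (hper : ∀ i, κ (i + n) = κ i) {i j : ℤ} (h : κ i < κ j) :
    rk κ n i < rk κ n j := by
  unfold rk
  norm_cast
  apply Finset.card_lt_card
  rw [Finset.ssubset_iff_of_subset]
  · obtain ⟨i', h1, h2, h3, -⟩ := exists_rep hn hper i
    exact ⟨i', by simp [h1, h2, h3, h], by simp [h3]⟩
  · intro k hk
    simp only [Finset.mem_filter] at hk ⊢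
    exact ⟨hk.1, hk.2.trans h⟩

lemma rk_lt_iff (hn : 0 < n) (hper : ∀ i, κ (i + n) = κ i) {i j : ℤ} :
    rk κ n i < rk κ n j ↔ κ i < κ j := by
  refine ⟨fun h => ?_, rk_lt_of hn hper⟩
  by_contra hcon
  rcases (not_lt.1 hcon).eq_or_lt with h1 | h1
  · rw [rk, rk, h1] at h; exact lt_irrefl _ h
  · exact lt_asymm h (rk_lt_of hn hper h1)

lemma vcr_rk (hn : 0 < n) (hper : ∀ i, κ (i + n) = κ i) (i j : ℤ) :
    VCr (rk κ n) i j ↔ VCr κ i j := by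
  simp only [VCr, Cr, betw, rk_lt_iff hn hper]

lemma lab_rk (hC : Cur W n) (hD : Diag W n .y κ) : Lab W n
    (((Finset.Ico 0 n).filter (fun j => W j = .x)).card : ℤ)
    (((Finset.Ico 0 n).filter (fun j => W j ≠ .z)).card : ℤ) (rk κ n) where
  nonneg i := by unfold rk; positivity
  lt i := by
    obtain ⟨i', h1, h2, h3, -⟩ := exists_rep hC.pos hD.per i
    have : ((Finset.Ico 0 n).filter (fun j => κ j < κ i)).card < (Finset.Ico 0 n).card := by
      apply Finset.card_lt_card
      rw [Finset.ssubset_iff_of_subset (Finset.filter_subset _ _)]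
      exact ⟨i', by simp [h1, h2], by simp [h3]⟩
    rw [Int.card_Ico] at this
    have := hC.pos
    unfold rk
    omega
  per i := by simp only [rk, hD.per]
  inj i j h := by
    apply hD.inj
    have h1 := rk_lt_iff hC.pos hD.per (i := i) (j := j)
    have h2 := rk_lt_iff hC.pos hD.per (i := j) (j := i)
    rw [h] at h1 h2
    exact le_antisymm (not_lt.1 (h2.not.1 (lt_irrefl _))) (not_lt.1 (h1.not.1 (lt_irrefl _)))
  sx i := by
    constructor
    · intro h
      unfold rk
      norm_cast
      apply Finset.card_lt_card
      rw [Finset.ssubset_iff_of_subset]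
      · obtain ⟨i', h1, h2, h3, hd⟩ := exists_rep hC.pos hD.per i
        exact ⟨i', by simp [h1, h2, per_dvd hC.per hd, h], by simp [h3]⟩
      · intro k hk
        simp only [Finset.mem_filter] at hk ⊢
        refine ⟨hk.1, ?_⟩
        by_contra hne
        refine lt_asymm hk.2 (hD.mono i k ?_)
        rw [h]
        cases hk' : W k <;> simp_all [ordp]
    · intro h
      by_contra hne
      refine not_le.2 h ?_
      unfold rk
      norm_cast
      apply Finset.card_le_card
      intro k hk
      simp only [Finset.mem_filter] at hk ⊢
      refine ⟨hk.1, hD.mono k i ?_⟩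
      rw [hk.2]
      cases hk' : W i <;> simp_all [ordp]
  sz i := by
    constructor
    · intro h
      unfold rk
      norm_cast
      apply Finset.card_le_card
      intro k hk
      simp only [Finset.mem_filter] at hk ⊢
      refine ⟨hk.1, hD.mono k i ?_⟩
      rw [h]
      cases hk' : W k <;> simp_all [ordp]
    · intro h
      by_contra hne
      refine not_lt.2 h ?_
      unfold rk
      norm_cast
      apply Finset.card_lt_card
      rw [Finset.ssubset_iff_of_subset]
      · obtain ⟨i', h1, h2, h3, hd⟩ := exists_rep hC.pos hD.per i
        exact ⟨i', by simp [h1, h2, per_dvd hC.per hd, hne], by simp [h3]⟩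
      · intro k hk
        simp only [Finset.mem_filter] at hk ⊢
        refine ⟨hk.1, ?_⟩
        intro hz
        refine lt_asymm hk.2 (hD.mono i k ?_)
        rw [hz]
        cases hk' : W i <;> simp_all [ordp]
  left_nonneg := by positivity
  left_le := by
    norm_cast
    apply Finset.card_le_card
    intro k hk
    simp only [Finset.mem_filter] at hk ⊢
    exact ⟨hk.1, by rw [hk.2]; simp⟩
  le_right := by
    have := Finset.card_filter_le (Finset.Ico 0 n) (fun j => W j ≠ .z)
    rw [Int.card_Ico] at this
    have := hC.pos
    omega

end Rank

variable {W : ℤ → Letter} {n X β : ℤ} {r : ℤ → ℤ}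

lemma Lab.surj (hC : Cur W n) (h : Lab W n X β r) {p : ℤ} (h0 : 0 ≤ p) (h1 : p < n) : ∃ i, r i = p := by
  have himg : (Finset.Ico 0 n).image r = Finset.Ico 0 n := by
    apply Finset.eq_of_subset_of_card_le
    · intro k hk
      obtain ⟨i, -, rfl⟩ := Finset.mem_image.1 hk
      exact Finset.mem_Ico.2 ⟨h.nonneg i, h.lt i⟩
    · rw [Finset.card_image_of_injOn]
      intro i hi j hj hij
      obtain ⟨m, hm⟩ := h.inj i j hij
      simp only [Finset.coe_Ico, Set.mem_Ico] at hi hj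
      have : m = 0 := by
        by_contra hm0
        rcases lt_or_gt_of_ne hm0 with h2 | h2
        · have : n * m ≤ n * (-1) := mul_le_mul_of_nonneg_left (by omega) hC.pos.le
          omega
        · have : n * 1 ≤ n * m := mul_le_mul_of_nonneg_left (by omega) hC.pos.le
          omega
      rw [this, mul_zero] at hm
      omega
  have hp : p ∈ (Finset.Ico 0 n).image r := by rw [himg]; exact Finset.mem_Ico.2 ⟨h0, h1⟩
  obtain ⟨i, -, hi⟩ := Finset.mem_image.1 hp
  exact ⟨i, hi⟩

lemma swp_lt {p a b : ℤ} (h1 : ¬ (a = p ∧ b = p + 1)) (h2 : ¬ (a = p + 1 ∧ b = p)) :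
    swp p a < swp p b ↔ a < b := by
  unfold swp; split_ifs <;> omega

lemma swp_inj {p a b : ℤ} (h : swp p a = swp p b) : a = b := by
  rw [← swp_swp p a, h, swp_swp]

lemma lab_swp (h : Lab W n X β r) {p : ℤ} (hp : Val n X β p) : Lab W n X β (fun i => swp p (r i)) := by
  obtain ⟨h1, h2, h3, h4⟩ := hp
  refine ⟨fun i => ?_, fun i => ?_, fun i => ?_, fun i j hij => h.inj i j (swp_inj hij), fun i => ?_, fun i => ?_,
    h.left_nonneg, h.left_le, h.le_right⟩
  · have := h.nonneg i; unfold swp; split_ifs <;> omega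
  · have := h.lt i; unfold swp; split_ifs <;> omega
  · simp only [h.per]
  · rw [h.sx i]; unfold swp; split_ifs <;> omega
  · rw [h.sz i]; unfold swp; split_ifs <;> omega

/-- Chords of the same family are disjoint. -/
lemma Lab.chord_eq (hC : Cur W n) (h : Lab W n X β r) {i j : ℤ} (hp : i % 2 = j % 2) {a : ℤ}
    (h1 : r (i - 1) = a ∨ r i = a) (h2 : r (j - 1) = a ∨ r j = a) : n ∣ i - j := by
  obtain ⟨m, hm⟩ := Int.dvd_of_emod_eq_zero hC.even
  rcases h1 with h1 | h1 <;> rcases h2 with h2 | h2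
  · simpa using h.inj _ _ (h1.trans h2.symm)
  · obtain ⟨k, hk⟩ := h.inj _ _ (h1.trans h2.symm)
    rw [hm, mul_assoc] at hk
    omega
  · obtain ⟨k, hk⟩ := h.inj _ _ (h1.trans h2.symm)
    rw [hm, mul_assoc] at hk
    omega
  · exact h.inj _ _ (h1.trans h2.symm)

lemma not_vcr_self (κ : ℤ → ℤ) (i : ℤ) : ¬ VCr κ i i := by simp [VCr, Cr, betw]

lemma cr_symm {a b c d : ℤ} (h1 : a ≠ c) (h2 : a ≠ d) (h3 : b ≠ c) (h4 : b ≠ d) (h : Cr a b c d) :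
    Cr c d a b := by
  unfold Cr betw at *; omega

lemma Lab.vcr_symm (hC : Cur W n) (h : Lab W n X β r) {i j : ℤ} (hp : i % 2 = j % 2) (hc : VCr r i j) :
    VCr r j i := by
  have hnd : ¬ n ∣ i - j := by
    intro hd
    rw [vcr_congr h.per hd (j' := j) ⟨0, by ring⟩] at hc
    exact not_vcr_self r j hc
  have hdis : ∀ a, (r (i - 1) = a ∨ r i = a) → ¬ (r (j - 1) = a ∨ r j = a) :=
    fun a h1 h2 => hnd (h.chord_eq hC hp h1 h2)
  have d1 := hdis _ (Or.inl rfl)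
  have d2 := hdis _ (Or.inr rfl)
  exact cr_symm (by omega) (by omega) (by omega) (by omega) hc

lemma cr_swp {p a b c d : ℤ}
    (h1 : ¬ ((a = p ∨ b = p) ∧ (c = p + 1 ∨ d = p + 1)))
    (h2 : ¬ ((a = p + 1 ∨ b = p + 1) ∧ (c = p ∨ d = p))) :
    Cr (swp p a) (swp p b) (swp p c) (swp p d) ↔ Cr a b c d := by
  unfold Cr betw
  rw [swp_lt (a := a) (b := c) (by omega) (by omega), swp_lt (a := c) (b := b) (by omega) (by omega),
    swp_lt (a := b) (b := c) (by omega) (by omega), swp_lt (a := c) (b := a) (by omega) (by omega),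
    swp_lt (a := a) (b := d) (by omega) (by omega), swp_lt (a := d) (b := b) (by omega) (by omega),
    swp_lt (a := b) (b := d) (by omega) (by omega), swp_lt (a := d) (b := a) (by omega) (by omega)]

lemma not_cr_swp {p b d : ℤ} (hb : b ≠ p) (hb' : b ≠ p + 1) (hd : d ≠ p) (hd' : d ≠ p + 1)
    (h : Cr p b (p + 1) d) : ¬ Cr (swp p p) (swp p b) (swp p (p + 1)) (swp p d) := by
  have e1 : swp p p = p + 1 := by simp [swp]
  have e2 : swp p (p + 1) = p := by simp [swp]
  have e3 : swp p b = b := by simp [swp, hb, hb']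
  have e4 : swp p d = d := by simp [swp, hd, hd']
  rw [e1, e2, e3, e4]
  unfold Cr betw at *
  omega

/-- Two crossing chords with adjacent end points on one side. -/
def Adj (X β ε : ℤ) (r : ℤ → ℤ) : Prop :=
  ∃ i j p, i % 2 = ε ∧ j % 2 = ε ∧ VCr r i j ∧ (r (i - 1) = p ∨ r i = p) ∧
    (r (j - 1) = p + 1 ∨ r j = p + 1) ∧ p + 1 ≠ X ∧ p + 1 ≠ β

lemma uncross_step (hC : Cur W n) (h : Lab W n X β r) {i j p : ℤ} (hij : i % 2 = j % 2) (hc : VCr r i j)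
    (hi : r (i - 1) = p ∨ r i = p) (hj : r (j - 1) = p + 1 ∨ r j = p + 1) (hv : Val n X β p) :
    ¬ VCr (fun i => swp p (r i)) i j ∧
      ∀ i' j', i' % 2 = i % 2 → j' % 2 = i % 2 → VCr (fun i => swp p (r i)) i' j' → VCr r i' j' := by
  have hsym : ∀ (κ : ℤ → ℤ) i j, VCr κ i j ↔ Cr (κ i) (κ (i - 1)) (κ (j - 1)) (κ j) :=
    fun κ i j => (cr_swap_left _ _ _ _).symm
  have hsym' : ∀ (κ : ℤ → ℤ) i j, VCr κ i j ↔ Cr (κ (i - 1)) (κ i) (κ j) (κ (j - 1)) :=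
    fun κ i j => (cr_swap_right _ _ _ _).symm
  have hsym'' : ∀ (κ : ℤ → ℤ) i j, VCr κ i j ↔ Cr (κ i) (κ (i - 1)) (κ j) (κ (j - 1)) :=
    fun κ i j => (hsym κ i j).trans (cr_swap_right _ _ _ _).symm
  have hnd : ¬ n ∣ i - j := by
    intro hd
    rw [vcr_congr h.per hd (j' := j) ⟨0, by ring⟩] at hc
    exact not_vcr_self r j hc
  have hdis : ∀ a, (r (i - 1) = a ∨ r i = a) → ¬ (r (j - 1) = a ∨ r j = a) :=
    fun a h1 h2 => hnd (h.chord_eq hC hij h1 h2)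
  have hself : ∀ i, r (i - 1) ≠ r i := by
    intro i hi
    obtain ⟨m, hm⟩ := Int.dvd_of_emod_eq_zero hC.even
    obtain ⟨k, hk⟩ := h.inj _ _ hi
    rw [hm, mul_assoc] at hk
    omega
  have hmain : ¬ VCr (fun i => swp p (r i)) i j := by
    have d1 := hdis p hi
    have d2 : ¬ (r (i - 1) = p + 1 ∨ r i = p + 1) := fun h1 => hdis _ h1 hj
    have s1 := hself i
    have s2 := hself j
    rcases hi with hi | hi <;> rcases hj with hj | hj
    · rw [VCr] at hc ⊢
      rw [hi, hj] at hc ⊢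
      exact not_cr_swp (by omega) (by omega) (by omega) (by omega) hc
    · rw [hsym'] at hc ⊢
      rw [hi, hj] at hc ⊢
      exact not_cr_swp (by omega) (by omega) (by omega) (by omega) hc
    · rw [hsym] at hc ⊢
      rw [hi, hj] at hc ⊢
      exact not_cr_swp (by omega) (by omega) (by omega) (by omega) hc
    · rw [hsym''] at hc ⊢
      rw [hi, hj] at hc ⊢
      exact not_cr_swp (by omega) (by omega) (by omega) (by omega) hc
  refine ⟨hmain, fun i' j' hi' hj' hc' => ?_⟩
  have hper' : ∀ i, (fun i => swp p (r i)) (i + n) = (fun i => swp p (r i)) i := fun i => by simp only [h.per]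
  by_cases h1 : (r (i' - 1) = p ∨ r i' = p) ∧ (r (j' - 1) = p + 1 ∨ r j' = p + 1)
  · rwa [vcr_congr h.per (h.chord_eq hC hi' h1.1 hi) (h.chord_eq hC (hj'.trans hij) h1.2 hj)]
  by_cases h2 : (r (i' - 1) = p + 1 ∨ r i' = p + 1) ∧ (r (j' - 1) = p ∨ r j' = p)
  · exfalso
    rw [vcr_congr hper' (h.chord_eq hC (hi'.trans hij) h2.1 hj) (h.chord_eq hC hj' h2.2 hi)] at hc'
    exact hmain ((lab_swp h hv).vcr_symm hC hij.symm hc')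
  exact hc' |> (cr_swp h1 h2).1

/-- The crossings in one family of chords. -/
noncomputable def crV (ε : ℤ) (r : ℤ → ℤ) (n : ℤ) : Finset (ℤ × ℤ) :=
  (crPairs r n 0).filter (fun q => q.1 % 2 = ε)

lemma mem_crV {ε : ℤ} {q : ℤ × ℤ} : q ∈ crV ε r n ↔ (0 ≤ q.1 ∧ q.1 < n) ∧ (0 ≤ q.2 ∧ q.2 < n) ∧
    q.1 % 2 = ε ∧ q.2 % 2 = ε ∧ VCr r q.1 q.2 := by
  rw [crV, Finset.mem_filter, mem_crPairs, zero_add]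
  constructor
  · rintro ⟨⟨h1, h2, h3, h4⟩, h5⟩
    exact ⟨h1, h2, h5, by omega, h4⟩
  · rintro ⟨h1, h2, h3, h4, h5⟩
    exact ⟨⟨h1, h2, by omega, h5⟩, h3⟩

/-- Uncross one family of chords by adjacent transpositions. -/
lemma uncross (hC : Cur W n) (ε : ℤ) (m : ℕ) : ∀ r : ℤ → ℤ, Lab W n X β r → (crV ε r n).card ≤ m →
    ∃ T : List ℤ, (∀ p ∈ T, Val n X β p) ∧ Lab W n X β (fun i => app T (r i)) ∧
      ¬ Adj X β ε (fun i => app T (r i)) ∧ 2 * T.length ≤ (crV ε r n).card := by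
  induction m using Nat.strong_induction_on with
  | _ m ih =>
    intro r h hm
    by_cases hA : Adj X β ε r
    · obtain ⟨i₀, j₀, p, hi, hj, hc, hip, hjp, hX, hβ⟩ := hA
      have hv : Val n X β p := by
        refine ⟨?_, ?_, hX, hβ⟩
        · rcases hip with rfl | rfl <;> exact h.nonneg _
        · rcases hjp with e | e <;> rw [← e] <;> exact h.lt _
      obtain ⟨a, ha1, ha2⟩ := window_rep hC.pos 0 i₀
      obtain ⟨b, hb1, hb2⟩ := window_rep hC.pos 0 j₀
      obtain ⟨l, hl⟩ := Int.dvd_of_emod_eq_zero hC.even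
      have pa : (i₀ + n * a) % 2 = ε := by rw [hl, mul_assoc]; omega
      have pb : (j₀ + n * b) % 2 = ε := by rw [hl, mul_assoc]; omega
      have hc1 : VCr r (i₀ + n * a) (j₀ + n * b) :=
        (vcr_congr h.per ⟨a, by ring⟩ ⟨b, by ring⟩).2 hc
      have ra : ∀ i a, r (i + n * a) = r i := fun i a => per_mul h.per i a
      have ra' : ∀ i a, r (i + n * a - 1) = r (i - 1) := fun i a => by
        rw [show i + n * a - 1 = i - 1 + n * a by ring, ra]
      obtain ⟨s1, s2⟩ := uncross_step hC h (pa.trans pb.symm) hc1 (p := p) (by rwa [ra, ra'])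
        (by rwa [ra, ra']) hv
      have h' := lab_swp h hv
      set r' := fun i => swp p (r i) with hr'
      have hsub : crV ε r' n ∪ {(i₀ + n * a, j₀ + n * b), (j₀ + n * b, i₀ + n * a)} ⊆ crV ε r n := by
        intro q hq
        rcases Finset.mem_union.1 hq with hq | hq
        · rw [mem_crV] at hq ⊢
          obtain ⟨q1, q2, q3, q4, q5⟩ := hq
          exact ⟨q1, q2, q3, q4, s2 _ _ (by omega) (by omega) q5⟩
        · rw [Finset.mem_insert, Finset.mem_singleton] at hq
          rcases hq with rfl | rfl
          · exact mem_crV.2 ⟨⟨ha1, by omega⟩, ⟨hb1, by omega⟩, pa, pb, hc1⟩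
          · exact mem_crV.2 ⟨⟨hb1, by omega⟩, ⟨ha1, by omega⟩, pb, pa, h.vcr_symm hC (pa.trans pb.symm) hc1⟩
      have hdisj : Disjoint (crV ε r' n) {(i₀ + n * a, j₀ + n * b), (j₀ + n * b, i₀ + n * a)} := by
        rw [Finset.disjoint_right]
        intro q hq hq'
        rw [mem_crV] at hq'
        rw [Finset.mem_insert, Finset.mem_singleton] at hq
        rcases hq with rfl | rfl
        · exact s1 hq'.2.2.2.2
        · exact s1 (h'.vcr_symm hC (pb.trans pa.symm) hq'.2.2.2.2)
      have hne : i₀ + n * a ≠ j₀ + n * b := by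
        intro e
        rw [e] at hc1
        exact not_vcr_self _ _ hc1
      have hcard := Finset.card_le_card hsub
      rw [Finset.card_union_of_disjoint hdisj, Finset.card_pair (by simp [hne])] at hcard
      obtain ⟨T, t1, t2, t3, t4⟩ := ih (crV ε r' n).card (by omega) r' h' le_rfl
      refine ⟨p :: T, ?_, t2, t3, ?_⟩
      · intro q hq
        rcases List.mem_cons.1 hq with rfl | hq
        · exact hv
        · exact t1 q hq
      · rw [List.length_cons]; omega
    · exact ⟨[], by simp, h, hA, by simp⟩

end

section

section Arcs

lemma match_eq {m : ℤ → ℤ → Prop} (h0 : ∀ k l, m k l → 0 ≤ k ∧ 0 ≤ l)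
    (h1 : ∀ k l, 0 ≤ k → m (k + 1) l → ∃ l' < l, m k l')
    (h2 : ∀ k l, 0 ≤ l → m k (l + 1) → ∃ k' < k, m k' l) {k l : ℤ} (h : m k l) :
    k = l ∧ ∀ k', 0 ≤ k' → k' ≤ k → m k' k' := by
  have h1' : ∀ d : ℕ, ∀ k l, 0 ≤ k → m (k + d + 1) l → ∃ l' < l, m k l' := by
    intro d
    induction d with
    | zero => intro k l hk h; exact h1 k l hk (by simpa using h)
    | succ d ih =>
      intro k l hk h
      push_cast at h
      obtain ⟨l', h3, h4⟩ := h1 (k + d + 1) l (by omega) (by rwa [show k + (d : ℤ) + 1 + 1 = k + (d + 1) + 1 by ring])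
      obtain ⟨l'', h5, h6⟩ := ih k l' hk h4
      exact ⟨l'', by omega, h6⟩
  have h2' : ∀ d : ℕ, ∀ k l, 0 ≤ l → m k (l + d + 1) → ∃ k' < k, m k' l := by
    intro d
    induction d with
    | zero => intro k l hk h; exact h2 k l hk (by simpa using h)
    | succ d ih =>
      intro k l hk h
      push_cast at h
      obtain ⟨l', h3, h4⟩ := h2 k (l + d + 1) (by omega) (by rwa [show l + (d : ℤ) + 1 + 1 = l + (d + 1) + 1 by ring])
      obtain ⟨l'', h5, h6⟩ := ih l' l hk h4
      exact ⟨l'', by omega, h6⟩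
  have main : ∀ N : ℕ, ∀ k l : ℤ, k < (N : ℤ) → m k l → k = l := by
    intro N
    induction N with
    | zero => intro k l hk h; have := h0 k l h; omega
    | succ N ih =>
      intro k l hk h
      have h3 := h0 k l h
      rcases lt_trichotomy l k with hlt | heq | hgt
      · obtain ⟨l', h4, h5⟩ := h1' (k - l - 1).toNat l l h3.2 (by
          rwa [show l + ((k - l - 1).toNat : ℤ) + 1 = k by omega])
        have := ih l l' (by omega) h5
        omega
      · exact heq.symm
      · obtain ⟨k', h4, h5⟩ := h2' (l - k - 1).toNat k k h3.1 (by
          rwa [show k + ((l - k - 1).toNat : ℤ) + 1 = l by omega])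
        have := ih k' k (by omega) h5
        omega
  have hk := h0 k l h
  refine ⟨main (k.toNat + 1) k l (by omega) h, fun k' hk' hle => ?_⟩
  rcases hle.eq_or_lt with rfl | hlt
  · rwa [← main (k'.toNat + 1) k' l (by omega) h] at h
  · obtain ⟨l', -, h5⟩ := h1' (k - k' - 1).toNat k' l hk' (by
      rwa [show k' + ((k - k' - 1).toNat : ℤ) + 1 = k by omega])
    rwa [← main (k'.toNat + 1) k' l' (by omega) h5] at h5

lemma exists_bound {P : ℤ → Prop} {B : ℤ} (h0 : ∀ k, P k → 0 ≤ k ∧ k < B)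
    (h1 : ∀ k k', P k → 0 ≤ k' → k' ≤ k → P k') : ∃ a, 0 ≤ a ∧ ∀ k, P k ↔ 0 ≤ k ∧ k < a := by
  have hex : ∃ m : ℕ, ¬ P m := ⟨B.toNat, fun h => by have := h0 _ h; omega⟩
  refine ⟨Nat.find hex, by positivity, fun k => ⟨fun h => ?_, fun h => ?_⟩⟩
  · refine ⟨(h0 k h).1, ?_⟩
    by_contra hcon
    exact Nat.find_spec hex (h1 k _ h (by positivity) (by omega))
  · have := Nat.find_min hex (m := k.toNat) (by omega)
    rw [not_not, Int.toNat_of_nonneg h.1] at this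
    exact this

/-- The crossing-free matching of the boundary points of a triangle. -/
def tau0 (a b c p : ℤ) : ℤ :=
  if p < c then 2 * (a + b + c) - 1 - p
  else if p < 2 * a + c then 2 * a + 2 * c - 1 - p
  else if p < 2 * a + 2 * b + c then 4 * a + 2 * b + 2 * c - 1 - p
  else 2 * (a + b + c) - 1 - p

variable {X β n : ℤ} {τ : ℤ → ℤ}

/-- A matching without adjacent crossings is the crossing-free one. -/
lemma eq_tau0 (hX : 0 ≤ X) (hXβ : X ≤ β) (hβ : β ≤ n)
    (rng : ∀ p, 0 ≤ p → p < n → 0 ≤ τ p ∧ τ p < n) (inv : ∀ p, 0 ≤ p → p < n → τ (τ p) = p)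
    (sd : ∀ p, 0 ≤ p → p < n → (p < X → X ≤ τ p) ∧ (X ≤ p → p < β → τ p < X ∨ β ≤ τ p) ∧ (β ≤ p → τ p < β))
    (nc : ∀ p, 0 ≤ p → p + 1 < n → p + 1 ≠ X → p + 1 ≠ β → ¬ Cr p (τ p) (p + 1) (τ (p + 1))) :
    ∃ a b c, 0 ≤ a ∧ 0 ≤ b ∧ 0 ≤ c ∧ X = a + c ∧ β = 2 * a + b + c ∧ n = 2 * (a + b + c) ∧
      ∀ p, 0 ≤ p → p < n → τ p = tau0 a b c p := by
  have nc' : ∀ p, 0 ≤ p → p + 1 < n → p + 1 ≠ X → p + 1 ≠ β →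
      (τ p < p ∧ τ (p + 1) < p ∧ τ (p + 1) < τ p) ∨ (τ p < p ∧ p + 1 < τ (p + 1)) ∨
      (p + 1 < τ p ∧ p + 1 < τ (p + 1) ∧ τ (p + 1) < τ p) := by
    intro p h0 h1 h2 h3
    have h4 := nc p h0 h1 h2 h3
    have h5 := sd p h0 (by omega)
    have h6 := sd (p + 1) (by omega) h1
    have h7 := inv p h0 (by omega)
    have h8 := inv (p + 1) (by omega) h1
    have h9 : τ p ≠ τ (p + 1) := by intro h; rw [h, h8] at h7; omega
    unfold Cr betw at h4
    omega
  have xy : ∀ p, 0 ≤ p → p < X → τ p < β → τ p = 2 * X - 1 - p ∧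
      ∀ k, 0 ≤ k → k ≤ X - 1 - p → τ (X - 1 - k) = X + k ∧ τ (X + k) = X - 1 - k ∧ k < X ∧ X + k < β := by
    intro p h0 h1 h2
    have h3 := (sd p h0 (by omega)).1 h1
    obtain ⟨e1, e2⟩ := match_eq (m := fun k l => 0 ≤ k ∧ 0 ≤ l ∧ k < X ∧ X + l < β ∧ τ (X - 1 - k) = X + l)
      (k := X - 1 - p) (l := τ p - X) (fun k l h => ⟨h.1, h.2.1⟩) (by
        rintro k l hk ⟨g1, g2, g3, g4, g5⟩
        have := nc' (X - 1 - (k + 1)) (by omega) (by omega) (by omega) (by omega)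
        rw [show X - 1 - (k + 1) + 1 = X - 1 - k by ring] at this
        have := sd (X - 1 - k) (by omega) (by omega)
        exact ⟨τ (X - 1 - k) - X, by omega, by omega, by omega, by omega, by omega, by omega⟩) (by
        rintro k l hl ⟨g1, g2, g3, g4, g5⟩
        have := nc' (X + l) (by omega) (by omega) (by omega) (by omega)
        have e := inv (X - 1 - k) (by omega) (by omega)
        rw [g5, ← add_assoc] at e
        have e' := inv (X + l) (by omega) (by omega)
        have := sd (X + l) (by omega) (by omega)
        have := rng (X + l) (by omega) (by omega)
        refine ⟨X - 1 - τ (X + l), by omega, by omega, by omega, by omega, by omega, ?_⟩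
        rw [show X - 1 - (X - 1 - τ (X + l)) = τ (X + l) by ring]; exact e') 
      ⟨by omega, by omega, by omega, by omega, by rw [show X - 1 - (X - 1 - p) = p by ring]; omega⟩
    refine ⟨by omega, fun k hk hk' => ?_⟩
    obtain ⟨g1, g2, g3, g4, g5⟩ := e2 k hk hk'
    have e := inv (X - 1 - k) (by omega) (by omega)
    rw [g5] at e
    exact ⟨g5, e, g3, g4⟩
  have yz : ∀ p, X ≤ p → p < β → β ≤ τ p → τ p = 2 * β - 1 - p ∧
      ∀ k, 0 ≤ k → k ≤ β - 1 - p → τ (β - 1 - k) = β + k ∧ τ (β + k) = β - 1 - k ∧ X ≤ β - 1 - k ∧ β + k < n := by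
    intro p h0 h1 h2
    have h3 := rng p (by omega) (by omega)
    obtain ⟨e1, e2⟩ := match_eq (m := fun k l => 0 ≤ k ∧ 0 ≤ l ∧ X ≤ β - 1 - k ∧ β + l < n ∧ τ (β - 1 - k) = β + l)
      (k := β - 1 - p) (l := τ p - β) (fun k l h => ⟨h.1, h.2.1⟩) (by
        rintro k l hk ⟨g1, g2, g3, g4, g5⟩
        have := nc' (β - 1 - (k + 1)) (by omega) (by omega) (by omega) (by omega)
        rw [show β - 1 - (k + 1) + 1 = β - 1 - k by ring] at this
        have := sd (β - 1 - k) (by omega) (by omega)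
        exact ⟨τ (β - 1 - k) - β, by omega, by omega, by omega, by omega, by omega, by omega⟩) (by
        rintro k l hl ⟨g1, g2, g3, g4, g5⟩
        have := nc' (β + l) (by omega) (by omega) (by omega) (by omega)
        have e := inv (β - 1 - k) (by omega) (by omega)
        rw [g5, ← add_assoc] at e
        have e' := inv (β + l) (by omega) (by omega)
        have := sd (β + l) (by omega) (by omega)
        have := rng (β + l) (by omega) (by omega)
        refine ⟨β - 1 - τ (β + l), by omega, by omega, by omega, by omega, by omega, ?_⟩
        rw [show β - 1 - (β - 1 - τ (β + l)) = τ (β + l) by ring]; exact e') 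
      ⟨by omega, by omega, by omega, by omega, by rw [show β - 1 - (β - 1 - p) = p by ring]; omega⟩
    refine ⟨by omega, fun k hk hk' => ?_⟩
    obtain ⟨g1, g2, g3, g4, g5⟩ := e2 k hk hk'
    have e := inv (β - 1 - k) (by omega) (by omega)
    rw [g5] at e
    exact ⟨g5, e, g3, g4⟩
  have zx : ∀ p, β ≤ p → p < n → τ p < X → τ p = n - 1 - p ∧
      ∀ k, 0 ≤ k → k ≤ n - 1 - p → τ (n - 1 - k) = k ∧ τ k = n - 1 - k ∧ β ≤ n - 1 - k ∧ k < X := by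
    intro p h0 h1 h2
    have h3 := rng p (by omega) (by omega)
    obtain ⟨e1, e2⟩ := match_eq (m := fun k l => 0 ≤ k ∧ 0 ≤ l ∧ β ≤ n - 1 - k ∧ l < X ∧ τ (n - 1 - k) = l)
      (k := n - 1 - p) (l := τ p) (fun k l h => ⟨h.1, h.2.1⟩) (by
        rintro k l hk ⟨g1, g2, g3, g4, g5⟩
        have := nc' (n - 1 - (k + 1)) (by omega) (by omega) (by omega) (by omega)
        rw [show n - 1 - (k + 1) + 1 = n - 1 - k by ring] at this
        have := sd (n - 1 - k) (by omega) (by omega)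
        have := rng (n - 1 - k) (by omega) (by omega)
        exact ⟨τ (n - 1 - k), by omega, by omega, by omega, by omega, by omega, by omega⟩) (by
        rintro k l hl ⟨g1, g2, g3, g4, g5⟩
        have := nc' l (by omega) (by omega) (by omega) (by omega)
        have e := inv (n - 1 - k) (by omega) (by omega)
        rw [g5] at e
        have e' := inv l (by omega) (by omega)
        have := sd l (by omega) (by omega)
        have := rng l (by omega) (by omega)
        refine ⟨n - 1 - τ l, by omega, by omega, by omega, by omega, by omega, ?_⟩
        rw [show n - 1 - (n - 1 - τ l) = τ l by ring]; exact e') 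
      ⟨by omega, by omega, by omega, by omega, by rw [show n - 1 - (n - 1 - p) = p by ring]⟩
    refine ⟨by omega, fun k hk hk' => ?_⟩
    obtain ⟨g1, g2, g3, g4, g5⟩ := e2 k hk hk'
    have e := inv (n - 1 - k) (by omega) (by omega)
    rw [g5] at e
    exact ⟨g5, e, g3, g4⟩
  obtain ⟨a, ha, hP⟩ := exists_bound
    (P := fun k => 0 ≤ k ∧ τ (X - 1 - k) = X + k ∧ τ (X + k) = X - 1 - k ∧ k < X ∧ X + k < β) (B := X)
    (fun k h => ⟨h.1, h.2.2.2.1⟩) (by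
      rintro k k' ⟨g1, g2, g3, g4, g5⟩ h0 h1
      exact ⟨h0, (xy (X - 1 - k) (by omega) (by omega) (by omega)).2 k' h0 (by omega)⟩)
  obtain ⟨b, hb, hQ⟩ := exists_bound
    (P := fun k => 0 ≤ k ∧ τ (β - 1 - k) = β + k ∧ τ (β + k) = β - 1 - k ∧ X ≤ β - 1 - k ∧ β + k < n) (B := n)
    (fun k h => ⟨h.1, by omega⟩) (by
      rintro k k' ⟨g1, g2, g3, g4, g5⟩ h0 h1
      exact ⟨h0, (yz (β - 1 - k) (by omega) (by omega) (by omega)).2 k' h0 (by omega)⟩)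
  obtain ⟨c, hc, hR⟩ := exists_bound
    (P := fun k => 0 ≤ k ∧ τ (n - 1 - k) = k ∧ τ k = n - 1 - k ∧ β ≤ n - 1 - k ∧ k < X) (B := X)
    (fun k h => ⟨h.1, h.2.2.2.2⟩) (by
      rintro k k' ⟨g1, g2, g3, g4, g5⟩ h0 h1
      exact ⟨h0, (zx (n - 1 - k) (by omega) (by omega) (by omega)).2 k' h0 (by omega)⟩)
  -- each point lies on exactly one arc
  have px : ∀ p, 0 ≤ p → p < X → (X - 1 - p < a ∧ τ p = 2 * X - 1 - p ∧ ¬ p < c) ∨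
      (p < c ∧ τ p = n - 1 - p ∧ ¬ X - 1 - p < a) := by
    intro p h0 h1
    have n1 := hP (X - 1 - p)
    have n2 := hR p
    rw [show X - 1 - (X - 1 - p) = p by ring] at n1
    by_cases h2 : τ p < β
    · have h3 := xy p h0 h1 h2
      have h4 := h3.2 (X - 1 - p) (by omega) le_rfl
      rw [show X - 1 - (X - 1 - p) = p by ring] at h4
      have h5 := n1.1 ⟨by omega, h4⟩
      exact Or.inl ⟨h5.2, h3.1, fun h => by have := n2.2 ⟨h0, h⟩; omega⟩
    · have h6 := inv p h0 (by omega)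
      have h7 := rng p h0 (by omega)
      have h3 := zx (τ p) (by omega) (by omega) (by omega)
      have h4 := h3.2 p h0 (by omega)
      have h5 := n2.1 ⟨h0, h4⟩
      exact Or.inr ⟨h5.2, by omega, fun h => by have := n1.2 ⟨by omega, h⟩; omega⟩
  have py : ∀ p, X ≤ p → p < β → (p - X < a ∧ τ p = 2 * X - 1 - p ∧ ¬ β - 1 - p < b) ∨
      (β - 1 - p < b ∧ τ p = 2 * β - 1 - p ∧ ¬ p - X < a) := by
    intro p h0 h1
    have n1 := hP (p - X)
    have n2 := hQ (β - 1 - p)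
    rw [show X + (p - X) = p by ring] at n1
    rw [show β - 1 - (β - 1 - p) = p by ring] at n2
    by_cases h2 : τ p < X
    · have h6 := inv p (by omega) (by omega)
      have h7 := rng p (by omega) (by omega)
      have h3 := xy (τ p) (by omega) h2 (by omega)
      have h4 := h3.2 (p - X) (by omega) (by omega)
      rw [show X + (p - X) = p by ring] at h4
      have h5 := n1.1 ⟨by omega, h4⟩
      exact Or.inl ⟨h5.2, by omega, fun h => by have := n2.2 ⟨by omega, h⟩; omega⟩
    · have h8 := (sd p (by omega) (by omega)).2.1 h0 h1
      have h3 := yz p h0 h1 (by omega)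
      have h4 := h3.2 (β - 1 - p) (by omega) le_rfl
      rw [show β - 1 - (β - 1 - p) = p by ring] at h4
      have h5 := n2.1 ⟨by omega, h4⟩
      exact Or.inr ⟨h5.2, by omega, fun h => by have := n1.2 ⟨by omega, h⟩; omega⟩
  have pz : ∀ p, β ≤ p → p < n → (p - β < b ∧ τ p = 2 * β - 1 - p ∧ ¬ n - 1 - p < c) ∨
      (n - 1 - p < c ∧ τ p = n - 1 - p ∧ ¬ p - β < b) := by
    intro p h0 h1
    have n1 := hQ (p - β)
    have n2 := hR (n - 1 - p)
    rw [show β + (p - β) = p by ring] at n1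
    rw [show n - 1 - (n - 1 - p) = p by ring] at n2
    by_cases h2 : τ p < X
    · have h3 := zx p h0 h1 h2
      have h4 := h3.2 (n - 1 - p) (by omega) (by omega)
      rw [show n - 1 - (n - 1 - p) = p by ring] at h4
      have h5 := n2.1 ⟨by omega, h4⟩
      exact Or.inr ⟨h5.2, by omega, fun h => by have := n1.2 ⟨by omega, h⟩; omega⟩
    · have h8 := (sd p (by omega) (by omega)).2.2 h0
      have h6 := inv p (by omega) (by omega)
      have h3 := yz (τ p) (by omega) h8 (by omega)
      have h4 := h3.2 (p - β) (by omega) (by omega)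
      rw [show β + (p - β) = p by ring] at h4
      have h5 := n1.1 ⟨by omega, h4⟩
      exact Or.inl ⟨h5.2, by omega, fun h => by have := n2.2 ⟨by omega, h⟩; omega⟩
  have ba := hP (a - 1)
  have bb := hQ (b - 1)
  have bc := hR (c - 1)
  have ex : X = a + c := by
    rcases lt_trichotomy X (a + c) with h | h | h
    · have := px (c - 1); omega
    · exact h
    · have := px c; omega
  have ey : β - X = a + b := by
    rcases lt_trichotomy (β - X) (a + b) with h | h | h
    · have := py (X + a - 1); omega
    · exact h
    · have := py (X + a); omega
  have ez : n - β = b + c := by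
    rcases lt_trichotomy (n - β) (b + c) with h | h | h
    · have := pz (β + b - 1); omega
    · exact h
    · have := pz (β + b); omega
  refine ⟨a, b, c, ha, hb, hc, ex, by omega, by omega, fun p h0 h1 => ?_⟩
  have := px p h0
  have := py p
  have := pz p
  unfold tau0
  split_ifs <;> omega

end Arcs

variable {W : ℤ → Letter} {n X β : ℤ} {r : ℤ → ℤ}

/-- The strand joined to the strand `i` by the vertices congruent to `ε` modulo 2. -/
def par (ε i : ℤ) : ℤ := if i % 2 = ε then i - 1 else i + 1

lemma Lab.std (hC : Cur W n) (h : Lab W n X β r) {ε : ℤ} (hε : ε = 0 ∨ ε = 1) (hA : ¬ Adj X β ε r) :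
    ∃ a b c, 0 ≤ a ∧ 0 ≤ b ∧ 0 ≤ c ∧ X = a + c ∧ β = 2 * a + b + c ∧ n = 2 * (a + b + c) ∧
      ∀ i, r (par ε i) = tau0 a b c (r i) := by
  have hs : ∀ p, ∃ i, 0 ≤ p → p < n → r i = p := by
    intro p
    by_cases hp : 0 ≤ p ∧ p < n
    · obtain ⟨i, hi⟩ := h.surj hC hp.1 hp.2
      exact ⟨i, fun _ _ => hi⟩
    · exact ⟨0, fun h1 h2 => absurd ⟨h1, h2⟩ hp⟩
  choose s hs using hs
  have hper : ∀ i j, r i = r j → r (par ε i) = r (par ε j) := by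
    intro i j hij
    obtain ⟨m, hm⟩ := h.inj i j hij
    obtain ⟨l, hl⟩ := Int.dvd_of_emod_eq_zero hC.even
    have e : par ε i = par ε j + n * m := by
      unfold par
      rw [hl, mul_assoc] at hm ⊢
      split_ifs <;> omega
    rw [e, per_mul h.per]
  set τ : ℤ → ℤ := fun p => r (par ε (s p)) with hτ
  have hτr : ∀ i, τ (r i) = r (par ε i) := by
    intro i
    exact hper _ _ (hs _ (h.nonneg i) (h.lt i))
  have hpp : ∀ i, par ε (par ε i) = i := by
    intro i; unfold par; split_ifs <;> omega
  have hWp : ∀ i, W (par ε i) ≠ W i := by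
    intro i
    unfold par
    split_ifs
    · exact hC.red' i
    · exact (hC.red i).symm
  have hside : ∀ i, (r i < X → X ≤ r (par ε i)) ∧
      (X ≤ r i → r i < β → r (par ε i) < X ∨ β ≤ r (par ε i)) ∧ (β ≤ r i → r (par ε i) < β) := by
    intro i
    have h1 := h.sx i
    have h2 := h.sx (par ε i)
    have h3 := h.sz i
    have h4 := h.sz (par ε i)
    have h5 := hWp i
    cases ha : W i <;> cases hb : W (par ε i) <;> simp [ha, hb] at h1 h2 h3 h4 h5 <;> omega
  have hv : ∀ i, ∃ v, v % 2 = ε ∧ ((v = i ∧ par ε i = v - 1) ∨ (v - 1 = i ∧ par ε i = v)) := by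
    intro i
    unfold par
    split_ifs with hi
    · exact ⟨i, hi, Or.inl ⟨rfl, rfl⟩⟩
    · exact ⟨i + 1, by omega, Or.inr ⟨by ring, rfl⟩⟩
  have key := eq_tau0 (X := X) (β := β) (n := n) (τ := τ) h.left_nonneg h.left_le h.le_right (by
      intro p h0 h1
      exact ⟨h.nonneg _, h.lt _⟩) (by
      intro p h0 h1
      have := hτr (par ε (s p))
      rw [hpp] at this
      exact this.trans (hs p h0 h1)) (by
      intro p h0 h1
      have := hside (s p)
      rw [← hτr, hs p h0 h1] at this
      exact this) (by
      intro p h0 h1 h2 h3 hcr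
      apply hA
      obtain ⟨v, hv1, hv2⟩ := hv (s p)
      obtain ⟨w, hw1, hw2⟩ := hv (s (p + 1))
      have e1 := hs p h0 (by omega)
      have e2 := hs (p + 1) (by omega) h1
      have e3 := hτr (s p)
      have e4 := hτr (s (p + 1))
      rw [e1] at e3
      rw [e2] at e4
      refine ⟨v, w, p, hv1, hw1, ?_, ?_, ?_, h2, h3⟩
      · unfold VCr
        rw [e3, e4] at hcr
        rcases hv2 with ⟨rfl, hv3⟩ | ⟨hv3, hv4⟩ <;> rcases hw2 with ⟨rfl, hw3⟩ | ⟨hw3, hw4⟩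
        · rw [← hv3, ← hw3, e1, e2, cr_swap_left, cr_swap_right]; exact hcr
        · rw [← hv3, hw3, ← hw4, e1, e2, cr_swap_left]; exact hcr
        · rw [← hw3, hv3, ← hv4, e1, e2, cr_swap_right]; exact hcr
        · rw [hv3, ← hv4, hw3, ← hw4, e1, e2]; exact hcr
      · rcases hv2 with ⟨rfl, -⟩ | ⟨hv3, -⟩
        · exact Or.inr e1
        · exact Or.inl (by rw [hv3, e1])
      · rcases hw2 with ⟨rfl, -⟩ | ⟨hv3, -⟩
        · exact Or.inr e2
        · exact Or.inl (by rw [hv3, e2]))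
  obtain ⟨a, b, c, h1, h2, h3, h4, h5, h6, h7⟩ := key
  exact ⟨a, b, c, h1, h2, h3, h4, h5, h6, fun i => by rw [← hτr, h7 _ (h.nonneg i) (h.lt i)]⟩

end

section

/-- Two crossing-free labellings of the two families of chords, related by transpositions. -/
structure Std (W : ℤ → Letter) (n a b c : ℤ) (u l : ℤ → ℤ) (T : List ℤ) : Prop where
  ha : 0 ≤ a
  hb : 0 ≤ b
  hc : 0 ≤ c
  hn : n = 2 * (a + b + c)
  lu : Lab W n (a + c) (2 * a + b + c) u
  ll : Lab W n (a + c) (2 * a + b + c) l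
  tu : ∀ i, u (par 0 i) = tau0 a b c (u i)
  tl : ∀ i, l (par 1 i) = tau0 a b c (l i)
  val : ∀ p ∈ T, Val n (a + c) (2 * a + b + c) p
  eq : ∀ i, l i = app T (u i)

lemma exists_std {W : ℤ → Letter} {n : ℤ} (hC : Cur W n) : ∃ a b c u l T, Std W n a b c u l T ∧
    2 * T.length ≤ (crPairs (can W) n 0).card := by
  have hD := can_diag hC
  have hL := lab_rk hC hD
  obtain ⟨S, hS1, hS2, hS3, hS4⟩ := uncross hC 0 _ _ hL le_rfl
  obtain ⟨S', hS1', hS2', hS3', hS4'⟩ := uncross hC 1 _ _ hL le_rfl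
  obtain ⟨a, b, c, h1, h2, h3, h4, h5, h6, h7⟩ := hS2.std hC (Or.inl rfl) hS3
  obtain ⟨a', b', c', h1', h2', h3', h4', h5', h6', h7'⟩ := hS2'.std hC (Or.inr rfl) hS3'
  obtain rfl : a' = a := by omega
  obtain rfl : b' = b := by omega
  obtain rfl : c' = c := by omega
  rw [h4, h5] at hS1 hS2 hS1' hS2'
  refine ⟨a', b', c', _, _, S.reverse ++ S', ⟨h1, h2, h3, h6, hS2, hS2', h7, h7', ?_, ?_⟩, ?_⟩
  · intro p hp
    rcases List.mem_append.1 hp with hp | hp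
    · exact hS1 p (List.mem_reverse.1 hp)
    · exact hS1' p hp
  · intro i
    rw [app_append, app_reverse]
  · have e : crPairs (can W) n 0 = crPairs (rk (can W) n) n 0 := by
      ext q
      rw [mem_crPairs, mem_crPairs, vcr_rk hC.pos hD.per]
    have hdis : Disjoint (crV 0 (rk (can W) n) n) (crV 1 (rk (can W) n) n) := by
      rw [Finset.disjoint_left]
      intro q h h'
      rw [mem_crV] at h h'
      omega
    have hsub : crV 0 (rk (can W) n) n ∪ crV 1 (rk (can W) n) n ⊆ crPairs (rk (can W) n) n 0 :=
      Finset.union_subset (Finset.filter_subset _ _) (Finset.filter_subset _ _)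
    have := Finset.card_le_card hsub
    rw [Finset.card_union_of_disjoint hdis] at this
    rw [e, List.length_append, List.length_reverse]
    omega

/-- A connected graph has at most one more vertex than edges. -/
lemma card_le_of_connected {α : Type*} [DecidableEq α] (V : Finset α) (E : Finset (α × α)) (v : α)
    (h : ∀ C : Finset α, v ∈ C → (∀ e ∈ E, e.1 ∈ C ↔ e.2 ∈ C) → V ⊆ C) : V.card ≤ E.card + 1 := by
  set U : Finset α := insert v (E.image Prod.fst ∪ E.image Prod.snd) with hU
  set S : Finset (Finset α) := U.powerset.filter (fun C => v ∈ C ∧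
    ∃ F ⊆ E, (∀ e ∈ F, e.1 ∈ C ∧ e.2 ∈ C) ∧ C.card ≤ F.card + 1) with hS
  have hne : S.Nonempty := by
    refine ⟨{v}, ?_⟩
    rw [hS, Finset.mem_filter, Finset.mem_powerset]
    refine ⟨by rw [Finset.singleton_subset_iff]; exact Finset.mem_insert_self _ _, by simp, ∅, by simp, by simp, by simp⟩
  obtain ⟨C, hCS, hmax⟩ := Finset.exists_max_image S Finset.card hne
  rw [hS, Finset.mem_filter, Finset.mem_powerset] at hCS
  obtain ⟨hCU, hv, F, hF, hFC, hcard⟩ := hCS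
  have grow : ∀ e ∈ E, ∀ x ∈ U, x ∉ C → (e.1 = x ∧ e.2 ∈ C) ∨ (e.2 = x ∧ e.1 ∈ C) → False := by
    intro e he x hx hxC hex
    have heF : e ∉ F := by
      intro h'
      have := hFC e h'
      rcases hex with ⟨rfl, -⟩ | ⟨rfl, -⟩
      · exact hxC this.1
      · exact hxC this.2
    have hmem : insert x C ∈ S := by
      rw [hS, Finset.mem_filter, Finset.mem_powerset]
      refine ⟨Finset.insert_subset hx hCU, Finset.mem_insert_of_mem hv, insert e F,
        Finset.insert_subset he hF, ?_, ?_⟩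
      · intro f hf
        rcases Finset.mem_insert.1 hf with rfl | hf
        · rcases hex with ⟨rfl, h2⟩ | ⟨rfl, h2⟩
          · exact ⟨Finset.mem_insert_self _ _, Finset.mem_insert_of_mem h2⟩
          · exact ⟨Finset.mem_insert_of_mem h2, Finset.mem_insert_self _ _⟩
        · exact ⟨Finset.mem_insert_of_mem (hFC f hf).1, Finset.mem_insert_of_mem (hFC f hf).2⟩
      · rw [Finset.card_insert_of_notMem hxC, Finset.card_insert_of_notMem heF]
        omega
    have := hmax _ hmem
    rw [Finset.card_insert_of_notMem hxC] at this
    omega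
  have hVC := h C hv (by
    intro e he
    constructor
    · intro h1
      by_contra h2
      refine grow e he e.2 ?_ h2 (Or.inr ⟨rfl, h1⟩)
      exact Finset.mem_insert_of_mem (Finset.mem_union_right _ (Finset.mem_image_of_mem _ he))
    · intro h1
      by_contra h2
      refine grow e he e.1 ?_ h2 (Or.inl ⟨rfl, h1⟩)
      exact Finset.mem_insert_of_mem (Finset.mem_union_left _ (Finset.mem_image_of_mem _ he)))
  have := Finset.card_le_card hVC
  have := Finset.card_le_card hF
  omega

lemma mem_app_iff {C : Finset ℤ} : ∀ {T : List ℤ}, (∀ p ∈ T, p ∈ C ↔ p + 1 ∈ C) → ∀ q, app T q ∈ C ↔ q ∈ C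
  | [], _, q => Iff.rfl
  | p :: T, h, q => by
    rw [show app (p :: T) q = app T (swp p q) from rfl,
      mem_app_iff (fun r hr => h r (List.mem_cons_of_mem _ hr))]
    have := h p List.mem_cons_self
    unfold swp
    split_ifs with h1 h2
    · rw [h1, this]
    · rw [h2, this]
    · rfl

variable {W : ℤ → Letter} {n a b c : ℤ} {u l : ℤ → ℤ} {T : List ℤ}

lemma Std.le_card (hC : Cur W n) (h : Std W n a b c u l T) (D : Finset ℤ)
    (hD : ∀ C : Finset ℤ, (∀ p, 0 ≤ p → p < n → (p ∈ C ↔ tau0 a b c p ∈ C)) →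
      (∀ p ∈ D, p ∈ C ↔ p + 1 ∈ C) → ∀ p ∈ T, p ∈ C ↔ p + 1 ∈ C) : n ≤ 2 * (D.card + 1) := by
  have hn := h.hn
  have key := card_le_of_connected (Finset.Ico 0 n)
    ((Finset.Ico 0 (a + b + c)).image (fun k => (u (2 * k - 1), u (2 * k))) ∪ D.image (fun p => (p, p + 1)))
    (u 0) (by
      intro C h0 hE
      have e1 : ∀ i, u i ∈ C ↔ u (par 0 i) ∈ C := by
        have base : ∀ k, 0 ≤ k → k < a + b + c → (u (2 * k - 1) ∈ C ↔ u (2 * k) ∈ C) := fun k h1 h2 =>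
          hE (u (2 * k - 1), u (2 * k)) (Finset.mem_union_left _ (Finset.mem_image.2 ⟨k, Finset.mem_Ico.2 ⟨h1, h2⟩, rfl⟩))
        have all : ∀ k, u (2 * k - 1) ∈ C ↔ u (2 * k) ∈ C := by
          intro k
          obtain ⟨m, h1, h2⟩ := window_rep hC.pos 0 (2 * k)
          have h3 : n * m = 2 * ((a + b + c) * m) := by rw [hn]; ring
          have := base (k + (a + b + c) * m) (by omega) (by omega)
          rw [show 2 * (k + (a + b + c) * m) - 1 = 2 * k - 1 + n * m by rw [h3]; ring,
            show 2 * (k + (a + b + c) * m) = 2 * k + n * m by rw [h3]; ring,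
            per_mul h.lu.per, per_mul h.lu.per] at this
          exact this
        intro i
        unfold par
        split_ifs with hi
        · have := all (i / 2)
          rw [show 2 * (i / 2) = i by omega] at this
          exact this.symm
        · have := all ((i + 1) / 2)
          rw [show 2 * ((i + 1) / 2) = i + 1 by omega, show i + 1 - 1 = i by ring] at this
          exact this
      have e2 : ∀ p, 0 ≤ p → p < n → (p ∈ C ↔ tau0 a b c p ∈ C) := by
        intro p h1 h2
        obtain ⟨i, rfl⟩ := h.lu.surj hC h1 h2
        rw [← h.tu]; exact e1 i
      have e3 := hD C e2 (fun p hp => hE (p, p + 1)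
        (Finset.mem_union_right _ (Finset.mem_image.2 ⟨p, hp, rfl⟩)))
      have e4 : ∀ i, l i ∈ C ↔ u i ∈ C := fun i => by rw [h.eq]; exact mem_app_iff e3 _
      have e5 : ∀ i, u i ∈ C ↔ u (par 1 i) ∈ C := by
        intro i
        rw [← e4, ← e4, h.tl]
        exact e2 _ (h.ll.nonneg i) (h.ll.lt i)
      have e6 : ∀ i, u i ∈ C ↔ u (i + 1) ∈ C := by
        intro i
        have g1 := e1 i
        have g2 := e5 i
        unfold par at g1 g2
        rcases Int.emod_two_eq i with hi | hi
        · simpa [hi] using g2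
        · simpa [hi] using g1
      have e7 : ∀ i, u i ∈ C := by
        intro i
        induction i using Int.induction_on with
        | zero => exact h0
        | succ i ih => exact (e6 _).1 ih
        | pred i ih => rw [e6]; simpa using ih
      intro p hp
      rw [Finset.mem_Ico] at hp
      obtain ⟨i, rfl⟩ := h.lu.surj hC hp.1 hp.2
      exact e7 i)
  have c1 := Finset.card_union_le ((Finset.Ico 0 (a + b + c)).image (fun k => (u (2 * k - 1), u (2 * k))))
    (D.image (fun p => (p, p + 1)))
  have c2 := Finset.card_image_le (s := Finset.Ico 0 (a + b + c)) (f := fun k => (u (2 * k - 1), u (2 * k)))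
  have c3 := Finset.card_image_le (s := D) (f := fun p => (p, p + 1))
  rw [Int.card_Ico] at key c2
  have := hC.pos
  omega

lemma Std.length_ge (hC : Cur W n) (h : Std W n a b c u l T) : n ≤ 2 * (T.length + 1) := by
  have h1 := h.le_card hC T.toFinset (fun C _ h1 p hp => h1 p (List.mem_toFinset.2 hp))
  have h2 := T.toFinset_card_le
  omega

lemma Std.nodup (hC : Cur W n) (h : Std W n a b c u l T) (hT : 2 * (T.length + 1) ≤ n) : T.Nodup := by
  have h1 := h.le_card hC T.toFinset (fun C _ h1 p hp => h1 p (List.mem_toFinset.2 hp))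
  have h2 := T.toFinset_card_le
  have h3 : T.toFinset.card = T.length := by omega
  exact Multiset.coe_nodup.1 (Multiset.toFinset_card_eq_card_iff_nodup.1 h3)

lemma Std.erase (hC : Cur W n) (h : Std W n a b c u l T) (hT : 2 * (T.length + 1) ≤ n) {q : ℤ} (hq : q ∈ T)
    (hD : ∀ C : Finset ℤ, (∀ p, 0 ≤ p → p < n → (p ∈ C ↔ tau0 a b c p ∈ C)) →
      (∀ p ∈ T, p ≠ q → (p ∈ C ↔ p + 1 ∈ C)) → (q ∈ C ↔ q + 1 ∈ C)) : False := by
  have h1 := h.le_card hC (T.toFinset.erase q) (by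
    intro C h1 h2 p hp
    have h3 : ∀ p ∈ T, p ≠ q → (p ∈ C ↔ p + 1 ∈ C) := fun p hp hne =>
      h2 p (Finset.mem_erase.2 ⟨hne, List.mem_toFinset.2 hp⟩)
    by_cases hpq : p = q
    · rw [hpq]; exact hD C h1 h3
    · exact h3 p hp hpq)
  have h2 := T.toFinset_card_le
  have h3 := Finset.card_erase_lt_of_mem (List.mem_toFinset.2 hq)
  omega

lemma Std.no_mirror (hC : Cur W n) (h : Std W n a b c u l T) (hT : 2 * (T.length + 1) ≤ n) {p q : ℤ}
    (hp : p ∈ T) (hq : q ∈ T) (hpq : p ≠ q) (h1 : tau0 a b c p = q + 1) (h2 : tau0 a b c (p + 1) = q) : False := by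
  have hv := h.val p hp
  unfold Val at hv
  refine h.erase hC hT hq (fun C g1 g2 => ?_)
  have e1 := g1 p (by omega) (by omega)
  have e2 := g1 (p + 1) (by omega) (by omega)
  rw [h1] at e1
  rw [h2] at e2
  rw [← e1, ← e2]
  exact (g2 p hp hpq).symm

/-- The last label on the side of a letter that is joined to the preceding side. -/
def jn (a b c : ℤ) : Letter → ℤ
  | .x => c - 1
  | .y => 2 * a + c - 1
  | .z => 2 * a + 2 * b + c - 1

lemma Std.no_triple (hC : Cur W n) (h : Std W n a b c u l T) (hT : 2 * (T.length + 1) ≤ n)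
    (hj : ∀ p, jn a b c p ∈ T) : False := by
  have hx := h.val _ (hj .x)
  have hy := h.val _ (hj .y)
  have hz := h.val _ (hj .z)
  have hn := h.hn
  unfold Val at hx hy hz
  have := h.ha
  have := h.hb
  have := h.hc
  refine h.erase hC hT (hj .x) (fun C g1 g2 => ?_)
  have e1 := g1 (jn a b c .x) (by omega) (by omega)
  have e2 := g1 (jn a b c .y) (by omega) (by omega)
  have e3 := g1 (jn a b c .z) (by omega) (by omega)
  have e4 := g2 _ (hj .y) (by simp only [jn] at *; omega)
  have e5 := g2 _ (hj .z) (by simp only [jn] at *; omega)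
  rw [show tau0 a b c (jn a b c .x) = jn a b c .z + 1 by simp only [jn] at *; unfold tau0; split_ifs <;> omega] at e1
  rw [show tau0 a b c (jn a b c .y) = jn a b c .x + 1 by simp only [jn] at *; unfold tau0; split_ifs <;> omega] at e2
  rw [show tau0 a b c (jn a b c .z) = jn a b c .y + 1 by simp only [jn] at *; unfold tau0; split_ifs <;> omega] at e3
  rw [e1, ← e5, e3, ← e4, e2]

end

section

lemma app_le_iff {J : ℤ} : ∀ {T : List ℤ}, J ∉ T → ∀ q, app T q ≤ J ↔ q ≤ J
  | [], _, q => Iff.rfl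
  | p :: T, h, q => by
    rw [List.mem_cons, not_or] at h
    rw [show app (p :: T) q = app T (swp p q) from rfl, app_le_iff h.2]
    unfold swp
    split_ifs <;> omega

lemma app_fix {q : ℤ} : ∀ {T : List ℤ}, q ∉ T → q - 1 ∉ T → app T q = q
  | [], _, _ => rfl
  | p :: T, h, h' => by
    rw [List.mem_cons, not_or] at h h'
    rw [show app (p :: T) q = app T (swp p q) from rfl, show swp p q = q by unfold swp; split_ifs <;> omega,
      app_fix h.2 h'.2]

lemma app_injective (T : List ℤ) : Function.Injective (app T) :=
  Function.LeftInverse.injective (app_reverse T)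

variable {W : ℤ → Letter} {n a b c : ℤ} {u l : ℤ → ℤ} {T : List ℤ}

/-- The strand `i` changes its side: the neighbouring letters are different. -/
def Chg (W : ℤ → Letter) (i : ℤ) : Prop := W (i - 1) ≠ W (i + 1)

lemma side_par {r : ℤ → ℤ} (ha : 0 ≤ a) (hb : 0 ≤ b)
    (h : Lab W n (a + c) (2 * a + b + c) r) {ε : ℤ}
    (ht : ∀ i, r (par ε i) = tau0 a b c (r i)) (i : ℤ) :
    (r i ≤ jn a b c (W i) → W (par ε i) = prv (W i)) ∧ (jn a b c (W i) < r i → W (par ε i) = nxt (W i)) := by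
  have h0 := h.nonneg i
  have h1 := h.lt i
  have h2 := h.sx i
  have h3 := h.sz i
  have h4 := h.sx (par ε i)
  have h5 := h.sz (par ε i)
  rw [ht i] at h4 h5
  unfold tau0 at h4 h5
  cases hW : W i <;> cases hP : W (par ε i) <;> simp only [hW, hP, jn, prv, nxt, reduceCtorEq, false_iff,
      true_iff] at * <;>
    split_ifs at h4 h5 <;> constructor <;> intro h <;> first | trivial | (exfalso; omega)

lemma nxt_ne_prv (p : Letter) : nxt p ≠ prv p := by cases p <;> simp [nxt, prv]

lemma Std.chg_iff (h : Std W n a b c u l T) (i : ℤ) :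
    Chg W i ↔ ¬ (u i ≤ jn a b c (W i) ↔ l i ≤ jn a b c (W i)) := by
  have h1 := side_par h.ha h.hb h.lu h.tu i
  have h2 := side_par h.ha h.hb h.ll h.tl i
  have h3 : Chg W i ↔ W (par 0 i) ≠ W (par 1 i) := by
    unfold Chg par
    rcases Int.emod_two_eq i with hi | hi <;> simp [hi, ne_comm]
  have h4 := nxt_ne_prv (W i)
  rw [h3]
  by_cases g1 : u i ≤ jn a b c (W i) <;> by_cases g2 : l i ≤ jn a b c (W i)
  · simp [g1, g2, h1.1 g1, h2.1 g2]
  · simp [g1, g2, h1.1 g1, h2.2 (not_le.1 g2), h4.symm]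
  · simp [g1, g2, h1.2 (not_le.1 g1), h2.1 g2, h4]
  · simp [g1, g2, h1.2 (not_le.1 g1), h2.2 (not_le.1 g2)]

lemma Std.jn_mem (h : Std W n a b c u l T) {i : ℤ} (hi : Chg W i) : jn a b c (W i) ∈ T := by
  by_contra hcon
  rw [h.chg_iff, h.eq, app_le_iff hcon] at hi
  exact hi Iff.rfl

lemma Std.chg_iff' (h : Std W n a b c u l T) (hT : T.Nodup) {T₁ T₂ : List ℤ} {i : ℤ}
    (hS : T = T₁ ++ jn a b c (W i) :: T₂) :
    Chg W i ↔ app T₁ (u i) = jn a b c (W i) ∨ app T₁ (u i) = jn a b c (W i) + 1 := by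
  rw [hS, List.nodup_middle, List.nodup_cons, List.mem_append, not_or] at hT
  rw [h.chg_iff, h.eq, ← app_le_iff hT.1.1 (u i), hS, app_append,
    show app (jn a b c (W i) :: T₂) (app T₁ (u i)) = app T₂ (swp (jn a b c (W i)) (app T₁ (u i))) from rfl,
    app_le_iff hT.1.2]
  unfold swp
  split_ifs <;> omega

/-- Each letter changes at no more than two strands. -/
lemma Std.chg_two (h : Std W n a b c u l T) (hT : T.Nodup) {i j k : ℤ} (hi : Chg W i) (hj : Chg W j)
    (hk : Chg W k) (hij : W i = W j) (hik : W i = W k) : n ∣ i - j ∨ n ∣ i - k ∨ n ∣ j - k := by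
  obtain ⟨T₁, T₂, hS⟩ := List.append_of_mem (h.jn_mem hi)
  have e1 := (h.chg_iff' hT hS).1 hi
  have e2 := (h.chg_iff' hT (i := j) (by rw [← hij]; exact hS)).1 hj
  have e3 := (h.chg_iff' hT (i := k) (by rw [← hik]; exact hS)).1 hk
  rw [← hij] at e2
  rw [← hik] at e3
  have inj : ∀ i j, app T₁ (u i) = app T₁ (u j) → n ∣ i - j := fun i j he =>
    h.lu.inj i j (app_injective _ he)
  rcases e1 with e1 | e1 <;> rcases e2 with e2 | e2 <;> rcases e3 with e3 | e3
  all_goals first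
    | exact Or.inl (inj _ _ (e1.trans e2.symm))
    | exact Or.inr (Or.inl (inj _ _ (e1.trans e3.symm)))
    | exact Or.inr (Or.inr (inj _ _ (e2.trans e3.symm)))

lemma Std.no_chg (hC : Cur W n) (h : Std W n a b c u l T) (hT : 2 * (T.length + 1) ≤ n) :
    ∃ p, ∀ i, W i = p → ¬ Chg W i := by
  by_contra hcon
  push Not at hcon
  refine h.no_triple hC hT (fun p => ?_)
  obtain ⟨i, rfl, hi⟩ := hcon p
  exact h.jn_mem hi

lemma Std.chg_of_u (h : Std W n a b c u l T) (hT : T.Nodup) {T₁ T₂ : List ℤ} {i : ℤ}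
    (hS : T = T₁ ++ jn a b c (W i) :: T₂) (hu : (u i = jn a b c (W i) + 1 ∧ u i ∉ T₁) ∨
      (u i = jn a b c (W i) ∧ u i - 1 ∉ T₁)) : Chg W i := by
  rw [h.chg_iff' hT hS]
  rw [hS, List.nodup_middle, List.nodup_cons, List.mem_append, not_or] at hT
  rcases hu with ⟨h1, h2⟩ | ⟨h1, h2⟩
  · right
    rw [app_fix h2 (by rw [h1, add_sub_cancel_right]; exact hT.1.1), h1]
  · left
    rw [app_fix (by rw [h1]; exact hT.1.1) h2, h1]

lemma Std.chg_of_l (h : Std W n a b c u l T) (hT : T.Nodup) {T₁ T₂ : List ℤ} {i : ℤ}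
    (hS : T = T₁ ++ jn a b c (W i) :: T₂) (hu : (l i = jn a b c (W i) + 1 ∧ l i ∉ T₂) ∨
      (l i = jn a b c (W i) ∧ l i - 1 ∉ T₂)) : Chg W i := by
  rw [h.chg_iff' hT hS]
  have he := h.eq i
  rw [hS, app_append, show app (jn a b c (W i) :: T₂) (app T₁ (u i)) = app T₂ (swp (jn a b c (W i)) (app T₁ (u i))) from rfl] at he
  rw [hS, List.nodup_middle, List.nodup_cons, List.mem_append, not_or] at hT
  have key : swp (jn a b c (W i)) (app T₁ (u i)) = l i := by
    apply app_injective T₂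
    rw [← he]
    symm
    rcases hu with ⟨h1, h2⟩ | ⟨h1, h2⟩
    · exact app_fix h2 (by rw [h1, add_sub_cancel_right]; exact hT.1.2)
    · exact app_fix (by rw [h1]; exact hT.1.2) h2
  unfold swp at key
  split_ifs at key <;> omega

lemma par_cases (ε i : ℤ) : par ε i = i - 1 ∨ par ε i = i + 1 := by
  unfold par; split_ifs <;> simp

lemma Std.chg_pair_nxt (hC : Cur W n) (h : Std W n a b c u l T) (hT : 2 * (T.length + 1) ≤ n) {p : Letter}
    (hp : jn a b c p ∈ T) (hq : jn a b c (nxt p) ∈ T) :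
    ∃ i j, (j = i - 1 ∨ j = i + 1) ∧ Chg W i ∧ Chg W j ∧ W i = p ∧ W j = nxt p := by
  have hnd := h.nodup hC hT
  have vp := h.val _ hp
  have vq := h.val _ hq
  have := h.ha
  have := h.hb
  have := h.hc
  have hn := h.hn
  unfold Val at vp vq
  have t1 : tau0 a b c (jn a b c p + 1) = jn a b c (nxt p) := by
    cases p <;> simp only [jn, nxt] at * <;> unfold tau0 <;> split_ifs <;> omega
  have side : ∀ r, Lab W n (a + c) (2 * a + b + c) r → ∀ i,
      (r i = jn a b c p + 1 → W i = p) ∧ (r i = jn a b c (nxt p) → W i = nxt p) := by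
    intro r hr i
    have h1 := hr.sx i
    have h2 := hr.sz i
    cases p <;> cases hW : W i <;> simp only [jn, nxt, hW, reduceCtorEq, false_iff, true_iff] at * <;>
      constructor <;> intro h <;> first | trivial | (exfalso; omega)
  obtain ⟨P₁, P₂, hP⟩ := List.append_of_mem hp
  obtain ⟨Q₁, Q₂, hQ⟩ := List.append_of_mem hq
  have hnP := hnd
  have hnQ := hnd
  rw [hP, List.nodup_middle, List.nodup_cons, List.nodup_append] at hnP
  rw [hQ, List.nodup_middle, List.nodup_cons, List.nodup_append] at hnQ
  have hu : jn a b c p + 1 ∉ P₁ → jn a b c (nxt p) - 1 ∉ Q₁ →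
      ∃ i j, (j = i - 1 ∨ j = i + 1) ∧ Chg W i ∧ Chg W j ∧ W i = p ∧ W j = nxt p := by
    intro g1 g2
    obtain ⟨i, hi⟩ := h.lu.surj hC (p := jn a b c p + 1) (by omega) (by omega)
    have hj : u (par 0 i) = jn a b c (nxt p) := by rw [h.tu, hi, t1]
    have w1 := (side u h.lu i).1 hi
    have w2 := (side u h.lu _).2 hj
    refine ⟨i, par 0 i, par_cases _ _, h.chg_of_u hnd (by rw [w1]; exact hP) (Or.inl ?_),
      h.chg_of_u hnd (by rw [w2]; exact hQ) (Or.inr ?_), w1, w2⟩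
    · rw [w1, hi]; exact ⟨rfl, g1⟩
    · rw [w2, hj]; exact ⟨rfl, g2⟩
  have hl : jn a b c p + 1 ∉ P₂ → jn a b c (nxt p) - 1 ∉ Q₂ →
      ∃ i j, (j = i - 1 ∨ j = i + 1) ∧ Chg W i ∧ Chg W j ∧ W i = p ∧ W j = nxt p := by
    intro g1 g2
    obtain ⟨i, hi⟩ := h.ll.surj hC (p := jn a b c p + 1) (by omega) (by omega)
    have hj : l (par 1 i) = jn a b c (nxt p) := by rw [h.tl, hi, t1]
    have w1 := (side l h.ll i).1 hi
    have w2 := (side l h.ll _).2 hj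
    refine ⟨i, par 1 i, par_cases _ _, h.chg_of_l hnd (by rw [w1]; exact hP) (Or.inl ?_),
      h.chg_of_l hnd (by rw [w2]; exact hQ) (Or.inr ?_), w1, w2⟩
    · rw [w1, hi]; exact ⟨rfl, g1⟩
    · rw [w2, hj]; exact ⟨rfl, g2⟩
  have hmir : ¬ (jn a b c p + 1 ∈ T ∧ jn a b c (nxt p) - 1 ∈ T) := by
    rintro ⟨g1, g2⟩
    have v1 := h.val _ g1
    have v2 := h.val _ g2
    unfold Val at v1 v2
    refine h.no_mirror hC hT g1 g2 ?_ (by rw [t1]; ring) ?_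
    · cases p <;> simp only [jn, nxt] at * <;> omega
    · cases p <;> simp only [jn, nxt] at * <;> unfold tau0 <;> split_ifs <;> omega
  have kP : jn a b c p + 1 ∉ P₁ ∨ jn a b c p + 1 ∉ P₂ := by
    by_contra hcon
    push Not at hcon
    exact hnP.2.2.2 _ hcon.1 _ hcon.2 rfl
  have kQ : jn a b c (nxt p) - 1 ∉ Q₁ ∨ jn a b c (nxt p) - 1 ∉ Q₂ := by
    by_contra hcon
    push Not at hcon
    exact hnQ.2.2.2 _ hcon.1 _ hcon.2 rfl
  have subP : ∀ x, x ∉ T → x ∉ P₁ ∧ x ∉ P₂ := fun x hx =>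
    ⟨fun h' => hx (by rw [hP]; simp [h']), fun h' => hx (by rw [hP]; simp [h'])⟩
  have subQ : ∀ x, x ∉ T → x ∉ Q₁ ∧ x ∉ Q₂ := fun x hx =>
    ⟨fun h' => hx (by rw [hQ]; simp [h']), fun h' => hx (by rw [hQ]; simp [h'])⟩
  by_cases g1 : jn a b c p + 1 ∈ T
  · have g2 := subQ _ (fun g => hmir ⟨g1, g⟩)
    rcases kP with k | k
    · exact hu k g2.1
    · exact hl k g2.2
  · have g2 := subP _ g1
    rcases kQ with k | k
    · exact hu g2.1 k
    · exact hl g2.2 k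

lemma Std.chg_pair (hC : Cur W n) (h : Std W n a b c u l T) (hT : 2 * (T.length + 1) ≤ n) {i j : ℤ}
    (hi : Chg W i) (hj : Chg W j) (hij : W i ≠ W j) :
    ∃ i' j', (j' = i' - 1 ∨ j' = i' + 1) ∧ Chg W i' ∧ Chg W j' ∧ W i' = W i ∧ W j' = W j := by
  have h1 := h.jn_mem hi
  have h2 := h.jn_mem hj
  have hor : W j = nxt (W i) ∨ W i = nxt (W j) := by
    cases hx : W i <;> cases hy : W j <;> simp [hx, hy, nxt] at hij ⊢
  rcases hor with e | e
  · rw [e] at h2 ⊢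
    exact h.chg_pair_nxt hC hT h1 h2
  · rw [e] at h1 ⊢
    obtain ⟨i', j', g1, g2, g3, g4, g5⟩ := h.chg_pair_nxt hC hT h2 h1
    exact ⟨j', i', by omega, g3, g2, g5, g4⟩

end

section

/-- The changes of direction of a curve of minimal complexity. -/
structure Sparse (W : ℤ → Letter) (n : ℤ) : Prop where
  two : ∀ i j k, Chg W i → Chg W j → Chg W k → W i = W j → W i = W k → n ∣ i - j ∨ n ∣ i - k ∨ n ∣ j - k
  none : ∃ p, ∀ i, W i = p → ¬ Chg W i
  pair : ∀ i j, Chg W i → Chg W j → W i ≠ W j →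
    ∃ i' j', (j' = i' - 1 ∨ j' = i' + 1) ∧ Chg W i' ∧ Chg W j' ∧ W i' = W i ∧ W j' = W j

variable {W : ℤ → Letter} {n : ℤ}

lemma chg_rev (c i : ℤ) : Chg (fun k => W (c - k)) i ↔ Chg W (c - i) := by
  unfold Chg
  beta_reduce
  rw [ne_comm, show c - (i - 1) = c - i + 1 by ring, show c - (i + 1) = c - i - 1 by ring]

lemma Sparse.rev (h : Sparse W n) (c : ℤ) : Sparse (fun k => W (c - k)) n := by
  refine ⟨fun i j k hi hj hk hij hik => ?_, ?_, fun i j hi hj hij => ?_⟩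
  · rw [chg_rev] at hi hj hk
    have := h.two _ _ _ hi hj hk hij hik
    rw [show i - j = -(c - i - (c - j)) by ring, show i - k = -(c - i - (c - k)) by ring,
      show j - k = -(c - j - (c - k)) by ring, dvd_neg, dvd_neg, dvd_neg]
    exact this
  · obtain ⟨p, hp⟩ := h.none
    exact ⟨p, fun i hi => by rw [chg_rev]; exact hp _ hi⟩
  · rw [chg_rev] at hi hj
    obtain ⟨i', j', h1, h2, h3, h4, h5⟩ := h.pair _ _ hi hj hij
    refine ⟨c - i', c - j', by omega, ?_, ?_, ?_, ?_⟩
    · rw [chg_rev, sub_sub_cancel]; exact h2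
    · rw [chg_rev, sub_sub_cancel]; exact h3
    · simpa using h4
    · simpa using h5

lemma sparse_of_card (hC : Cur W n) (hcard : (crPairs (can W) n 0).card < n) : Sparse W n := by
  obtain ⟨a, b, c, u, l, T, h, hT⟩ := exists_std hC
  have hT' : 2 * ((T.length : ℤ) + 1) ≤ n := by
    have := h.hn
    omega
  exact ⟨fun i j k => h.chg_two (h.nodup hC hT'), h.no_chg hC hT', fun i j => h.chg_pair hC hT'⟩

lemma le_card_crPairs (hC : Cur W n) : n - 2 ≤ (crPairs (can W) n 0).card := by
  obtain ⟨a, b, c, u, l, T, h, hT⟩ := exists_std hC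
  have := h.length_ge hC
  omega

/-- The cyclic word with letters `p (nxt p) (prv p nxt p)ᶜ (p nxt p)ᵇ⁻¹ (p prv p)ᵃ` of length
`n = 2 * (a + b + c)`. -/
def FW (p : Letter) (b c n i : ℤ) : Letter :=
  if i % n % 2 = 1 then (if i % n < 2 * (b + c) then nxt p else prv p)
  else if 0 < i % n ∧ i % n ≤ 2 * c then prv p else p

lemma eq_third {p q : Letter} (h1 : q ≠ p) (h2 : q ≠ nxt p) : q = prv p := by
  cases p <;> cases q <;> simp_all [nxt, prv]

lemma eq_third' {p q : Letter} (h1 : q ≠ p) (h2 : q ≠ prv p) : q = nxt p := by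
  cases p <;> cases q <;> simp_all [nxt, prv]

lemma eq_third'' {p q : Letter} (h1 : q ≠ nxt p) (h2 : q ≠ prv p) : q = p := by
  cases p <;> cases q <;> simp_all [nxt, prv]

lemma nxt_ne (p : Letter) : nxt p ≠ p := by cases p <;> simp [nxt]

lemma prv_ne (p : Letter) : prv p ≠ p := by cases p <;> simp [prv]

lemma not_dvd_of_lt {i j : ℤ} (h0 : 0 ≤ j) (h1 : j < i) (h2 : i < n) : ¬ n ∣ j - i := by
  intro h
  rw [← dvd_neg] at h
  have := Int.le_of_dvd (by omega) h
  omega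

variable {V : ℤ → Letter} {p : Letter}

lemma tail_form (hC : Cur V n) (hS : Sparse V n) {c : ℤ} (hc : 0 ≤ c) (hcn : 2 * c + 2 ≤ n)
    (hm : V (-1) = prv p) (h0 : V 0 = p) (h1 : V 1 = nxt p)
    (hc1 : V (2 * c + 1) = nxt p) (hc2 : V (2 * c + 2) = p)
    (hodd : ∀ i, 2 * c + 1 < i → i < n → Chg V i → V i = p) :
    ∃ m, c < m ∧ 2 * m < n ∧ (∀ j, c < j → j < m → V (2 * j) = p ∧ V (2 * j + 1) = nxt p) ∧
      ∀ j, m ≤ j → 2 * j < n → V (2 * j) = p ∧ V (2 * j + 1) = prv p := by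
  have hpar := hC.even
  have chg : ∀ i, ¬ Chg V i → V (i + 1) = V (i - 1) := by
    intro i hi; unfold Chg at hi; push Not at hi; exact hi.symm
  have claim : ∀ d : ℕ, (∀ d' < d, ¬ Chg V (2 * (c + 1 + (d' : ℕ)))) → 2 * (c + d) + 2 ≤ n →
      V (2 * (c + d) + 1) = nxt p ∧ V (2 * (c + d) + 2) = p := by
    intro d
    induction d with
    | zero => intro _ _; exact ⟨by simpa using hc1, by simpa using hc2⟩
    | succ d ih =>
      intro hd hle
      push_cast at hle ⊢
      obtain ⟨g1, g2⟩ := ih (fun d' hd' => hd d' (by omega)) (by omega)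
      have g3 := chg _ (hd d (by omega))
      rw [show 2 * (c + 1 + (d : ℤ)) + 1 = 2 * (c + (d + 1)) + 1 by ring,
        show 2 * (c + 1 + (d : ℤ)) - 1 = 2 * (c + d) + 1 by ring, g1] at g3
      refine ⟨g3, ?_⟩
      have g4 := chg (2 * (c + (d + 1)) + 1) (fun hch => by
        have := hodd _ (by omega) (by omega) hch
        rw [g3] at this
        exact nxt_ne p this)
      rw [show 2 * (c + ((d : ℤ) + 1)) + 1 - 1 = 2 * (c + d) + 2 by ring, g2] at g4
      rw [show 2 * (c + ((d : ℤ) + 1)) + 2 = 2 * (c + (d + 1)) + 1 + 1 by ring]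
      exact g4
  have hn1 : V (n - 1) = prv p := by
    rw [show n - 1 = -1 + n by ring, hC.per, hm]
  have hbound : ∀ d : ℕ, (∀ d' < d, ¬ Chg V (2 * (c + 1 + (d' : ℕ)))) → 2 * (c + d) + 2 < n := by
    intro d hd
    by_contra hcon
    obtain ⟨k, hk⟩ : ∃ k : ℕ, 2 * (c + k) + 2 = n := ⟨((n - 2 - 2 * c) / 2).toNat, by omega⟩
    have := (claim k (fun d' hd' => hd d' (by omega)) (by omega)).1
    rw [show 2 * (c + (k : ℤ)) + 1 = n - 1 by omega, hn1] at this
    exact nxt_ne_prv p this.symm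
  have hex : ∃ d : ℕ, Chg V (2 * (c + 1 + (d : ℕ))) := by
    by_contra hcon
    push Not at hcon
    have := hbound n.toNat (fun d _ => hcon d)
    omega
  set d := Nat.find hex with hd
  have hd1 : Chg V (2 * (c + 1 + (d : ℕ))) := Nat.find_spec hex
  have hd2 : ∀ d' < d, ¬ Chg V (2 * (c + 1 + (d' : ℕ))) := fun d' h => Nat.find_min hex h
  have hd3 := hbound d hd2
  obtain ⟨k1, k2⟩ := claim d hd2 hd3.le
  refine ⟨c + 1 + d, by omega, by omega, ?_, ?_⟩
  · intro j hj1 hj2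
    obtain ⟨e, rfl⟩ : ∃ e : ℕ, j = c + 1 + e := ⟨(j - c - 1).toNat, by omega⟩
    obtain ⟨-, g2⟩ := claim e (fun d' hd' => hd2 d' (by omega)) (by omega)
    obtain ⟨g1, -⟩ := claim (e + 1) (fun d' hd' => hd2 d' (by omega)) (by push_cast; omega)
    rw [show 2 * (c + 1 + (e : ℤ)) = 2 * (c + e) + 2 by ring]
    refine ⟨g2, ?_⟩
    push_cast at g1
    rw [show 2 * (c + (e : ℤ)) + 2 + 1 = 2 * (c + (e + 1)) + 1 by ring]
    exact g1
  · have hch0 : Chg V 0 := by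
      unfold Chg
      rw [show (0 : ℤ) - 1 = -1 by ring, show (0 : ℤ) + 1 = 1 by ring, hm, h1]
      exact (nxt_ne_prv p).symm
    have hVm : V (2 * (c + 1 + d)) = p := by
      rw [show 2 * (c + 1 + (d : ℤ)) = 2 * (c + d) + 2 by ring]; exact k2
    suffices H : ∀ e : ℕ, 2 * (c + 1 + d + e) < n → V (2 * (c + 1 + d + e)) = p ∧
        V (2 * (c + 1 + d + e) + 1) = prv p by
      intro j hj1 hj2
      obtain ⟨e, rfl⟩ : ∃ e : ℕ, j = c + 1 + d + e := ⟨(j - c - 1 - d).toNat, by omega⟩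
      exact H e hj2
    intro e
    induction e with
    | zero =>
      intro _
      simp only [Nat.cast_zero, add_zero]
      refine ⟨hVm, eq_third ?_ ?_⟩
      · rw [← hVm]; exact (hC.red _).symm
      · unfold Chg at hd1
        rw [show 2 * (c + 1 + (d : ℤ)) - 1 = 2 * (c + d) + 1 by ring, k1] at hd1
        exact hd1.symm
    | succ e ih =>
      intro hlt
      push_cast at hlt ⊢
      obtain ⟨g1, g2⟩ := ih (by omega)
      have g3 := chg (2 * (c + 1 + d + e) + 1) (fun hch => by
        have := hodd _ (by omega) (by omega) hch
        rw [g2] at this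
        exact prv_ne p this)
      rw [add_sub_cancel_right, g1] at g3
      have g4 : V (2 * (c + 1 + d + (e + 1))) = p := by
        rw [show 2 * (c + 1 + (d : ℤ) + (e + 1)) = 2 * (c + 1 + d + e) + 1 + 1 by ring]; exact g3
      refine ⟨g4, ?_⟩
      have g5 := chg (2 * (c + 1 + d + (e + 1))) (fun hch => by
        rcases hS.two 0 (2 * (c + 1 + d)) _ hch0 hd1 hch (h0.trans hVm.symm) (h0.trans g4.symm) with h | h | h
        · exact not_dvd_of_lt le_rfl (by omega) (by omega) h
        · exact not_dvd_of_lt le_rfl (by omega) (by omega) h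
        · exact not_dvd_of_lt (by omega) (by omega) (by omega) h)
      rw [show 2 * (c + 1 + (d : ℤ) + (e + 1)) - 1 = 2 * (c + 1 + d + e) + 1 by ring, g2] at g5
      exact g5

lemma eq_FW (hC : Cur V n) {c m : ℤ} (h0 : V 0 = p) (h1 : V 1 = nxt p)
    (hmid : ∀ j, 1 ≤ j → j ≤ c → V (2 * j) = prv p ∧ V (2 * j + 1) = nxt p)
    (h2 : ∀ j, c < j → j < m → V (2 * j) = p ∧ V (2 * j + 1) = nxt p)
    (h3 : ∀ j, m ≤ j → 2 * j < n → V (2 * j) = p ∧ V (2 * j + 1) = prv p) (i : ℤ) :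
    V i = FW p (m - c) c n i := by
  have hn := hC.pos
  have e1 : V i = V (i % n) := by
    conv_lhs => rw [← Int.emod_add_mul_ediv i n]
    rw [per_mul hC.per]
  rw [e1]
  unfold FW
  have b1 := Int.emod_nonneg i hn.ne'
  have b2 := Int.emod_lt_of_pos i hn
  set j := i % n
  have he : j % 2 = 0 ∨ j % 2 = 1 := Int.emod_two_eq j
  obtain ⟨k, hk⟩ : ∃ k, k = j / 2 := ⟨_, rfl⟩
  have g1 := hmid k
  have g2 := h2 k
  have g3 := h3 k
  rcases he with he | he
  · rw [if_neg (by omega)]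
    rw [show 2 * k = j by omega] at g1 g2 g3
    split_ifs with h
    · exact (g1 (by omega) (by omega)).1
    · by_cases hj0 : j = 0
      · rw [hj0]; exact h0
      · by_cases hjm : k < m
        · exact (g2 (by omega) hjm).1
        · exact (g3 (by omega) (by omega)).1
  · rw [if_pos he]
    rw [show 2 * k + 1 = j by omega] at g1 g2 g3
    split_ifs with h
    · by_cases hj0 : j = 1
      · rw [hj0]; exact h1
      · by_cases hjm : k ≤ c
        · exact (g1 (by omega) hjm).2
        · exact (g2 (by omega) (by omega)).2
    · exact (g3 (by omega) (by omega)).2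

lemma form_two (hC : Cur V n) (hS : Sparse V n) (hm : V (-1) = prv p) (h0 : V 0 = p) (h1 : V 1 = nxt p)
    (h2 : V 2 = prv p) : ∃ b c, 1 ≤ b ∧ 0 ≤ c ∧ 2 * (b + c) < n ∧ ∀ i, V i = FW p b c n i := by
  have hpar := hC.even
  have hn := hC.pos
  have chg : ∀ i, ¬ Chg V i → V (i + 1) = V (i - 1) := by
    intro i hi; unfold Chg at hi; push Not at hi; exact hi.symm
  have c0 : Chg V 0 := by
    unfold Chg
    rw [show (0 : ℤ) - 1 = -1 by ring, show (0 : ℤ) + 1 = 1 by ring, hm, h1]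
    exact (nxt_ne_prv p).symm
  have c1 : Chg V 1 := by
    unfold Chg
    rw [show (1 : ℤ) - 1 = 0 by ring, show (1 : ℤ) + 1 = 2 by ring, h0, h2]
    exact (prv_ne p).symm
  obtain ⟨s, hs⟩ := hS.none
  have hsr : s = prv p := by
    apply eq_third
    · intro h; exact hs 0 (h0.trans h.symm) c0
    · intro h; exact hs 1 (h1.trans h.symm) c1
  rw [hsr] at hs
  have claim : ∀ d : ℕ, (∀ d' < d, ¬ Chg V (2 * (d' : ℕ) + 3)) →
      V (2 * (d : ℤ) + 2) = prv p ∧ V (2 * (d : ℤ) + 3) = nxt p := by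
    intro d
    induction d with
    | zero =>
      intro _
      have := chg 2 (hs _ h2)
      refine ⟨by simpa using h2, ?_⟩
      simpa [h1] using this
    | succ d ih =>
      intro hd
      push_cast
      obtain ⟨g1, g2⟩ := ih (fun d' hd' => hd d' (by omega))
      have g3 := chg _ (hd d (by omega))
      rw [show 2 * (d : ℤ) + 3 + 1 = 2 * (d + 1) + 2 by ring, show 2 * (d : ℤ) + 3 - 1 = 2 * d + 2 by ring, g1] at g3
      have g4 := chg _ (hs _ g3)
      rw [show 2 * ((d : ℤ) + 1) + 2 + 1 = 2 * (d + 1) + 3 by ring,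
        show 2 * ((d : ℤ) + 1) + 2 - 1 = 2 * d + 3 by ring, g2] at g4
      exact ⟨g3, g4⟩
  have hVn : V n = p := by
    have := hC.per 0
    rwa [zero_add, h0] at this
  have hbound : ∀ d : ℕ, (∀ d' < d, ¬ Chg V (2 * (d' : ℕ) + 3)) → 2 * (d : ℤ) + 2 < n := by
    intro d hd
    by_contra hcon
    obtain ⟨k, hk⟩ : ∃ k : ℕ, 2 * (k : ℤ) + 2 = n := ⟨((n - 2) / 2).toNat, by omega⟩
    have := (claim k (fun d' hd' => hd d' (by omega))).1
    rw [hk, hVn] at this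
    exact prv_ne p this.symm
  have hex : ∃ d : ℕ, Chg V (2 * (d : ℕ) + 3) := by
    by_contra hcon
    push Not at hcon
    have := hbound n.toNat (fun d _ => hcon d)
    omega
  set d := Nat.find hex with hd
  have hd1 : Chg V (2 * (d : ℕ) + 3) := Nat.find_spec hex
  have hd2 : ∀ d' < d, ¬ Chg V (2 * (d' : ℕ) + 3) := fun d' h => Nat.find_min hex h
  have hd3 := hbound d hd2
  obtain ⟨k1, k2⟩ := claim d hd2
  have k3 : V (2 * (d + 1 : ℤ) + 2) = p := by
    unfold Chg at hd1
    rw [show 2 * (d : ℤ) + 3 - 1 = 2 * d + 2 by ring, show 2 * (d : ℤ) + 3 + 1 = 2 * (d + 1) + 2 by ring, k1] at hd1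
    refine eq_third'' ?_ hd1.symm
    rw [← k2, show 2 * ((d : ℤ) + 1) + 2 = 2 * d + 3 + 1 by ring]
    exact (hC.red _).symm
  have k2' : V (2 * (d + 1 : ℤ) + 1) = nxt p := by
    rw [show 2 * ((d : ℤ) + 1) + 1 = 2 * d + 3 by ring]; exact k2
  obtain ⟨m, m1, m2, m3, m4⟩ := tail_form hC hS (c := d + 1) (by omega) (by omega) hm h0 h1 k2' k3 (by
    intro i hi1 hi2 hch
    refine eq_third'' (fun hq => ?_) (fun hr => hs i hr hch)
    rcases hS.two 1 (2 * d + 3) i c1 hd1 hch (h1.trans k2.symm) (h1.trans hq.symm) with h | h | h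
    · exact not_dvd_of_lt (by omega) (by omega) (by omega) h
    · exact not_dvd_of_lt (by omega) (by omega) (by omega) h
    · exact not_dvd_of_lt (by omega) (by omega) (by omega) h)
  refine ⟨m - (d + 1), d + 1, by omega, by omega, by omega, eq_FW hC h0 h1 ?_ m3 m4⟩
  intro j hj1 hj2
  obtain ⟨e, rfl⟩ : ∃ e : ℕ, j = e + 1 := ⟨(j - 1).toNat, by omega⟩
  obtain ⟨g1, g2⟩ := claim e (fun d' hd' => hd2 d' (by omega))
  rw [show 2 * ((e : ℤ) + 1) = 2 * e + 2 by ring, show 2 * (e : ℤ) + 2 + 1 = 2 * e + 3 by ring]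
  exact ⟨g1, g2⟩

lemma form_one (hC : Cur V n) (hS : Sparse V n) (hm : V (-1) = prv p) (h0 : V 0 = p) (h1 : V 1 = nxt p)
    (h : ∀ i, Chg V i → V i = p) : ∃ b c, 1 ≤ b ∧ 0 ≤ c ∧ 2 * (b + c) < n ∧ ∀ i, V i = FW p b c n i := by
  have hn := hC.pos
  have hpar := hC.even
  have h2 : V 2 = p := by
    have : ¬ Chg V 1 := fun hc => nxt_ne p (h1.symm.trans (h 1 hc))
    unfold Chg at this
    push Not at this
    rw [← h0]; exact this.symm
  obtain ⟨m, m1, m2, m3, m4⟩ := tail_form hC hS (c := 0) le_rfl (by omega) hm h0 h1 (by simpa using h1)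
    (by simpa using h2) (fun i _ _ hi => h i hi)
  exact ⟨m, 0, by omega, le_rfl, by omega, by
    simpa using eq_FW hC h0 h1 (fun j h1 h2 => by omega) m3 m4⟩

/-- A curve of minimal complexity, up to translation and reversal. -/
lemma Sparse.form (hC : Cur W n) (h4 : 4 ≤ n) (hS : Sparse W n) :
    ∃ p b c t, 1 ≤ b ∧ 0 ≤ c ∧ 2 * (b + c) < n ∧
      ((∀ i, W (t + i) = FW p b c n i) ∨ ∀ i, W (t - i) = FW p b c n i) := by
  have shC : ∀ t, Cur (fun i => W (t + i)) n := by
    intro t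
    have := (hC.rev t).rev 0
    simpa using this
  have shS : ∀ t, Sparse (fun i => W (t + i)) n := by
    intro t
    have := (hS.rev t).rev 0
    simpa using this
  by_cases hone : ∃ p, ∀ i, Chg W i → W i = p
  · obtain ⟨p, hp⟩ := hone
    obtain ⟨k, hk⟩ := hC.change h4
    have hch : Chg W (k + 1) := by
      unfold Chg
      rwa [show k + 1 - 1 = k by ring, show k + 1 + 1 = k + 2 by ring]
    have hpk := hp _ hch
    have hk1 : W k ≠ p := by rw [← hpk]; exact hC.red k
    have hk2 : W (k + 2) ≠ p := by
      rw [← hpk, show k + 2 = k + 1 + 1 by ring]; exact (hC.red _).symm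
    by_cases hd : W k = prv p
    · obtain ⟨b, c, h1, h2, h3, h5⟩ := form_one (p := p) (shC (k + 1)) (shS (k + 1)) (by simpa using hd) (by simpa using hpk)
        (by rw [show k + 1 + 1 = k + 2 by ring]; exact eq_third' hk2 (by rw [← hd]; exact hk.symm))
        (by
          intro i hi
          apply hp
          unfold Chg at hi ⊢
          rwa [show k + 1 + i - 1 = k + 1 + (i - 1) by ring, show k + 1 + i + 1 = k + 1 + (i + 1) by ring])
      exact ⟨p, b, c, k + 1, h1, h2, h3, Or.inl h5⟩
    · have hd' := eq_third' hk1 hd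
      obtain ⟨b, c, h1, h2, h3, h5⟩ := form_one (p := p) (hC.rev (k + 1)) (hS.rev (k + 1))
        (by rw [show k + 1 - -1 = k + 2 by ring]; exact eq_third hk2 (by rw [← hd']; exact hk.symm)) (by simpa using hpk)
        (by simpa using hd') (by
          intro i hi
          rw [chg_rev] at hi
          exact hp _ hi)
      exact ⟨p, b, c, k + 1, h1, h2, h3, Or.inr h5⟩
  · push Not at hone
    obtain ⟨i₀, hi₀, -⟩ := hone .x
    obtain ⟨j₀, hj₀, hne⟩ := hone (W i₀)
    obtain ⟨i, j, hij, hi, hj, e1, e2⟩ := hS.pair _ _ hi₀ hj₀ hne.symm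
    obtain ⟨k, hk1, hk2⟩ : ∃ k, Chg W k ∧ Chg W (k + 1) := by
      rcases hij with rfl | rfl
      · exact ⟨i - 1, hj, by simpa using hi⟩
      · exact ⟨i, hi, hj⟩
    unfold Chg at hk1 hk2
    rw [show k + 1 - 1 = k by ring, show k + 1 + 1 = k + 2 by ring] at hk2
    have r1 := hC.red' k
    have r2 := hC.red k
    have r3 := hC.red (k + 1)
    rw [show k + 1 + 1 = k + 2 by ring] at r3
    by_cases hd : W (k + 1) = nxt (W k)
    · rw [hd] at hk1 r3
      obtain ⟨b, c, h1, h2, h3, h5⟩ := form_two (p := W k) (shC k) (shS k) (by exact eq_third r1 hk1)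
        (by simp) hd (eq_third hk2.symm r3.symm)
      exact ⟨_, b, c, k, h1, h2, h3, Or.inl h5⟩
    · have hd' := eq_third r2.symm hd
      have hq : W k = nxt (W (k + 1)) := by rw [hd']; cases W k <;> rfl
      rw [hq] at r1 hk2
      obtain ⟨b, c, h1, h2, h3, h5⟩ := form_two (p := W (k + 1)) (hC.rev (k + 1)) (hS.rev (k + 1))
        (by rw [show k + 1 - -1 = k + 2 by ring]; exact eq_third r3.symm hk2.symm) (by simp)
        (by simpa using hq) (by rw [show k + 1 - 2 = k - 1 by ring]; exact eq_third hk1 r1)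
      exact ⟨_, b, c, k + 1, h1, h2, h3, Or.inr h5⟩

end

section

/-- The word `FW p b c n` translated by `2 * a`, where `n = 2 * (a + b + c)`. -/
def UW (p : Letter) (a c n i : ℤ) : Letter :=
  if i % n % 2 = 0 then (if i % n ≤ 2 * a then p else if i % n ≤ 2 * a + 2 * c then prv p else p)
  else if i % n < 2 * a then prv p else nxt p

/-- A diagram of the word `UW p a c n` with few crossings. -/
def kap (a c n i : ℤ) : ℤ :=
  if i % n % 2 = 0 then
    (if i % n ≤ 2 * a then 4 * n - i % n else if i % n ≤ 2 * a + 2 * c then i % n - n else 4 * n + i % n)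
  else if i % n < 2 * a then i % n else 8 * n - i % n

variable {p : Letter} {a b c n : ℤ}

lemma FW_eq_UW (ha : 0 ≤ a) (hb : 1 ≤ b) (hc : 0 ≤ c) (hn : n = 2 * (a + b + c)) (i : ℤ) :
    FW p b c n i = UW p a c n (i + 2 * a) := by
  have h0 := Int.emod_nonneg i (b := n) (by omega)
  have h1 := Int.emod_lt_of_pos i (b := n) (by omega)
  have h2 : (i + 2 * a) % n = if i % n + 2 * a < n then i % n + 2 * a else i % n + 2 * a - n := by
    rw [Int.add_emod, Int.emod_eq_of_lt (a := 2 * a) (by omega) (by omega)]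
    split_ifs with h
    · exact Int.emod_eq_of_lt (by omega) h
    · rw [← Int.sub_emod_right]; exact Int.emod_eq_of_lt (by omega) (by omega)
  unfold FW UW
  rw [h2]
  split_ifs <;> first | rfl | (exfalso; omega)

lemma ordp_values (p : Letter) : ordp p p = 1 ∧ ordp p (prv p) = 0 ∧ ordp p (nxt p) = 2 := by
  cases p <;> simp [ordp, prv, nxt]

lemma kap_diag (ha : 0 ≤ a) (hb : 1 ≤ b) (hc : 0 ≤ c) (hn : n = 2 * (a + b + c)) :
    Diag (UW p a c n) n p (kap a c n) where
  mono i j h := by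
    obtain ⟨h1, h2, h3⟩ := ordp_values p
    have i0 := Int.emod_nonneg i (b := n) (by omega)
    have i1 := Int.emod_lt_of_pos i (b := n) (by omega)
    have j0 := Int.emod_nonneg j (b := n) (by omega)
    have j1 := Int.emod_lt_of_pos j (b := n) (by omega)
    unfold UW at h
    unfold kap
    split_ifs at h ⊢ <;> omega
  per i := by unfold kap; rw [Int.add_emod_right]
  inj i j h := by
    have i0 := Int.emod_nonneg i (b := n) (by omega)
    have i1 := Int.emod_lt_of_pos i (b := n) (by omega)
    have j0 := Int.emod_nonneg j (b := n) (by omega)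
    have j1 := Int.emod_lt_of_pos j (b := n) (by omega)
    apply Int.ModEq.dvd
    symm
    unfold kap at h
    show i % n = j % n
    split_ifs at h <;> omega

lemma kap_seg (ha : 0 ≤ a) (hb : 1 ≤ b) (hc : 0 ≤ c) (hn : n = 2 * (a + b + c)) {i : ℤ} (h0 : 0 ≤ i) (h1 : i < n) :
    (i % 2 = 0 ∧
      ((i = 0 ∧ kap a c n (i - 1) = 7 * n + 1 ∧ kap a c n i = 4 * n) ∨
      (1 ≤ i ∧ i ≤ 2 * a ∧ kap a c n (i - 1) = i - 1 ∧ kap a c n i = 4 * n - i) ∨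
      (2 * a < i ∧ i ≤ 2 * a + 2 * c ∧ kap a c n (i - 1) = 8 * n - i + 1 ∧ kap a c n i = i - n) ∨
      (2 * a + 2 * c < i ∧ kap a c n (i - 1) = 8 * n - i + 1 ∧ kap a c n i = 4 * n + i))) ∨
    (i % 2 = 1 ∧
      ((i < 2 * a ∧ kap a c n (i - 1) = 4 * n - i + 1 ∧ kap a c n i = i) ∨
      (i = 2 * a + 1 ∧ kap a c n (i - 1) = 4 * n - i + 1 ∧ kap a c n i = 8 * n - i) ∨
      (2 * a + 1 < i ∧ i ≤ 2 * a + 2 * c + 1 ∧ kap a c n (i - 1) = i - 1 - n ∧ kap a c n i = 8 * n - i) ∨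
      (2 * a + 2 * c + 1 < i ∧ kap a c n (i - 1) = 4 * n + i - 1 ∧ kap a c n i = 8 * n - i))) := by
  have e1 : i % n = i := Int.emod_eq_of_lt h0 h1
  have e2 : (i - 1) % n = if i = 0 then n - 1 else i - 1 := by
    split_ifs with h
    · rw [h, ← Int.add_emod_right]; exact (Int.emod_eq_of_lt (by omega) (by omega)).trans (by ring)
    · exact Int.emod_eq_of_lt (by omega) (by omega)
  unfold kap
  rw [e1, e2]
  rcases Int.emod_two_eq i with hi | hi
  · left
    refine ⟨hi, ?_⟩
    split_ifs <;> omega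
  · right
    refine ⟨hi, ?_⟩
    split_ifs <;> omega

lemma kap_cross (ha : 0 ≤ a) (hb : 1 ≤ b) (hc : 0 ≤ c) (hn : n = 2 * (a + b + c)) {i j : ℤ} (h0 : 0 ≤ i)
    (hij : i < j) (h1 : j < n) (hpar : (i - j) % 2 = 0) (h : VCr (kap a c n) i j ∨ VCr (kap a c n) j i) :
    (i % 2 = 1 ∧ i < 2 * a ∧ j = 2 * a + 1) ∨ (i = 2 * a + 1 ∧ j ≤ 2 * a + 2 * c + 1) ∨
      (i = 0 ∧ 2 * a + 2 * c < j) := by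
  have hi := kap_seg ha hb hc hn h0 (hij.trans h1)
  have hj := kap_seg ha hb hc hn (h0.trans hij.le) h1
  unfold VCr Cr betw at h
  rcases hi with ⟨pi, hi⟩ | ⟨pi, hi⟩ <;> rcases hj with ⟨pj, hj⟩ | ⟨pj, hj⟩
  · rcases hi with ⟨g1, k1, k2⟩ | ⟨g1, g2, k1, k2⟩ | ⟨g1, g2, k1, k2⟩ | ⟨g1, k1, k2⟩ <;>
    rcases hj with ⟨g3, k3, k4⟩ | ⟨g3, g4, k3, k4⟩ | ⟨g3, g4, k3, k4⟩ | ⟨g3, k3, k4⟩ <;>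
    rw [k1, k2, k3, k4] at h <;> omega
  · omega
  · omega
  · rcases hi with ⟨g1, k1, k2⟩ | ⟨g1, k1, k2⟩ | ⟨g1, g2, k1, k2⟩ | ⟨g1, k1, k2⟩ <;>
    rcases hj with ⟨g3, k3, k4⟩ | ⟨g3, k3, k4⟩ | ⟨g3, g4, k3, k4⟩ | ⟨g3, k3, k4⟩ <;>
    rw [k1, k2, k3, k4] at h <;> omega

lemma card_kap (ha : 0 ≤ a) (hb : 1 ≤ b) (hc : 0 ≤ c) (hn : n = 2 * (a + b + c)) :
    ((crPairs (kap a c n) n 0).card : ℤ) ≤ n - 2 := by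
  set F₁ : Finset (ℤ × ℤ) := (Finset.Ico 0 a).image (fun k => (2 * k + 1, 2 * a + 1)) with hF₁
  set F₂ : Finset (ℤ × ℤ) := (Finset.Ico 0 c).image (fun k => (2 * a + 1, 2 * a + 3 + 2 * k)) with hF₂
  set F₃ : Finset (ℤ × ℤ) := (Finset.Ico (a + c + 1) (a + b + c)).image (fun k => (0, 2 * k)) with hF₃
  have key : ∀ i j, 0 ≤ i → i < j → j < n → (i - j) % 2 = 0 → (VCr (kap a c n) i j ∨ VCr (kap a c n) j i) →
      (i, j) ∈ F₁ ∪ F₂ ∪ F₃ := by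
    intro i j h0 hij h1 hp h
    rw [Finset.mem_union, Finset.mem_union, hF₁, hF₂, hF₃, Finset.mem_image, Finset.mem_image, Finset.mem_image]
    rcases kap_cross ha hb hc hn h0 hij h1 hp h with ⟨g1, g2, g3⟩ | ⟨g1, g2⟩ | ⟨g1, g2⟩
    · exact Or.inl (Or.inl ⟨i / 2, Finset.mem_Ico.2 (by omega), by rw [Prod.mk.injEq]; omega⟩)
    · exact Or.inl (Or.inr ⟨(j - 2 * a - 3) / 2, Finset.mem_Ico.2 (by omega), by rw [Prod.mk.injEq]; omega⟩)
    · exact Or.inr ⟨j / 2, Finset.mem_Ico.2 (by omega), by rw [Prod.mk.injEq]; omega⟩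
  have hsub : crPairs (kap a c n) n 0 ⊆ (F₁ ∪ F₂ ∪ F₃) ∪ (F₁ ∪ F₂ ∪ F₃).image Prod.swap := by
    rintro ⟨i, j⟩ h
    rw [mem_crPairs] at h
    obtain ⟨h1, h2, h3, h4⟩ := h
    dsimp only at h1 h2 h3 h4
    rcases lt_trichotomy i j with hij | rfl | hij
    · exact Finset.mem_union_left _ (key i j (by omega) hij (by omega) h3 (Or.inl h4))
    · exact absurd h4 (not_vcr_self _ i)
    · exact Finset.mem_union_right _ (Finset.mem_image.2
        ⟨(j, i), key j i (by omega) hij (by omega) (by omega) (Or.inr h4), rfl⟩)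
  have c1 : F₁.card ≤ a.toNat := Finset.card_image_le.trans (by rw [Int.card_Ico]; omega)
  have c2 : F₂.card ≤ c.toNat := Finset.card_image_le.trans (by rw [Int.card_Ico]; omega)
  have c3 : F₃.card ≤ (b - 1).toNat := Finset.card_image_le.trans (by rw [Int.card_Ico]; omega)
  have c4 := Finset.card_union_le (F₁ ∪ F₂) F₃
  have c5 := Finset.card_union_le F₁ F₂
  have c6 := Finset.card_union_le (F₁ ∪ F₂ ∪ F₃) ((F₁ ∪ F₂ ∪ F₃).image Prod.swap)
  have c7 := Finset.card_image_le (s := F₁ ∪ F₂ ∪ F₃) (f := Prod.swap)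
  have c8 := Finset.card_le_card hsub
  omega

lemma sTwo_le_of_form {W : ℤ → Letter} {t : ℤ} {v : Gamma} (hC : Cur W n) (h4 : 4 ≤ n) (hv : io v = gg W n)
    (hb : 1 ≤ b) (hc : 0 ≤ c) (hbc : 2 * (b + c) ≤ n)
    (h : (∀ i, W (t + i) = FW p b c n i) ∨ ∀ i, W (t - i) = FW p b c n i) : (sTwo v : ℤ) ≤ n - 2 := by
  have hpar := hC.even
  obtain ⟨a, ha⟩ : ∃ a, a = n / 2 - b - c := ⟨_, rfl⟩
  have ha0 : 0 ≤ a := by omega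
  have hn : n = 2 * (a + b + c) := by omega
  have hD := kap_diag (p := p) ha0 hb hc hn
  have hcard := card_kap ha0 hb hc hn
  rcases h with h | h
  · have hW : ∀ i, W i = UW p a c n (i + (2 * a - t)) := by
      intro i
      have := h (i - t)
      rw [add_sub_cancel, FW_eq_UW ha0 hb hc hn] at this
      rw [this]; congr 1; ring
    have hD' : Diag W n p (fun i => kap a c n (i + (2 * a - t))) :=
      ⟨fun i j hij => hD.mono _ _ (by rwa [← hW, ← hW]),
        fun i => by rw [show i + n + (2 * a - t) = i + (2 * a - t) + n by ring]; exact hD.per _,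
        fun i j hij => by simpa using hD.inj _ _ hij⟩
    have := sTwo_le hC h4 hv hD' (-(2 * a - t))
    have hle : (crPairs (fun i => kap a c n (i + (2 * a - t))) n (-(2 * a - t))).card ≤
        (crPairs (kap a c n) n 0).card := by
      apply Finset.card_le_card_of_injOn (fun q => (q.1 + (2 * a - t), q.2 + (2 * a - t)))
      · intro q hq
        rw [Finset.mem_coe, mem_crPairs] at hq ⊢
        obtain ⟨h1, h2, h3, h4⟩ := hq
        refine ⟨by dsimp only; omega, by dsimp only; omega, by dsimp only; omega, ?_⟩
        unfold VCr at h4 ⊢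
        dsimp only at h4 ⊢
        rw [show q.1 - 1 + (2 * a - t) = q.1 + (2 * a - t) - 1 by ring,
          show q.2 - 1 + (2 * a - t) = q.2 + (2 * a - t) - 1 by ring] at h4
        exact h4
      · intro q _ q' _ hqq
        rw [Prod.mk.injEq] at hqq
        exact Prod.ext (by omega) (by omega)
    omega
  · have hW : ∀ i, W i = UW p a c n (t + 2 * a - i) := by
      intro i
      have := h (t - i)
      rw [sub_sub_cancel, FW_eq_UW ha0 hb hc hn] at this
      rw [this]; congr 1; ring
    have hD' : Diag W n p (fun i => kap a c n (t + 2 * a - i)) :=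
      ⟨fun i j hij => hD.mono _ _ (by rwa [← hW, ← hW]),
        fun i => by
          have := hD.per (t + 2 * a - (i + n))
          rw [← this]; congr 1; ring,
        fun i j hij => by
          have := hD.inj _ _ hij
          rw [← dvd_neg] at this
          simpa using this⟩
    have := sTwo_le hC h4 hv hD' (t + 2 * a + 2 - n)
    have hle : (crPairs (fun i => kap a c n (t + 2 * a - i)) n (t + 2 * a + 2 - n)).card ≤
        (crPairs (kap a c n) n 0).card := by
      apply Finset.card_le_card_of_injOn (fun q => (t + 2 * a - q.1 + 1, t + 2 * a - q.2 + 1))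
      · intro q hq
        rw [Finset.mem_coe, mem_crPairs] at hq ⊢
        obtain ⟨h1, h2, h3, h4⟩ := hq
        refine ⟨by dsimp only; omega, by dsimp only; omega, by dsimp only; omega, ?_⟩
        unfold VCr at h4 ⊢
        dsimp only at h4 ⊢
        rw [show t + 2 * a - (q.1 - 1) = t + 2 * a - q.1 + 1 by ring,
          show t + 2 * a - (q.2 - 1) = t + 2 * a - q.2 + 1 by ring, cr_swap_left, cr_swap_right] at h4
        rw [add_sub_cancel_right, add_sub_cancel_right]
        exact h4
      · intro q _ q' _ hqq
        rw [Prod.mk.injEq] at hqq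
        exact Prod.ext (by omega) (by omega)
    omega

/-- The curves with `n - 2` as twice the number of self-crossings. -/
lemma sTwo_div_iff {W : ℤ → Letter} {v : Gamma} (hC : Cur W n) (h4 : 4 ≤ n) (hv : io v = gg W n) :
    ((sTwo v / 2 : ℕ) : ℤ) = n / 2 - 1 ↔ ∃ p b c t, 1 ≤ b ∧ 0 ≤ c ∧ 2 * (b + c) < n ∧
      ((∀ i, W (t + i) = FW p b c n i) ∨ ∀ i, W (t - i) = FW p b c n i) := by
  have hpar := hC.even
  have h1 := le_sTwo hC h4 hv 0
  constructor
  · intro h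
    exact (sparse_of_card hC (by omega)).form hC h4
  · rintro ⟨p, b, c, t, hb, hc, hbc, h⟩
    have h2 := sTwo_le_of_form hC h4 hv hb hc hbc.le h
    have h3 := le_card_crPairs hC
    omega

end

section

/-- The periodic sequence of letters of a word. -/
def lw (w : List Letter) (i : ℤ) : Letter := w.getD (i % w.length).toNat Letter.x

/-- The word formed by the first `n` letters of a sequence. -/
def wd (W : ℤ → Letter) (n : ℕ) : List Letter := (List.range n).map (fun k : ℕ => W k)

lemma length_wd (W : ℤ → Letter) (n : ℕ) : (wd W n).length = n := by simp [wd]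

lemma lw_natCast {w : List Letter} {k : ℕ} (h : k < w.length) : lw w k = w[k] := by
  unfold lw
  rw [Int.emod_eq_of_lt (by omega) (by omega), Int.toNat_natCast]
  simp [h]

lemma lw_per (w : List Letter) (i : ℤ) : lw w (i + w.length) = lw w i := by
  unfold lw; rw [Int.add_emod_right]

lemma lw_wd {W : ℤ → Letter} {n : ℕ} (hn : 0 < n) (h : ∀ i, W (i + n) = W i) (i : ℤ) :
    lw (wd W n) i = W i := by
  have h0 := Int.emod_nonneg i (b := (n : ℤ)) (by omega)
  have h1 := Int.emod_lt_of_pos i (b := (n : ℤ)) (by omega)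
  have h2 : W i = W (i % n) := per_dvd h (Int.dvd_self_sub_emod)
  rw [h2]
  obtain ⟨k, hk⟩ := Int.eq_ofNat_of_zero_le h0
  unfold lw
  rw [length_wd, hk, Int.toNat_natCast]
  have : k < n := by omega
  simp [wd, this]

lemma wd_lw (w : List Letter) : wd (lw w) w.length = w := by
  apply List.ext_getElem (length_wd _ _)
  intro k h1 h2
  simp only [wd, List.getElem_map, List.getElem_range]
  exact lw_natCast h2

lemma eq_of_lw {u v : List Letter} (hl : u.length = v.length) (h : ∀ i, lw u i = lw v i) : u = v := by
  rw [← wd_lw u, ← wd_lw v, hl, funext h]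

lemma lw_rotate {w : List Letter} (hw : w ≠ []) (k : ℕ) (i : ℤ) : lw (w.rotate k) i = lw w (i + k) := by
  have hl : 0 < w.length := List.length_pos_iff.mpr hw
  have e : w.rotate k = wd (fun i => lw w (i + k)) w.length := by
    apply List.ext_getElem (by simp [length_wd])
    intro j h1 h2
    rw [List.getElem_rotate]
    simp only [wd, List.getElem_map, List.getElem_range]
    rw [← lw_natCast]
    apply per_dvd (lw_per w)
    push_cast
    rw [← dvd_neg, neg_sub]
    exact Int.dvd_self_sub_emod
  rw [e, lw_wd hl]
  intro i
  rw [← lw_per w (i + k)]; congr 1; ring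

lemma lw_reverse {w : List Letter} (hw : w ≠ []) (i : ℤ) : lw w.reverse i = lw w (-1 - i) := by
  have hl : 0 < w.length := List.length_pos_iff.mpr hw
  have e : w.reverse = wd (fun i => lw w (-1 - i)) w.length := by
    apply List.ext_getElem (by simp [length_wd])
    intro j h1 h2
    rw [List.length_reverse] at h1
    rw [List.getElem_reverse]
    simp only [wd, List.getElem_map, List.getElem_range]
    rw [← lw_natCast, ← lw_per w (-1 - j)]
    congr 1
    omega
  rw [e, lw_wd hl]
  intro i
  rw [← lw_per w (-1 - (i + w.length))]; congr 1; ring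

lemma wordEquiv_iff {u v : List Letter} (hu : u ≠ []) (hpar : 2 ∣ u.length) :
    WordEquiv u v ↔ v.length = u.length ∧ ∃ t : ℤ, (t % 2 = 0 ∧ ∀ i, lw v i = lw u (i + t)) ∨
      (t % 2 = 1 ∧ ∀ i, lw v i = lw u (t - i)) := by
  have hl : 0 < u.length := List.length_pos_iff.mpr hu
  have hr : u.reverse ≠ [] := by simpa using hu
  constructor
  · rintro ⟨k, hk, rfl | rfl⟩
    · exact ⟨by simp, k, Or.inl ⟨by omega, lw_rotate hu k⟩⟩
    · refine ⟨by simp, -1 - k, Or.inr ⟨by omega, fun i => ?_⟩⟩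
      rw [lw_rotate hr, lw_reverse hu]; congr 1; ring
  · rintro ⟨hlen, t, ⟨ht, h⟩ | ⟨ht, h⟩⟩
    · have h0 := Int.emod_nonneg t (b := (u.length : ℤ)) (by omega)
      have h2 := Int.emod_emod_of_dvd t (m := 2) (k := (u.length : ℤ)) (by exact_mod_cast hpar)
      refine ⟨(t % u.length).toNat, by omega, Or.inl (eq_of_lw (by simpa using hlen) fun i => ?_)⟩
      rw [h, lw_rotate hu]
      apply per_dvd (lw_per u)
      rw [Int.toNat_of_nonneg h0, add_sub_add_left_eq_sub]
      exact Int.dvd_self_sub_emod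
    · have h0 := Int.emod_nonneg (-1 - t) (b := (u.length : ℤ)) (by omega)
      have h2 := Int.emod_emod_of_dvd (-1 - t) (m := 2) (k := (u.length : ℤ)) (by exact_mod_cast hpar)
      refine ⟨((-1 - t) % u.length).toNat, by omega, Or.inr (eq_of_lw (by simpa using hlen) fun i => ?_)⟩
      rw [h, lw_rotate hr, lw_reverse hu]
      apply per_dvd (lw_per u)
      rw [Int.toNat_of_nonneg h0, ← dvd_neg]
      obtain ⟨m, hm⟩ := Int.dvd_self_sub_emod (x := -1 - t) (m := (u.length : ℤ))
      exact ⟨m, by linarith⟩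

lemma wd_mul {W : ℤ → Letter} {g : ℕ} (h : ∀ i, W (i + g) = W i) (k : ℕ) :
    (List.replicate k (wd W g)).flatten = wd W (k * g) := by
  induction k with
  | zero => simp [wd]
  | succ k ih =>
    rw [List.replicate_succ, List.flatten_cons, ih]
    unfold wd
    rw [add_mul, one_mul, add_comm, List.range_add, List.map_append, List.map_map]
    congr 1
    apply List.map_congr_left
    intro j _
    simp only [Function.comp]
    rw [← h]; congr 1; push_cast; ring

lemma inG_iff {w : List Letter} : InG w ↔ Cur (lw w) w.length ∧ 4 ≤ w.length := by
  constructor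
  · rintro ⟨⟨hne, hred⟩, hprim, hev, h4⟩
    refine ⟨⟨by omega, by omega, lw_per w, fun i => ?_, fun d hd => ?_⟩, h4⟩
    · have h0 := Int.emod_nonneg i (b := (w.length : ℤ)) (by omega)
      have h1 := Int.emod_lt_of_pos i (b := (w.length : ℤ)) (by omega)
      obtain ⟨k, hk⟩ := Int.eq_ofNat_of_zero_le h0
      have hd : (w.length : ℤ) ∣ i - k := by rw [← hk]; exact Int.dvd_self_sub_emod
      rw [per_dvd (lw_per w) hd, per_dvd (lw_per w) (i := i + 1) (j := ((k + 1 : ℕ) : ℤ))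
        (by push_cast; simpa using hd)]
      have := hred k (by omega)
      unfold cget at this
      unfold lw
      exact_mod_cast this
    · by_contra hnd
      have hg : ∀ i, lw w (i + (Int.gcd d w.length : ℕ)) = lw w i := by
        intro i
        rw [Int.gcd_eq_gcd_ab, ← add_assoc, per_mul (lw_per w), per_mul hd]
      have hgn : Int.gcd d w.length ∣ w.length := by exact_mod_cast Int.gcd_dvd_right d w.length
      have hgd : ((Int.gcd d w.length : ℕ) : ℤ) ∣ d := Int.gcd_dvd_left d w.length
      obtain ⟨k, hk⟩ := hgn
      obtain ⟨g, hgg⟩ : ∃ g, g = Int.gcd d w.length := ⟨_, rfl⟩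
      rw [← hgg] at hg hk hgd
      have hk0 : k ≠ 0 := by rintro rfl; omega
      have hk1 : k ≠ 1 := by
        rintro rfl
        rw [mul_one] at hk
        exact hnd (hk ▸ hgd)
      have hg0 : 0 < g := by
        rcases Nat.eq_zero_or_pos g with h | h
        · rw [h] at hk; omega
        · exact h
      apply hprim
      refine ⟨wd (lw w) g, k, by omega, ?_, 0, ?_⟩
      · rw [length_wd]; nlinarith [show 2 ≤ k by omega]
      · rw [wd_mul hg, List.rotate_zero, mul_comm, ← hk, wd_lw]
  · rintro ⟨hC, h4⟩
    have hne : w ≠ [] := by rintro rfl; simp at h4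
    refine ⟨⟨hne, fun i hi => ?_⟩, ?_, by have := hC.even; omega, h4⟩
    · have := hC.red i
      unfold lw at this
      unfold cget
      exact_mod_cast this
    · rintro ⟨u, k, hk, hlt, j, hj⟩
      have hlen : w.length = k * u.length := by
        have := congrArg List.length hj
        simpa using this
      have hu : 0 < u.length := by
        rcases Nat.eq_zero_or_pos u.length with h | h
        · rw [h] at hlen; omega
        · exact h
      have hpu : ∀ i, lw w (i + u.length) = lw w i := by
        have e : ∀ i, lw w i = lw u (i - j) := by
          intro i
          have h1 := lw_rotate hne j (i - j)
          rw [sub_add_cancel, hj] at h1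
          conv at h1 => lhs; rw [← wd_lw u]
          rw [wd_mul (lw_per u), lw_wd (by positivity)] at h1
          · exact h1.symm
          · intro i
            push_cast
            rw [mul_comm, per_mul (lw_per u)]
        intro i
        rw [e, e, ← lw_per u (i - j)]; congr 1; ring
      have := Int.le_of_dvd (by omega) (hC.prim _ hpu)
      omega

lemma gg_phiM {W : ℤ → Letter} (hred : ∀ i, W i ≠ W (i + 1)) : ∀ (l : List Letter) (s : ℤ), 2 ∣ l.length →
    (∀ (k : ℕ) (hk : k < l.length), W (s + k) = l[k]) →
    gg W s * Matrix.SpecialLinearGroup.toGL (phiM l) = gg W (s + l.length)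
  | [], s, _, _ => by simp [phiM]
  | [_], s, h, _ => by simp at h
  | a :: b :: t, s, h, hW => by
    have ha : W s = a := by
      have := hW 0 (by simp)
      rwa [Nat.cast_zero, add_zero] at this
    have hb : W (s + 1) = b := by
      have := hW 1 (by simp)
      rwa [Nat.cast_one] at this
    have hab : a ≠ b := by rw [← ha, ← hb]; exact hred s
    have ih := gg_phiM hred t (s + 2) (by simp at h; omega) (fun k hk => by
      have := hW (k + 2) (by simpa using hk)
      rw [List.getElem_cons_succ, List.getElem_cons_succ] at this
      rw [← this]; congr 1; push_cast; ring)
    rw [phiM, map_mul, toGL_pairM hab, ← ha, ← hb, ← mul_assoc, ← mul_assoc, ← gg_succ, ← gg_succ,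
      add_assoc s 1 1, one_add_one_eq_two, ih]
    congr 1
    simp only [List.length_cons]; push_cast; ring

lemma io_phiM {w : List Letter} (hC : Cur (lw w) w.length) :
    io ⟨phiM w, phiM_mem w⟩ = gg (lw w) w.length := by
  have h1 := gg_phiM hC.red w 0 (by have := hC.even; omega) (fun k hk => by rw [zero_add]; exact lw_natCast hk)
  rw [gg_zero, one_mul, zero_add] at h1
  exact h1

lemma deltaW_iff {w : List Letter} (hw : InG w) : deltaW w = -1 ↔ ∃ p b c t, 1 ≤ b ∧ 0 ≤ c ∧
    2 * (b + c) < (w.length : ℤ) ∧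
      ((∀ i, lw w (t + i) = FW p b c w.length i) ∨ ∀ i, lw w (t - i) = FW p b c w.length i) := by
  obtain ⟨hC, h4⟩ := inG_iff.mp hw
  rw [← sTwo_div_iff hC (by omega) (io_phiM hC), ← Iγ_eq hC (by omega) (io_phiM hC)]
  unfold deltaW Iw Lw
  omega

end

section

variable {p p' q : Letter} {b b' c c' n : ℤ}

lemma FW_per (i : ℤ) : FW p b c n (i + n) = FW p b c n i := by
  unfold FW; rw [Int.add_emod_right]

lemma prv_nxt (p : Letter) : prv (nxt p) = p := by cases p <;> rfl

lemma nxt_nxt (p : Letter) : nxt (nxt p) = prv p := by cases p <;> rfl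

/-- The values of `FW` on a period. -/
lemma FW_eq {i : ℤ} (h0 : 0 ≤ i) (h1 : i < n) : FW p b c n i =
    if i % 2 = 1 then (if i < 2 * (b + c) then nxt p else prv p)
    else if 0 < i ∧ i ≤ 2 * c then prv p else p := by
  unfold FW
  rw [Int.emod_eq_of_lt h0 h1]

lemma FW_neg_one (hbc : 2 * (b + c) < n) (hn : n % 2 = 0) (h : 0 < n) : FW p b c n (-1) = prv p := by
  rw [← FW_per, FW_eq (by omega) (by omega), if_pos (by omega), if_neg (by omega)]

lemma FW_zero (h : 0 < n) : FW p b c n 0 = p := by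
  rw [FW_eq le_rfl h, if_neg (by omega), if_neg (by omega)]

lemma FW_self (h : 0 < n) : FW p b c n n = p := by
  have := FW_per (p := p) (b := b) (c := c) (n := n) 0
  rwa [zero_add, FW_zero h] at this

lemma FW_one (hb : 1 ≤ b) (hc : 0 ≤ c) (hbc : 2 * (b + c) < n) : FW p b c n 1 = nxt p := by
  rw [FW_eq (by omega) (by omega), if_pos (by omega), if_pos (by omega)]

/-- The letters at `i - 1`, `i`, `i + 1` are in cyclic order. -/
def Pos (W : ℤ → Letter) (i : ℤ) : Prop := W (i - 1) = prv (W i) ∧ W (i + 1) = nxt (W i)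

/-- The letters at `i - 1`, `i`, `i + 1` are in reverse cyclic order. -/
def Neg (W : ℤ → Letter) (i : ℤ) : Prop := W (i - 1) = nxt (W i) ∧ W (i + 1) = prv (W i)

lemma pos_FW_zero (hb : 1 ≤ b) (hc : 0 ≤ c) (hbc : 2 * (b + c) < n) (hn : n % 2 = 0) :
    Pos (FW p b c n) 0 := by
  unfold Pos
  rw [zero_sub, zero_add, FW_neg_one hbc hn (by omega), FW_zero (by omega), FW_one hb hc hbc]
  exact ⟨rfl, rfl⟩

lemma pos_FW_one (hb : 1 ≤ b) (hc : 1 ≤ c) (hbc : 2 * (b + c) < n) (hn : n % 2 = 0) :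
    Pos (FW p b c n) 1 := by
  unfold Pos
  rw [sub_self, one_add_one_eq_two, FW_zero (by omega), FW_one hb (by omega) hbc,
    FW_eq (i := 2) (by omega) (by omega), if_neg (by omega), if_pos (by omega), prv_nxt, nxt_nxt]
  exact ⟨rfl, rfl⟩

lemma FW_around (hb : 1 ≤ b) (hc : 0 ≤ c) (hbc : 2 * (b + c) < n) (hn : n % 2 = 0) {P : ℤ → Prop}
    (hP : ∀ i, P (i + n) ↔ P i) (hP0 : P 0) (h : ∀ i, 1 ≤ i → i + 1 < n → P i) (h1 : P (n - 1)) (i : ℤ) : P i := by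
  obtain ⟨m, hm1, hm2⟩ := window_rep (n := n) (by omega) 0 i
  have e : P (i + n * m) ↔ P i := by
    rw [← eq_iff_iff]
    exact per_mul (f := P) (fun i => propext (hP i)) i m
  rw [← e]
  generalize i + n * m = j at *
  rcases eq_or_ne j 0 with rfl | h0
  · exact hP0
  rcases eq_or_ne j (n - 1) with rfl | h2
  · exact h1
  exact h j (by omega) (by omega)

lemma pos_FW (hb : 1 ≤ b) (hc : 0 ≤ c) (hbc : 2 * (b + c) < n) (hn : n % 2 = 0) {i : ℤ}
    (h : Pos (FW p b c n) i) : n ∣ i ∨ 1 ≤ c ∧ n ∣ i - 1 := by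
  revert h
  have hn0 : 0 < n := by omega
  have e1 := nxt_ne p
  have e2 := prv_ne p
  have e3 := nxt_ne_prv p
  refine FW_around (P := fun i => Pos (FW p b c n) i → n ∣ i ∨ 1 ≤ c ∧ n ∣ i - 1) hb hc hbc hn
    (fun i => ?_) ?_ (fun i h1 h2 => ?_) ?_ i
  · unfold Pos
    rw [FW_per, ← sub_add_eq_add_sub, FW_per, add_right_comm, FW_per, dvd_add_self_right, dvd_add_self_right]
  · exact fun _ => Or.inl (dvd_zero n)
  · rintro ⟨g1, g2⟩
    rw [FW_eq (by omega) (by omega), FW_eq (by omega) (by omega)] at g1 g2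
    split_ifs at g1 g2 <;>
      first
      | (exfalso; omega)
      | exact Or.inr ⟨by omega, by rw [show i = 1 by omega, sub_self]; exact dvd_zero n⟩
      | (exfalso; revert g1 g2 e1 e2 e3; cases p <;> simp [nxt, prv])
  · rintro ⟨g1, g2⟩
    rw [sub_add_cancel, FW_self hn0, FW_eq (by omega) (by omega)] at g2
    rw [FW_eq (by omega) (by omega), FW_eq (by omega) (by omega)] at g1
    split_ifs at g1 g2 <;>
      first
      | (exfalso; omega)
      | (exfalso; revert g1 g2 e1 e2 e3; cases p <;> simp [nxt, prv])

lemma neg_FW (hb : 1 ≤ b) (hc : 0 ≤ c) (hbc : 2 * (b + c) < n) (hn : n % 2 = 0) {i : ℤ}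
    (h : Neg (FW p b c n) i) : n ∣ i - 2 * (b + c) ∨ 1 ≤ c ∧ n ∣ i - (2 * c + 1) := by
  revert h
  have hn0 : 0 < n := by omega
  have e1 := nxt_ne p
  have e2 := prv_ne p
  have e3 := nxt_ne_prv p
  refine FW_around (P := fun i => Neg (FW p b c n) i → n ∣ i - 2 * (b + c) ∨ 1 ≤ c ∧ n ∣ i - (2 * c + 1))
    hb hc hbc hn (fun i => ?_) ?_ (fun i h1 h2 => ?_) ?_ i
  · unfold Neg
    rw [FW_per, ← sub_add_eq_add_sub, ← sub_add_eq_add_sub, ← sub_add_eq_add_sub, FW_per, add_right_comm,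
      FW_per, dvd_add_self_right, dvd_add_self_right]
  · rintro ⟨g1, -⟩
    rw [zero_sub, FW_neg_one hbc hn hn0, FW_zero hn0] at g1
    exact absurd g1.symm e3
  · rintro ⟨g1, g2⟩
    rw [FW_eq (by omega) (by omega), FW_eq (by omega) (by omega)] at g1 g2
    split_ifs at g1 g2 <;>
      first
      | (exfalso; omega)
      | exact Or.inr ⟨by omega, by rw [show i = 2 * c + 1 by omega, sub_self]; exact dvd_zero n⟩
      | exact Or.inl (by rw [show i = 2 * (b + c) by omega, sub_self]; exact dvd_zero n)
      | (exfalso; revert g1 g2 e1 e2 e3; cases p <;> simp [nxt, prv])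
  · rintro ⟨g1, g2⟩
    rw [sub_add_cancel, FW_self hn0, FW_eq (by omega) (by omega)] at g2
    rw [FW_eq (by omega) (by omega), FW_eq (by omega) (by omega)] at g1
    split_ifs at g1 g2 <;>
      first
      | (exfalso; omega)
      | (exfalso; revert g1 g2 e1 e2 e3; cases p <;> simp [nxt, prv])

/-- The words `FW` are determined by their parameters and their starting points. -/
lemma FW_inj (hb : 1 ≤ b) (hc : 0 ≤ c) (hbc : 2 * (b + c) < n) (hn : n % 2 = 0) (hb' : 1 ≤ b') (hc' : 0 ≤ c')
    (hbc' : 2 * (b' + c') < n) {t : ℤ} (h : ∀ i, FW p' b' c' n i = FW p b c n (i + t)) :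
    p' = p ∧ b' = b ∧ c' = c ∧ n ∣ t := by
  have hpos : ∀ i, Pos (FW p' b' c' n) i ↔ Pos (FW p b c n) (i + t) := by
    intro i
    unfold Pos
    rw [h, h, h, sub_add_eq_add_sub, add_right_comm]
  have h0 := pos_FW hb hc hbc hn ((hpos 0).mp (pos_FW_zero hb' hc' hbc' hn))
  rw [zero_add] at h0
  have hd : n ∣ t := by
    rcases h0 with h0 | ⟨h1, h0⟩
    · exact h0
    have h2 : Pos (FW p b c n) (-t + t) := by
      rw [neg_add_cancel]; exact pos_FW_zero hb hc hbc hn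
    rcases pos_FW hb' hc' hbc' hn ((hpos _).mpr h2) with h3 | ⟨-, h3⟩
    · exact (dvd_neg.mp h3)
    · exfalso
      have := dvd_add h0 h3
      rw [show t - 1 + (-t - 1) = -2 by ring, dvd_neg] at this
      have := Int.le_of_dvd (by norm_num) this
      omega
  have h' : ∀ i, FW p' b' c' n i = FW p b c n i := fun i => by
    rw [h]; exact per_dvd FW_per (by simpa using hd)
  have hp : p' = p := by
    have := h' 0
    rwa [FW_zero (by omega), FW_zero (by omega)] at this
  subst hp
  have hcc : c' = c := by
    rcases lt_trichotomy c' c with h1 | h1 | h1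
    · have := h' (2 * c' + 2)
      rw [FW_eq (by omega) (by omega), FW_eq (by omega) (by omega)] at this
      split_ifs at this <;> first | (exfalso; omega) | exact absurd this.symm (prv_ne _)
    · exact h1
    · have := h' (2 * c + 2)
      rw [FW_eq (by omega) (by omega), FW_eq (by omega) (by omega)] at this
      split_ifs at this <;> first | (exfalso; omega) | exact absurd this (prv_ne _)
  subst hcc
  refine ⟨rfl, ?_, rfl, hd⟩
  rcases lt_trichotomy b' b with h1 | h1 | h1
  · have := h' (2 * (b' + c') + 1)
    rw [FW_eq (by omega) (by omega), FW_eq (by omega) (by omega)] at this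
    split_ifs at this <;> first | (exfalso; omega) | exact absurd this.symm (nxt_ne_prv _)
  · exact h1
  · have := h' (2 * (b + c') + 1)
    rw [FW_eq (by omega) (by omega), FW_eq (by omega) (by omega)] at this
    split_ifs at this <;> first | (exfalso; omega) | exact absurd this (nxt_ne_prv _)

/-- The words `FW` with `c = 0` or `b = 1` are symmetric. -/
lemma FW_symm (hb : 1 ≤ b) (hc : 0 ≤ c) (hbc : 2 * (b + c) < n) (hn : n % 2 = 0) (h : c = 0 ∨ b = 1) (i : ℤ) :
    FW p b c n (2 * (b + c) - i) = FW p b c n i := by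
  have h0 := Int.emod_nonneg i (b := n) (by omega)
  have h1 := Int.emod_lt_of_pos i (b := n) (by omega)
  have e1 : FW p b c n i = FW p b c n (i % n) := per_dvd FW_per Int.dvd_self_sub_emod
  have e2 : FW p b c n (2 * (b + c) - i) = FW p b c n (2 * (b + c) - i % n) := per_dvd FW_per (by
    rw [sub_sub_sub_cancel_left, ← dvd_neg, neg_sub]; exact Int.dvd_self_sub_emod)
  rw [e1, e2]
  generalize i % n = j at *
  by_cases hj : j ≤ 2 * (b + c)
  · rw [FW_eq (by omega) (by omega), FW_eq h0 h1]
    split_ifs <;> first | rfl | (exfalso; omega)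
  · rw [← FW_per, FW_eq (by omega) (by omega), FW_eq h0 h1]
    split_ifs <;> first | rfl | (exfalso; omega)

/-- The asymmetric words `FW` are not reflections of each other. -/
lemma FW_refl (hb : 1 ≤ b) (hc : 0 ≤ c) (hbc : 2 * (b + c) < n) (hn : n % 2 = 0) (hb' : 1 ≤ b') (hc' : 0 ≤ c')
    (hbc' : 2 * (b' + c') < n) {t : ℤ} (h : ∀ i, FW p' b' c' n i = FW p b c n (t - i)) :
    p' = p ∧ b' = b ∧ c' = c ∧ (c = 0 ∨ b = 1) ∧ t % 2 = 0 := by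
  have key : ∀ {p p' : Letter} {b b' c c' t : ℤ}, 1 ≤ b → 0 ≤ c → 2 * (b + c) < n → 1 ≤ b' → 0 ≤ c' →
      2 * (b' + c') < n → (∀ i, FW p' b' c' n i = FW p b c n (t - i)) → (c = 0 ∨ b = 1) →
      p' = p ∧ b' = b ∧ c' = c ∧ (c = 0 ∨ b = 1) ∧ t % 2 = 0 := by
    intro p p' b b' c c' t hb hc hbc hb' hc' hbc' h hs
    obtain ⟨h1, h2, h3, h4⟩ := FW_inj hb hc hbc hn hb' hc' hbc' (t := 2 * (b + c) - t) (p := p) (p' := p')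
      (fun i => by rw [h, ← FW_symm hb hc hbc hn hs]; congr 1; ring)
    refine ⟨h1, h2, h3, hs, ?_⟩
    have := (Int.dvd_of_emod_eq_zero hn).trans h4
    omega
  by_cases hs : c = 0 ∨ b = 1
  · exact key hb hc hbc hb' hc' hbc' h hs
  have h' : ∀ i, FW p b c n i = FW p' b' c' n (t - i) := fun i => by rw [h, sub_sub_cancel]
  have hneg : ∀ i, Pos (FW p b c n) i → Neg (FW p' b' c' n) (t - i) := by
    intro i hi
    unfold Pos at hi
    rw [h', h', h'] at hi
    refine ⟨?_, ?_⟩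
    · rw [← hi.2]; congr 1; ring
    · rw [← hi.1]; congr 1; ring
  have n0 := neg_FW hb' hc' hbc' hn (hneg _ (pos_FW_zero hb hc hbc hn))
  have n1 := neg_FW hb' hc' hbc' hn (hneg _ (pos_FW_one hb (by omega) hbc hn))
  rw [not_or] at hs
  exfalso
  have hb1 : b' = 1 := by
    rcases n0 with n0 | ⟨-, n0⟩ <;> rcases n1 with n1 | ⟨-, n1⟩
    · have := dvd_sub n0 n1
      rw [show t - 0 - 2 * (b' + c') - (t - 1 - 2 * (b' + c')) = 1 by ring] at this
      have := Int.le_of_dvd (by norm_num) this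
      omega
    · have := dvd_sub n1 n0
      rw [show t - 1 - (2 * c' + 1) - (t - 0 - 2 * (b' + c')) = 2 * b' - 2 by ring] at this
      rcases eq_or_ne b' 1 with h1 | h1
      · exact h1
      have := Int.le_of_dvd (by omega) this
      omega
    · have := dvd_sub n0 n1
      rw [show t - 0 - (2 * c' + 1) - (t - 1 - 2 * (b' + c')) = 2 * b' by ring] at this
      have := Int.le_of_dvd (by omega) this
      omega
    · have := dvd_sub n0 n1
      rw [show t - 0 - (2 * c' + 1) - (t - 1 - (2 * c' + 1)) = 1 by ring] at this
      have := Int.le_of_dvd (by norm_num) this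
      omega
  have := key hb' hc' hbc' hb hc hbc h' (Or.inr hb1)
  omega

lemma cur_FW (hb : 1 ≤ b) (hc : 0 ≤ c) (hbc : 2 * (b + c) < n) (hn : n % 2 = 0) (e : ℤ) :
    Cur (fun i => FW p b c n (i - e)) n := by
  refine ⟨by omega, hn, fun i => ?_, fun i => ?_, fun d hd => ?_⟩
  · rw [← sub_add_eq_add_sub, FW_per]
  · rw [← sub_add_eq_add_sub]
    generalize i - e = j
    refine FW_around (P := fun j => FW p b c n j ≠ FW p b c n (j + 1)) hb hc hbc hn (fun i => ?_) ?_
      (fun i h1 h2 => ?_) ?_ j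
    · rw [add_right_comm, FW_per, FW_per]
    · rw [zero_add, FW_zero (by omega), FW_one hb hc hbc]; exact (nxt_ne _).symm
    · rw [FW_eq (by omega) (by omega), FW_eq (by omega) (by omega)]
      have := nxt_ne p
      have := prv_ne p
      have := nxt_ne_prv p
      split_ifs <;> first | (exfalso; omega) | assumption | (symm; assumption)
    · rw [sub_add_cancel, FW_self (by omega), ← neg_add_eq_sub, FW_per, FW_neg_one hbc hn (by omega)]
      exact prv_ne p
  · refine (FW_inj hb hc hbc hn hb hc hbc (p := p) (p' := p) (t := d) fun i => ?_).2.2.2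
    have := hd (i + e)
    rw [add_sub_cancel_right] at this
    rw [← this]; congr 1; ring

end

section

instance : Fintype Letter := ⟨{.x, .y, .z}, by intro a; cases a <;> simp⟩

lemma gEquiv_iff (u v : GWord) : GEquiv u v ↔ v.1.length = u.1.length ∧
    ∃ t : ℤ, (t % 2 = 0 ∧ ∀ i, lw v.1 i = lw u.1 (i + t)) ∨ (t % 2 = 1 ∧ ∀ i, lw v.1 i = lw u.1 (t - i)) :=
  wordEquiv_iff u.2.1.1 u.2.2.2.1

lemma gEquiv_equivalence : Equivalence GEquiv := by
  refine ⟨fun u => ?_, fun {u v} h => ?_, fun {u v w} h h' => ?_⟩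
  · rw [gEquiv_iff]
    exact ⟨rfl, 0, Or.inl ⟨rfl, fun i => by rw [add_zero]⟩⟩
  · rw [gEquiv_iff] at h ⊢
    obtain ⟨hl, t, ⟨ht, h⟩ | ⟨ht, h⟩⟩ := h
    · exact ⟨hl.symm, -t, Or.inl ⟨by omega, fun i => by rw [h, neg_add_cancel_right]⟩⟩
    · exact ⟨hl.symm, t, Or.inr ⟨ht, fun i => by rw [h, sub_sub_cancel]⟩⟩
  · rw [gEquiv_iff] at h h' ⊢
    obtain ⟨hl, t, ⟨ht, h⟩ | ⟨ht, h⟩⟩ := h <;> obtain ⟨hl', t', ⟨ht', h'⟩ | ⟨ht', h'⟩⟩ := h'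
    · exact ⟨hl'.trans hl, t' + t, Or.inl ⟨by omega, fun i => by rw [h', h, add_assoc]⟩⟩
    · exact ⟨hl'.trans hl, t' + t, Or.inr ⟨by omega, fun i => by rw [h', h, sub_add_eq_add_sub]⟩⟩
    · exact ⟨hl'.trans hl, t - t', Or.inr ⟨by omega, fun i => by rw [h', h]; congr 1; ring⟩⟩
    · exact ⟨hl'.trans hl, t - t', Or.inl ⟨by omega, fun i => by rw [h', h]; congr 1; ring⟩⟩

/-- An index set for the classes of words with `2 * (k + 1)` letters and defect `-1`. -/
abbrev Idx (k : ℕ) : Type := Letter × ((Σ i : Fin k, Fin (i + 1)) ⊕ (Σ i : Fin (k - 2), Fin (i + 1)))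

/-- The first parameter of the word attached to an index. -/
def bI (k : ℕ) (q : Idx k) : ℤ := Sum.elim (fun s => (k : ℤ) - s.1) (fun s => (k : ℤ) - 1 - s.1) q.2

/-- The second parameter of the word attached to an index. -/
def cI (k : ℕ) (q : Idx k) : ℤ := Sum.elim (fun s => (s.2 : ℤ)) (fun s => (s.2 : ℤ) + 1) q.2

/-- The starting point of the word attached to an index. -/
def eI (k : ℕ) (q : Idx k) : ℤ := Sum.elim (fun _ => (0 : ℤ)) (fun _ => (1 : ℤ)) q.2

lemma idx_bounds (k : ℕ) (q : Idx k) : 1 ≤ bI k q ∧ 0 ≤ cI k q ∧ bI k q + cI k q ≤ k ∧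
    (eI k q = 0 ∨ eI k q = 1 ∧ cI k q ≠ 0 ∧ bI k q ≠ 1) := by
  obtain ⟨p, ⟨i, c⟩ | ⟨i, c⟩⟩ := q <;> simp only [bI, cI, eI, Sum.elim_inl, Sum.elim_inr] <;>
    have h1 := i.2 <;> have h2 := c.2
  · exact ⟨by omega, by omega, by omega, Or.inl trivial⟩
  · exact ⟨by omega, by omega, by omega, Or.inr ⟨trivial, by omega, by omega⟩⟩

lemma idx_ext {k : ℕ} {q q' : Idx k} (h1 : q.1 = q'.1) (h2 : bI k q = bI k q') (h3 : cI k q = cI k q')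
    (h4 : eI k q = eI k q') : q = q' := by
  obtain ⟨p, ⟨i, c⟩ | ⟨i, c⟩⟩ := q <;> obtain ⟨p', ⟨i', c'⟩ | ⟨i', c'⟩⟩ := q' <;>
    simp only [bI, cI, eI, Sum.elim_inl, Sum.elim_inr] at h1 h2 h3 h4
  · obtain rfl : i = i' := Fin.ext (by omega)
    obtain rfl : c = c' := Fin.ext (by omega)
    rw [h1]
  · omega
  · omega
  · obtain rfl : i = i' := Fin.ext (by omega)
    obtain rfl : c = c' := Fin.ext (by omega)
    rw [h1]

lemma exists_idx {k : ℕ} (p : Letter) {b c e : ℤ} (hb : 1 ≤ b) (hc : 0 ≤ c) (hbc : b + c ≤ k)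
    (he : e = 0 ∨ e = 1 ∧ c ≠ 0 ∧ b ≠ 1) :
    ∃ q : Idx k, q.1 = p ∧ bI k q = b ∧ cI k q = c ∧ eI k q = e := by
  rcases he with rfl | ⟨rfl, h1, h2⟩
  · refine ⟨(p, Sum.inl ⟨⟨(k - b).toNat, by omega⟩, ⟨c.toNat, by dsimp only; omega⟩⟩), rfl, ?_, ?_, rfl⟩
    · simp only [bI, Sum.elim_inl]; omega
    · simp only [cI, Sum.elim_inl]; omega
  · refine ⟨(p, Sum.inr ⟨⟨(k - 1 - b).toNat, by omega⟩, ⟨(c - 1).toNat, by dsimp only; omega⟩⟩), rfl, ?_, ?_, rfl⟩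
    · simp only [bI, Sum.elim_inr]; omega
    · simp only [cI, Sum.elim_inr]; omega

lemma sum_succ (k : ℕ) : 2 * ∑ i : Fin k, ((i : ℕ) + 1) = k * (k + 1) := by
  rw [Fin.sum_univ_eq_sum_range (fun i => i + 1) k]
  induction k with
  | zero => rfl
  | succ k ih => rw [Finset.sum_range_succ, mul_add, ih]; ring

lemma card_idx (k : ℕ) : 2 * Nat.card (Idx k) = 3 * (k * (k + 1) + (k - 2) * (k - 2 + 1)) := by
  rw [← sum_succ, ← sum_succ, Nat.card_eq_fintype_card, Fintype.card_prod, Fintype.card_sum, Fintype.card_sigma,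
    Fintype.card_sigma]
  simp only [Fintype.card_fin]
  rw [show Fintype.card Letter = 3 from rfl]
  ring

/-- The sequence of letters attached to an index. -/
def seqI (k : ℕ) (q : Idx k) (i : ℤ) : Letter :=
  FW q.1 (bI k q) (cI k q) ((2 * (k + 1) : ℕ) : ℤ) (i - eI k q)

lemma cur_seqI (k : ℕ) (q : Idx k) : Cur (seqI k q) ((2 * (k + 1) : ℕ) : ℤ) := by
  obtain ⟨h1, h2, h3, -⟩ := idx_bounds k q
  exact cur_FW h1 h2 (by omega) (by omega) _

lemma lw_seqI (k : ℕ) (q : Idx k) : lw (wd (seqI k q) (2 * (k + 1))) = seqI k q :=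
  funext fun i => lw_wd (by omega) (cur_seqI k q).per i

/-- The word attached to an index. -/
def wordI {k : ℕ} (hk : 1 ≤ k) (q : Idx k) : GWord :=
  ⟨wd (seqI k q) (2 * (k + 1)), by
    rw [inG_iff, length_wd, lw_seqI]
    exact ⟨cur_seqI k q, by omega⟩⟩

lemma wordI_spec {k : ℕ} (hk : 1 ≤ k) (q : Idx k) : (wordI hk q).1.length = 2 * (k + 1) ∧
    lw (wordI hk q).1 = seqI k q := ⟨length_wd _ _, lw_seqI k q⟩

lemma deltaW_wordI {k : ℕ} (hk : 1 ≤ k) (q : Idx k) : deltaW (wordI hk q).1 = -1 := by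
  obtain ⟨h1, h2, h3, -⟩ := idx_bounds k q
  rw [deltaW_iff (wordI hk q).2, (wordI_spec hk q).1, (wordI_spec hk q).2]
  exact ⟨_, _, _, eI k q, h1, h2, by omega, Or.inl fun i => by rw [seqI, add_sub_cancel_left]⟩

lemma wordI_inj {k : ℕ} (hk : 1 ≤ k) {q q' : Idx k} (h : GEquiv (wordI hk q) (wordI hk q')) : q = q' := by
  obtain ⟨h1, h2, h3, h4⟩ := idx_bounds k q
  obtain ⟨h1', h2', h3', h4'⟩ := idx_bounds k q'
  rw [gEquiv_iff, (wordI_spec hk q).1, (wordI_spec hk q).2, (wordI_spec hk q').1, (wordI_spec hk q').2] at h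
  obtain ⟨-, t, ⟨ht, h⟩ | ⟨ht, h⟩⟩ := h
  · obtain ⟨e1, e2, e3, e4⟩ := FW_inj (p := q.1) (p' := q'.1) (n := ((2 * (k + 1) : ℕ) : ℤ))
      (t := eI k q' + t - eI k q) h1 h2 (by omega) (by omega) h1' h2' (by omega) (fun i => by
        have := h (i + eI k q')
        unfold seqI at this
        rw [add_sub_cancel_right] at this
        rw [this]; congr 1; ring)
    have := (Int.dvd_of_emod_eq_zero (show ((2 * (k + 1) : ℕ) : ℤ) % 2 = 0 by omega)).trans e4
    exact (idx_ext e1 e2 e3 (by omega)).symm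
  · obtain ⟨e1, e2, e3, e4, e5⟩ := FW_refl (p := q.1) (p' := q'.1) (n := ((2 * (k + 1) : ℕ) : ℤ))
      (t := t - eI k q' - eI k q) h1 h2 (by omega) (by omega) h1' h2' (by omega) (fun i => by
        have := h (i + eI k q')
        unfold seqI at this
        rw [add_sub_cancel_right] at this
        rw [this]; congr 1; ring)
    rw [e2, e3] at h4'
    have h0 : eI k q = 0 := h4.resolve_right fun h => e4.elim h.2.1 h.2.2
    have h0' : eI k q' = 0 := h4'.resolve_right fun h => e4.elim h.2.1 h.2.2
    omega

lemma exists_wordI {k : ℕ} (hk : 1 ≤ k) (w : GWord) (hl : w.1.length = 2 * (k + 1)) (hw : deltaW w.1 = -1) :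
    ∃ q, GEquiv w (wordI hk q) := by
  rw [deltaW_iff w.2, hl] at hw
  obtain ⟨p, b, c, t, hb, hc, hbc, h⟩ := hw
  have hn : ((2 * (k + 1) : ℕ) : ℤ) % 2 = 0 := by omega
  have hsym := FW_symm (p := p) hb hc hbc hn
  have key : ∀ e : ℤ, (e = 0 ∨ e = 1 ∧ c ≠ 0 ∧ b ≠ 1) → (∃ t : ℤ, (t % 2 = 0 ∧
      ∀ i, FW p b c ((2 * (k + 1) : ℕ) : ℤ) (i - e) = lw w.1 (i + t)) ∨ (t % 2 = 1 ∧
      ∀ i, FW p b c ((2 * (k + 1) : ℕ) : ℤ) (i - e) = lw w.1 (t - i))) → ∃ q, GEquiv w (wordI hk q) := by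
    intro e he h
    obtain ⟨q, rfl, rfl, rfl, rfl⟩ := exists_idx (k := k) p hb hc (by omega) he
    refine ⟨q, ?_⟩
    rw [gEquiv_iff, (wordI_spec hk q).1, (wordI_spec hk q).2, hl]
    exact ⟨rfl, h⟩
  by_cases hs : c = 0 ∨ b = 1
  · apply key 0 (Or.inl rfl)
    rcases h with h | h
    · rcases Int.emod_two_eq_zero_or_one t with ht | ht
      · exact ⟨t, Or.inl ⟨ht, fun i => by rw [← h]; congr 1; ring⟩⟩
      · refine ⟨t + 2 * (b + c), Or.inr ⟨by omega, fun i => ?_⟩⟩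
        rw [sub_zero, ← hsym hs, ← h]; congr 1; ring
    · rcases Int.emod_two_eq_zero_or_one t with ht | ht
      · refine ⟨t - 2 * (b + c), Or.inl ⟨by omega, fun i => ?_⟩⟩
        rw [sub_zero, ← hsym hs, ← h]; congr 1; ring
      · exact ⟨t, Or.inr ⟨ht, fun i => by rw [← h]; congr 1; ring⟩⟩
  · have h1 : (1 : ℤ) = 0 ∨ (1 : ℤ) = 1 ∧ c ≠ 0 ∧ b ≠ 1 := by rw [not_or] at hs; exact Or.inr ⟨rfl, hs⟩
    rcases h with h | h
    · rcases Int.emod_two_eq_zero_or_one t with ht | ht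
      · exact key 0 (Or.inl rfl) ⟨t, Or.inl ⟨ht, fun i => by rw [← h]; congr 1; ring⟩⟩
      · refine key 1 h1 ⟨t - 1, Or.inl ⟨by omega, fun i => ?_⟩⟩
        rw [← h]; congr 1; ring
    · rcases Int.emod_two_eq_zero_or_one t with ht | ht
      · refine key 1 h1 ⟨t + 1, Or.inr ⟨by omega, fun i => ?_⟩⟩
        rw [← h]; congr 1; ring
      · exact key 0 (Or.inl rfl) ⟨t, Or.inr ⟨ht, fun i => by rw [← h]; congr 1; ring⟩⟩

lemma Ncount_eq_card {k : ℕ} (hk : 1 ≤ k) : Ncount (-1) (k + 1) = Nat.card (Idx k) := by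
  symm
  refine Nat.card_congr (Equiv.ofBijective (fun q => ⟨Quot.mk GEquiv (wordI hk q), wordI hk q, rfl, ?_,
    deltaW_wordI hk q⟩) ⟨fun q q' h => ?_, ?_⟩)
  · rw [Lw, (wordI_spec hk q).1]; omega
  · exact wordI_inj hk ((gEquiv_equivalence.eqvGen_iff).mp (Quot.eqvGen_exact (congrArg Subtype.val h)))
  · rintro ⟨_, w, rfl, h1, h2⟩
    have hev := w.2.2.2.1
    obtain ⟨q, hq⟩ := exists_wordI hk w (by unfold Lw at h1; omega) h2
    exact ⟨q, Subtype.ext (Quot.sound hq).symm⟩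

lemma Ncount_eq_zero {L : ℤ} (hL : L ≤ 1) : Ncount (-1) L = 0 := by
  refine Nat.card_eq_zero.mpr (Or.inl ⟨?_⟩)
  rintro ⟨_, w, -, h, -⟩
  have := w.2.2.2.2
  unfold Lw at h
  omega

lemma Ncount_eq {L : ℤ} (hL : 2 ≤ L) : (Ncount (-1) L : ℤ) = 3 * L ^ 2 - 9 * L + 9 := by
  obtain ⟨k, rfl⟩ : ∃ k : ℕ, L = k + 1 := ⟨(L - 1).toNat, by omega⟩
  rw [Ncount_eq_card (by omega)]
  have h := card_idx k
  rcases eq_or_ne k 1 with rfl | h1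
  · norm_num at h ⊢
    omega
  obtain ⟨j, rfl⟩ : ∃ j, k = j + 2 := ⟨k - 2, by omega⟩
  rw [Nat.add_sub_cancel] at h
  zify at h
  push_cast
  linarith

lemma sum_binC {L : ℤ} (hL : 2 ≤ L) :
    3 * binC (L - 2) 1 + 3 * binC (L - 1) 1 + 6 * binC (L - 2) 2 = 3 * L ^ 2 - 9 * L + 9 := by
  obtain ⟨j, rfl⟩ : ∃ j : ℕ, L = j + 2 := ⟨(L - 2).toNat, by omega⟩
  have e : ∀ m i : ℕ, binC m i = (m.choose i : ℕ) := fun m i => by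
    unfold binC
    rw [if_neg (fun h => absurd h.1 (by omega)), if_pos ⟨by omega, by omega⟩, Int.toNat_natCast, Int.toNat_natCast]
  have e1 := e j 1
  have e2 := e (j + 1) 1
  have e3 := e j 2
  rw [Nat.choose_one_right] at e1 e2
  push_cast at e1 e2 e3
  rw [show (j : ℤ) + 2 - 2 = j by ring, show (j : ℤ) + 2 - 1 = j + 1 by ring, e1, e2, e3]
  have h : 2 * ((j.choose 2 : ℕ) : ℤ) = j * (j - 1) := by
    clear e e1 e2 e3 hL
    induction j with
    | zero => simp
    | succ j ih =>
      rw [Nat.choose_succ_succ', Nat.choose_one_right]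
      push_cast
      linarith
  linarith

lemma sum_binC_zero {L : ℤ} (hL : L ≤ 1) :
    3 * binC (L - 2) 1 + 3 * binC (L - 1) 1 + 6 * binC (L - 2) 2 = 0 := by
  have e : ∀ m i : ℤ, m < 0 → 0 < i → binC m i = 0 := fun m i hm hi => by
    unfold binC
    rw [if_neg (fun h => absurd h.2 (by omega)), if_neg (fun h => absurd h.1 (by omega))]
  rw [e _ _ (by omega) one_pos, e _ _ (by omega) two_pos]
  rcases eq_or_ne L 1 with rfl | h
  · simp [binC]
  · rw [e _ _ (by omega) one_pos]; rfl

end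

end Geo

theorem almost_simple_geodesics_stmt17 :
    (∀ L : ℤ, (Ncount (-1) L : ℤ) =
        3 * binC (L - 2) 1 + 3 * binC (L - 1) 1 + 6 * binC (L - 2) 2) ∧
    (∀ L : ℤ, 3 ≤ L → (Ncount (-1) L : ℤ) = 3 * L ^ 2 - 9 * L + 9) := by
  refine ⟨fun L => ?_, fun L hL => Geo.Ncount_eq (by omega)⟩
  rcases le_or_gt L 1 with h | h
  · rw [Geo.Ncount_eq_zero h, Geo.sum_binC_zero h]; rfl
  · rw [Geo.Ncount_eq h, Geo.sum_binC h]
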